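/- Let Ω be an open set of finite Lebesgue measure in ℝⁿ, n ≥ 2, let m ∈ ℕ with m < n, and let d ∈ [n−m, n]. Let ‖·‖_X and ‖·‖_Y be rearrangement-invariant function norms on (0,1), and let μ be a finite Borel measure on Ω satisfying sup_{x ∈ ℝⁿ, r > 0} μ(B_r(x) ∩ Ω)/r^d < ∞. Assume that there exists a constant C₁ such that ‖ t ↦ ∫_{t^{n/d}}^1 f(s) s^{−1+m/n} ds ‖_Y ≤ C₁ ‖f‖_X for every nonnegative non-increasing measurable f on (0,1). Then there exists a constant C₂ such that for every u ∈ C_c^∞(Ω): ‖ t ↦ u*_μ(μ(Ω)·t) ‖_Y ≤ C₂ ‖ t ↦ (|∇^m u|)*(|Ω|·t) ‖_X, where u*_μ is the non-increasing rearrangement of u with respect to μ and (|∇^m u|)* is the non-increasing rearrangement of |∇^m u| with respect to Lebesgue measure. -/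

import Mathlib

open MeasureTheory Set
open scoped ENNReal NNReal

/-- Lebesgue measure on the interval `(0,1)`. -/
noncomputable def vol01 : MeasureTheory.Measure ℝ :=
  MeasureTheory.volume.restrict (Set.Ioo 0 1)

/-- The non-increasing rearrangement on `(0,1)` of an extended-nonnegative function. -/
noncomputable def decRearr (f : ℝ → ℝ≥0∞) (s : ℝ) : ℝ≥0∞ :=
  sInf {ρ : ℝ≥0∞ | vol01 {t | ρ < f t} ≤ ENNReal.ofReal s}

/-- The non-increasing rearrangement of a real-valued function with respect to a measure. -/
noncomputable def rearr {α : Type*} [MeasurableSpace α] (ν : MeasureTheory.Measure α)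
    (u : α → ℝ) (s : ℝ) : ℝ≥0∞ :=
  sInf {ρ : ℝ≥0∞ | ν {x | ρ < ENNReal.ofReal |u x|} ≤ ENNReal.ofReal s}

/-- A rearrangement-invariant function norm on `(0,1)`: properties (P1)–(P6). -/
structure IsRINorm (N : (ℝ → ℝ≥0∞) → ℝ≥0∞) : Prop where
  eq_zero_iff : ∀ f : ℝ → ℝ≥0∞, N f = 0 ↔ (∀ᵐ t ∂vol01, f t = 0)
  smul : ∀ (c : ℝ≥0) (f : ℝ → ℝ≥0∞), N (fun t => (c : ℝ≥0∞) * f t) = (c : ℝ≥0∞) * N f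
  add_le : ∀ f g : ℝ → ℝ≥0∞, N (fun t => f t + g t) ≤ N f + N g
  mono : ∀ f g : ℝ → ℝ≥0∞, (∀ᵐ t ∂vol01, f t ≤ g t) → N f ≤ N g
  iSup_eq : ∀ (f : ℕ → ℝ → ℝ≥0∞) (g : ℝ → ℝ≥0∞),
    (∀ k, ∀ᵐ t ∂vol01, f k t ≤ f (k + 1) t) →
    (∀ᵐ t ∂vol01, (⨆ k, f k t) = g t) → N g = ⨆ k, N (f k)
  indicator_lt_top : ∀ E : Set ℝ, MeasurableSet E → E ⊆ Set.Ioo 0 1 → N (E.indicator 1) < ⊤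
  exists_integral_le : ∀ E : Set ℝ, MeasurableSet E → E ⊆ Set.Ioo 0 1 →
    ∃ C : ℝ≥0, ∀ f : ℝ → ℝ≥0∞, (∫⁻ t in E, f t) ≤ (C : ℝ≥0∞) * N f
  rearr_invariant : ∀ f g : ℝ → ℝ≥0∞, decRearr f = decRearr g → N f = N g

/-- The Hardy-type operator `S₁f(t) = ∫_{t^{n/d}}^1 f(s) s^{-1+m/n} ds`. -/
noncomputable def S1 (n m : ℕ) (d : ℝ) (f : ℝ → ℝ≥0∞) (t : ℝ) : ℝ≥0∞ :=
  ∫⁻ s in Set.Ioo (t ^ ((n : ℝ) / d)) 1, ENNReal.ofReal (s ^ ((m : ℝ) / n - 1)) * f s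

/-- The Hardy-type operator
`S₂f(t) = t^{-m/(n-d)} ∫_0^{t^{n/d}} f(s) s^{-1+m/(n-d)} ds`. -/
noncomputable def S2 (n m : ℕ) (d : ℝ) (f : ℝ → ℝ≥0∞) (t : ℝ) : ℝ≥0∞ :=
  ENNReal.ofReal (t ^ (-((m : ℝ) / ((n : ℝ) - d)))) *
    ∫⁻ s in Set.Ioo (0 : ℝ) (t ^ ((n : ℝ) / d)),
      ENNReal.ofReal (s ^ ((m : ℝ) / ((n : ℝ) - d) - 1)) * f s

/-- The non-increasing rearrangement of an extended-nonnegative function with respect to an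
arbitrary measure. -/
noncomputable def levelRearr {α : Type*} [MeasurableSpace α] (ν : Measure α)
    (h : α → ℝ≥0∞) (s : ℝ) : ℝ≥0∞ :=
  sInf {ρ : ℝ≥0∞ | ν {x | ρ < h x} ≤ ENNReal.ofReal s}

section levelRearr

variable {α : Type*} [MeasurableSpace α]

theorem lt_levelRearr_iff (ν : Measure α) (h : α → ℝ≥0∞) (s : ℝ) (ρ : ℝ≥0∞) :
    ρ < levelRearr ν h s ↔ ENNReal.ofReal s < ν {x | ρ < h x} := by
  constructor
  · intro hρ
    by_contra hcon
    have hle : levelRearr ν h s ≤ ρ := sInf_le (not_lt.mp hcon)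
    exact absurd hle (not_le.mpr hρ)
  · intro hlt
    rcases eq_or_ne ρ ⊤ with rfl | hρ
    · simp at hlt
    obtain ⟨v, hv_anti, hv_gt, hv_lim⟩ := exists_seq_strictAnti_tendsto' (lt_top_iff_ne_top.mpr hρ)
    have hU : {x | ρ < h x} = ⋃ i, {x | v i < h x} := by
      ext x
      simp only [mem_ofPred_eq, mem_iUnion]
      constructor
      · intro hx
        exact (hv_lim.eventually (gt_mem_nhds hx)).exists
      · rintro ⟨i, hi⟩
        exact (hv_gt i).1.trans hi
    have hmono : Monotone fun i => {x | v i < h x} := by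
      intro i j hij x hx
      exact lt_of_le_of_lt (hv_anti.antitone hij) hx
    rw [hU, hmono.directed_le.measure_iUnion, lt_iSup_iff] at hlt
    obtain ⟨i, hi⟩ := hlt
    refine lt_of_lt_of_le (hv_gt i).1 (le_sInf fun ρ' hρ' => ?_)
    by_contra hcon
    have : {x | v i < h x} ⊆ {x | ρ' < h x} := fun x hx => (not_le.mp hcon).trans hx
    exact absurd ((measure_mono this).trans hρ') (not_le.mpr hi)

theorem measure_levelRearr_lt_le (ν : Measure α) (h : α → ℝ≥0∞) (s : ℝ) :
    ν {x | levelRearr ν h s < h x} ≤ ENNReal.ofReal s := by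
  by_contra hcon
  exact lt_irrefl _ ((lt_levelRearr_iff ν h s _).mpr (not_le.mp hcon))

theorem levelRearr_antitone (ν : Measure α) (h : α → ℝ≥0∞) : Antitone (levelRearr ν h) :=
  fun _ _ hab => sInf_le_sInf fun _ hρ => le_trans hρ (ENNReal.ofReal_le_ofReal hab)

theorem volume_Ioi_lt_eq (a : ℝ≥0∞) :
    volume {s : ℝ | 0 < s ∧ ENNReal.ofReal s < a} = a := by
  rcases eq_or_ne a ⊤ with rfl | ha
  · have : {s : ℝ | 0 < s ∧ ENNReal.ofReal s < ⊤} = Ioi 0 := by ext; simp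
    rw [this, Real.volume_Ioi]
  · have : {s : ℝ | 0 < s ∧ ENNReal.ofReal s < a} = Ioo 0 a.toReal := by
      ext s
      simp only [mem_ofPred_eq, mem_Ioo, and_congr_right_iff]
      intro hs
      exact ENNReal.ofReal_lt_iff_lt_toReal hs.le ha
    rw [this, Real.volume_Ioo, sub_zero, ENNReal.ofReal_toReal ha]

theorem vol01_ofReal_lt (a : ℝ≥0∞) :
    vol01 {s : ℝ | ENNReal.ofReal s < a} = min a 1 := by
  rw [vol01, Measure.restrict_apply
    (measurableSet_lt ENNReal.measurable_ofReal measurable_const)]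
  rw [← volume_Ioi_lt_eq (min a 1)]
  congr 1
  ext s
  simp only [mem_inter_iff, mem_ofPred_eq, mem_Ioo, lt_min_iff]
  rw [show (1 : ℝ≥0∞) = ENNReal.ofReal 1 by simp]
  constructor
  · rintro ⟨h1, h2, h3⟩
    exact ⟨h2, h1, (ENNReal.ofReal_lt_ofReal_iff one_pos).mpr h3⟩
  · rintro ⟨h1, h2, h3⟩
    exact ⟨h2, h1, (ENNReal.ofReal_lt_ofReal_iff one_pos).mp h3⟩

/-- Layer-cake formula for an extended-nonnegative function. -/
theorem lintegral_eq_lintegral_level (ν : Measure α) [SFinite ν] {h : α → ℝ≥0∞}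
    (hh : Measurable h) :
    ∫⁻ x, h x ∂ν = ∫⁻ r in Ioi (0 : ℝ), ν {x | ENNReal.ofReal r < h x} := by
  have hset : MeasurableSet {z : α × ℝ | ENNReal.ofReal z.2 < h z.1} :=
    measurableSet_lt (ENNReal.measurable_ofReal.comp measurable_snd) (hh.comp measurable_fst)
  have h1 : ∀ x, h x = ∫⁻ r in Ioi (0 : ℝ),
      {z : α × ℝ | ENNReal.ofReal z.2 < h z.1}.indicator 1 (x, r) := by
    intro x
    have : (fun r : ℝ => {z : α × ℝ | ENNReal.ofReal z.2 < h z.1}.indicator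
        (1 : α × ℝ → ℝ≥0∞) (x, r)) = {r : ℝ | ENNReal.ofReal r < h x}.indicator 1 := by
      ext r; simp [indicator]
    rw [this, lintegral_indicator_one
      (measurableSet_lt ENNReal.measurable_ofReal measurable_const),
      Measure.restrict_apply (measurableSet_lt ENNReal.measurable_ofReal measurable_const)]
    conv_lhs => rw [← volume_Ioi_lt_eq (h x)]
    congr 1
    ext s; simp [and_comm]
  rw [lintegral_congr h1, lintegral_lintegral_swap (f := fun x r =>
    {z : α × ℝ | ENNReal.ofReal z.2 < h z.1}.indicator (1 : α × ℝ → ℝ≥0∞) (x, r))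
    ((measurable_one.indicator hset).aemeasurable)]
  refine lintegral_congr fun r => ?_
  have : (fun x : α => {z : α × ℝ | ENNReal.ofReal z.2 < h z.1}.indicator
      (1 : α × ℝ → ℝ≥0∞) (x, r)) = {x : α | ENNReal.ofReal r < h x}.indicator 1 := by
    ext x; simp [indicator]
  rw [this, lintegral_indicator_one (measurableSet_lt measurable_const hh)]

theorem lintegral_levelRearr (ν : Measure α) [SFinite ν] {h : α → ℝ≥0∞} (hh : Measurable h) :
    ∫⁻ s in Ioi (0 : ℝ), levelRearr ν h s = ∫⁻ x, h x ∂ν := by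
  rw [lintegral_eq_lintegral_level ν hh,
    lintegral_eq_lintegral_level _ (levelRearr_antitone ν h).measurable]
  refine setLIntegral_congr_fun measurableSet_Ioi fun r _ => ?_
  simp only [lt_levelRearr_iff]
  rw [Measure.restrict_apply (measurableSet_lt ENNReal.measurable_ofReal measurable_const)]
  conv_rhs => rw [← volume_Ioi_lt_eq (ν {x | ENNReal.ofReal r < h x})]
  congr 1
  ext s; simp [and_comm]

end levelRearr

namespace IsRINorm

variable {N : (ℝ → ℝ≥0∞) → ℝ≥0∞}

theorem decRearr_eq (hN : IsRINorm N) (f : ℝ → ℝ≥0∞) : N (decRearr f) = N f := by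
  refine hN.rearr_invariant _ _ ?_
  ext1 s
  have key : ∀ ρ, vol01 {t | ρ < decRearr f t} = vol01 {t | ρ < f t} := by
    intro ρ
    have : {t | ρ < decRearr f t} = {t | ENNReal.ofReal t < vol01 {t | ρ < f t}} := by
      ext t; exact lt_levelRearr_iff vol01 f t ρ
    rw [this, vol01_ofReal_lt, min_eq_left]
    refine (measure_mono (subset_univ _)).trans ?_
    simp [vol01]
  simp only [decRearr] at key ⊢
  simp only [key]

theorem le_of_distribution (hN : IsRINorm N) {f g : ℝ → ℝ≥0∞}
    (h : ∀ ρ, vol01 {t | ρ < f t} ≤ vol01 {t | ρ < g t}) : N f ≤ N g := by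
  rw [← hN.decRearr_eq f, ← hN.decRearr_eq g]
  exact hN.mono _ _ (.of_forall fun s => sInf_le_sInf fun ρ hρ => (h ρ).trans hρ)

theorem sum_le (hN : IsRINorm N) {ι : Type*} (s : Finset ι) (f : ι → ℝ → ℝ≥0∞) :
    N (fun t => ∑ i ∈ s, f i t) ≤ ∑ i ∈ s, N (f i) := by
  classical
  induction s using Finset.induction_on with
  | empty =>
    simp only [Finset.sum_empty, nonpos_iff_eq_zero]
    exact (hN.eq_zero_iff _).mpr (.of_forall fun _ => rfl)
  | insert a s ha ih =>
    simp only [Finset.sum_insert ha]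
    exact (hN.add_le _ _).trans (by gcongr)

end IsRINorm

namespace IsRINorm

variable {N : (ℝ → ℝ≥0∞) → ℝ≥0∞}

/-- Comparison of functions through pieces: `f` is carried by sets `S i` where `f ≤ c i`, and `g`
is at least `c i` on disjoint sets `T i` that are no smaller. -/
theorem le_of_pieces (hN : IsRINorm N) {ι : Type*} [Countable ι] {f g : ℝ → ℝ≥0∞}
    (S T : ι → Set ℝ) (c : ι → ℝ≥0∞)
    (hf : ∀ t ∈ Ioo (0 : ℝ) 1, f t = 0 ∨ ∃ i, t ∈ S i ∧ f t ≤ c i)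
    (hTm : ∀ i, MeasurableSet (T i)) (hTd : Pairwise (fun i j => Disjoint (T i) (T j)))
    (hT : ∀ i, T i ⊆ Ioo 0 1) (hg : ∀ i, ∀ t ∈ T i, c i ≤ g t)
    (hST : ∀ i, volume (S i) ≤ volume (T i)) : N f ≤ N g := by
  refine hN.le_of_distribution fun ρ => ?_
  calc vol01 {t | ρ < f t}
      ≤ volume (⋃ i : {i // ρ < c i}, S i) := by
        rw [vol01, Measure.restrict_apply' measurableSet_Ioo]
        refine measure_mono ?_
        rintro t ⟨ht, ht01⟩
        rcases hf t ht01 with h0 | ⟨i, hi, hle⟩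
        · simp [h0] at ht
        · exact mem_iUnion.mpr ⟨⟨i, lt_of_lt_of_le ht hle⟩, hi⟩
    _ ≤ ∑' i : {i // ρ < c i}, volume (S i) := measure_iUnion_le _
    _ ≤ ∑' i : {i // ρ < c i}, volume (T i) := ENNReal.tsum_le_tsum fun i => hST i
    _ = volume (⋃ i : {i // ρ < c i}, T i) := by
        exact (measure_iUnion (fun i j hij => hTd fun h => hij (Subtype.ext h))
          fun i => hTm i).symm
    _ ≤ vol01 {t | ρ < g t} := by
        rw [vol01, Measure.restrict_apply' measurableSet_Ioo]
        refine measure_mono (iUnion_subset fun i t ht => ⟨?_, hT i ht⟩)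
        exact lt_of_lt_of_le i.2 (hg i t ht)

theorem exists_dyadic {t : ℝ} (ht : t ∈ Ioo (0 : ℝ) 1) :
    ∃ k : ℕ, (1 / 2 : ℝ) ^ (k + 1) ≤ t ∧ t < (1 / 2 : ℝ) ^ k := by
  obtain ⟨k, hk1, hk2⟩ := exists_nat_pow_near_of_lt_one ht.1 ht.2.le
    (by norm_num : (0 : ℝ) < 1 / 2) (by norm_num)
  rcases hk2.lt_or_eq with h | h
  · exact ⟨k, hk1.le, h⟩
  · rcases k with _ | k
    · simp at h; exact absurd h ht.2.ne
    · refine ⟨k, h.ge, ?_⟩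
      rw [h]
      exact pow_lt_pow_right_of_lt_one₀ (by norm_num) (by norm_num) (Nat.lt_succ_self k)

theorem dilation_half_le (hN : IsRINorm N) {f : ℝ → ℝ≥0∞} (hf : AntitoneOn f (Ioo 0 1)) :
    N (fun t => f (t / 2)) ≤ 4 * N f := by
  let S : ℕ → ℕ → Set ℝ := fun i k =>
    Ico ((1 / 2 : ℝ) ^ (k + 1) * (1 + i / 4)) ((1 / 2 : ℝ) ^ (k + 1) * (1 + (i + 1) / 4))
  have hpow : ∀ k : ℕ, (0 : ℝ) < (1 / 2) ^ k := fun k => by positivity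
  have hpow1 : ∀ k : ℕ, ((1 : ℝ) / 2) ^ k ≤ 1 := fun k =>
    pow_le_one₀ (by norm_num) (by norm_num)
  have hcover : ∀ t ∈ Ioo (0 : ℝ) 1,
      f (t / 2) ≤ ∑ i ∈ Finset.range 4, (⋃ k, S i k).indicator (fun t => f (t / 2)) t := by
    intro t ht
    obtain ⟨k, hk1, hk2⟩ := exists_dyadic ht
    have hkp := hpow (k + 1)
    have hdiv : t < (1 / 2 : ℝ) ^ (k + 1) * 2 := by rw [pow_succ]; linarith
    have : ∃ i < 4, t ∈ S i k := by
      by_contra! hcon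
      have h0 := hcon 0 (by norm_num)
      have h1 := hcon 1 (by norm_num)
      have h2 := hcon 2 (by norm_num)
      have h3 := hcon 3 (by norm_num)
      simp only [S, mem_Ico, not_and, not_lt] at h0 h1 h2 h3
      norm_num at h0 h1 h2 h3 hk1 hdiv
      have := h3 (h2 (h1 (h0 hk1)))
      linarith
    obtain ⟨i, hi4, hi⟩ := this
    have hmem : t ∈ ⋃ k, S i k := mem_iUnion.mpr ⟨k, hi⟩
    refine le_trans (le_of_eq ?_) (Finset.single_le_sum (fun _ _ => zero_le)
      (Finset.mem_range.mpr hi4))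
    rw [indicator_of_mem hmem]
  have hpiece : ∀ i : ℕ, N ((⋃ k, S i k).indicator (fun t => f (t / 2))) ≤ N f := by
    intro i
    refine hN.le_of_pieces (S i) (fun k => Ico ((1 / 2 : ℝ) ^ (k + 3)) ((1 / 2) ^ (k + 2)))
      (fun k => f ((1 / 2) ^ (k + 2))) ?_ (fun k => measurableSet_Ico) ?_ ?_ ?_ ?_
    · intro t ht
      by_cases hmem : t ∈ ⋃ k, S i k
      · right
        obtain ⟨k, hk⟩ := mem_iUnion.mp hmem
        refine ⟨k, hk, ?_⟩
        rw [indicator_of_mem hmem]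
        have h1 := hk.1
        have hkp := hpow (k + 1)
        have h2 : (1 / 2 : ℝ) ^ (k + 1) ≤ t := by
          refine le_trans ?_ h1
          have : (0 : ℝ) ≤ i / 4 := by positivity
          nlinarith
        refine hf ⟨hpow _, ?_⟩ ⟨by linarith [ht.1], by linarith [ht.2]⟩ ?_
        · exact pow_lt_one₀ (by norm_num) (by norm_num) (by omega)
        · rw [pow_succ]; linarith
      · left; exact indicator_of_notMem hmem _
    · have := (pow_right_strictAnti₀ (by norm_num : (0 : ℝ) < 1 / 2) (by norm_num)).antitone
      have hmono : Antitone fun k : ℕ => (1 / 2 : ℝ) ^ (k + 2) :=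
        fun a b hab => this (Nat.add_le_add_right hab 2)
      exact fun i j hij => hmono.pairwise_disjoint_on_Ico_succ hij
    · intro k t ht
      exact ⟨(hpow _).trans_le ht.1, ht.2.trans_le (hpow1 _)⟩
    · intro k t ht
      refine hf ⟨(hpow _).trans_le ht.1, ht.2.trans_le (hpow1 _)⟩ ⟨hpow _, ?_⟩ ht.2.le
      exact pow_lt_one₀ (by norm_num) (by norm_num) (by omega)
    · intro k
      simp only [S, Real.volume_Ico]
      refine ENNReal.ofReal_le_ofReal (le_of_eq ?_)
      ring
  calc N (fun t => f (t / 2))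
      ≤ N (fun t => ∑ i ∈ Finset.range 4, (⋃ k, S i k).indicator (fun t => f (t / 2)) t) := by
        refine hN.mono _ _ ?_
        rw [vol01]
        exact (ae_restrict_iff' measurableSet_Ioo).mpr (.of_forall hcover)
    _ ≤ ∑ i ∈ Finset.range 4, N ((⋃ k, S i k).indicator (fun t => f (t / 2))) := hN.sum_le _ _
    _ ≤ ∑ i ∈ Finset.range 4, N f := Finset.sum_le_sum fun i _ => hpiece i
    _ = 4 * N f := by simp

theorem dilation_eighth_le (hN : IsRINorm N) {f : ℝ → ℝ≥0∞} (hf : AntitoneOn f (Ioo 0 1)) :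
    N (fun t => f (t / 8)) ≤ 64 * N f := by
  have hhalf : ∀ {g : ℝ → ℝ≥0∞}, AntitoneOn g (Ioo 0 1) →
      AntitoneOn (fun t => g (t / 2)) (Ioo 0 1) := by
    intro g hg a ha b hb hab
    exact hg ⟨by linarith [ha.1], by linarith [ha.2]⟩ ⟨by linarith [hb.1], by linarith [hb.2]⟩
      (by linarith)
  have h1 := hN.dilation_half_le hf
  have h2 := hN.dilation_half_le (hhalf hf)
  have h3 := hN.dilation_half_le (hhalf (hhalf hf))
  have he : (fun t : ℝ => f (t / 8)) = fun t => f (t / 2 / 2 / 2) := by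
    ext t; congr 1; ring
  rw [he]
  calc _ ≤ 4 * (4 * (4 * N f)) := h3.trans (by gcongr; exact h2.trans (by gcongr))
    _ = 64 * N f := by rw [← mul_assoc, ← mul_assoc]; norm_num

end IsRINorm

theorem tsum_indicator_const_of_mem {I : ℕ → Set ℝ}
    (hI : Pairwise fun i j => Disjoint (I i) (I j)) (v : ℕ → ℝ≥0∞) {t : ℝ} {k : ℕ}
    (ht : t ∈ I k) : ∑' j, (I j).indicator (fun _ => v j) t = v k := by
  rw [tsum_eq_single k, indicator_of_mem ht]
  intro j hj
  exact indicator_of_notMem (fun h => Set.disjoint_left.mp (hI hj) h ht) _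

theorem setLIntegral_Ico_le_sum {G : ℝ → ℝ≥0∞} {a h : ℝ} (hh : 0 < h) (M : ℕ)
    (hG : AntitoneOn G (Ioo a (a + (M + 1) * h))) :
    ∫⁻ t in Ico (a + h) (a + (M + 1) * h), G t ≤
      ENNReal.ofReal h * ∑ j ∈ Finset.range M, G (a + (j + 1) * h) := by
  induction M with
  | zero => simp
  | succ M ih =>
    have hM : (0 : ℝ) ≤ M := Nat.cast_nonneg M
    push_cast at hG ⊢
    have hsub : Ico (a + h) (a + (M + 1 + 1) * h) ⊆
        Ico (a + h) (a + (M + 1) * h) ∪ Ico (a + (M + 1) * h) (a + (M + 1 + 1) * h) :=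
      Ico_subset_Ico_union_Ico
    refine (lintegral_mono_set hsub).trans ((lintegral_union_le _ _ _).trans ?_)
    rw [Finset.sum_range_succ, mul_add]
    refine add_le_add (ih (hG.mono (Ioo_subset_Ioo le_rfl (by nlinarith)))) ?_
    calc ∫⁻ t in Ico (a + (M + 1) * h) (a + (M + 1 + 1) * h), G t
        ≤ ∫⁻ _ in Ico (a + (M + 1) * h) (a + (M + 1 + 1) * h), G (a + (M + 1) * h) := by
          refine setLIntegral_mono' measurableSet_Ico fun t ht => hG ?_ ?_ ht.1
          · constructor <;> nlinarith
          · exact ⟨by nlinarith [ht.1], ht.2⟩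
      _ = ENNReal.ofReal h * G (a + (M + 1) * h) := by
          rw [setLIntegral_const, Real.volume_Ico, mul_comm]
          congr 2; ring

namespace IsRINorm

variable {N : (ℝ → ℝ≥0∞) → ℝ≥0∞}

theorem shifted_average_le (hN : IsRINorm N) (M : ℕ) {a l : ℕ → ℝ} {G : ℝ → ℝ≥0∞}
    (hl : ∀ k, 0 < l k)
    (hd : Pairwise fun i j => Disjoint (Ico (a i) (a i + l i)) (Ico (a j) (a j + l j)))
    (h01 : ∀ k, Ico (a k) (a k + l k) ⊆ Ioo 0 1)
    (hG : ∀ k, AntitoneOn G (Ico (a k) (a k + l k))) :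
    N (fun t => ∑' k, (Ico (a k) (a k + l k)).indicator (fun _ => (ENNReal.ofReal (l k))⁻¹ *
      ∫⁻ s in Ico (a k + l k / (M + 1)) (a k + l k), G s) t) ≤ N G := by
  classical
  have hM : (0 : ℝ) < M + 1 := by positivity
  let h : ℕ → ℝ := fun k => l k / (M + 1)
  have hh : ∀ k, 0 < h k := fun k => div_pos (hl k) hM
  have hhl : ∀ k, a k + (M + 1) * h k = a k + l k := fun k => by
    simp only [h]; field_simp
  let S : ℕ × Fin (M + 1) → Set ℝ := fun p =>
    Ico (a p.1 + p.2 * h p.1) (a p.1 + (p.2 + 1) * h p.1)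
  have hlt : ∀ q : Fin (M + 1), ((q : ℕ) : ℝ) + 1 ≤ M + 1 := fun q => by
    exact_mod_cast q.2
  have hSI : ∀ p, S p ⊆ Ico (a p.1) (a p.1 + l p.1) := by
    rintro ⟨k, q⟩ t ⟨h1, h2⟩
    have := hh k
    have hq := hlt q
    have hq0 : (0 : ℝ) ≤ (q : ℕ) := Nat.cast_nonneg _
    simp only at h1 h2
    constructor
    · nlinarith
    · rw [← hhl]; nlinarith
  have hSd : Pairwise fun p p' => Disjoint (S p) (S p') := by
    rintro ⟨k, q⟩ ⟨k', q'⟩ hne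
    by_cases hk : k = k'
    · subst hk
      refine Set.disjoint_left.mpr fun t ht ht' => hne ?_
      have hq : q = q' := by
        have h1 := ht.1; have h2 := ht.2; have h3 := ht'.1; have h4 := ht'.2
        simp only at h1 h2 h3 h4
        have hk := hh k
        have e1 : ((q : ℕ) : ℝ) < (q' : ℕ) + 1 := by
          by_contra! hc; nlinarith
        have e2 : ((q' : ℕ) : ℝ) < (q : ℕ) + 1 := by
          by_contra! hc; nlinarith
        have e3 : (q : ℕ) < q' + 1 := by exact_mod_cast e1
        have e4 : (q' : ℕ) < q + 1 := by exact_mod_cast e2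
        exact Fin.ext (by omega)
      rw [hq]
    · exact (hd hk).mono (hSI _) (hSI _)
  let c : ℕ → Fin (M + 1) → ℝ≥0∞ := fun k j =>
    if (j : ℕ) < M then G (a k + (j + 1) * h k) else 0
  let f : Fin (M + 1) → ℝ → ℝ≥0∞ := fun i t =>
    if ht : ∃ p, t ∈ S p then c ht.choose.1 (ht.choose.2 + i) else 0
  have hfN : ∀ i, N (f i) ≤ N G := by
    intro i
    refine hN.le_of_pieces S (fun p => S (p.1, p.2 + i)) (fun p => c p.1 (p.2 + i)) ?_
      (fun p => measurableSet_Ico) ?_ (fun p => (hSI _).trans (h01 _)) ?_ ?_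
    · intro t _
      by_cases ht : ∃ p, t ∈ S p
      · right
        exact ⟨ht.choose, ht.choose_spec, by simp only [f, dif_pos ht]; exact le_rfl⟩
      · left; simp only [f, dif_neg ht]
    · rintro ⟨k, q⟩ ⟨k', q'⟩ hne
      refine hSd fun he => hne ?_
      simp only [Prod.mk.injEq, add_left_inj] at he
      rw [he.1, he.2]
    · rintro ⟨k, q⟩ t ht
      simp only [c]
      split_ifs with hq
      · have h1 := ht.1; have h2 := ht.2
        have hk := hh k
        have hq' : (((q + i : Fin (M + 1)) : ℕ) : ℝ) + 1 ≤ M := by exact_mod_cast hq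
        have hq0 : (0 : ℝ) ≤ ((q + i : Fin (M + 1)) : ℕ) := Nat.cast_nonneg _
        simp only at h1 h2
        refine hG k ⟨by nlinarith, ?_⟩ ⟨by nlinarith, ?_⟩ h2.le
        · rw [← hhl]; nlinarith
        · rw [← hhl]; nlinarith
      · exact zero_le
    · rintro ⟨k, q⟩
      simp only [S, Real.volume_Ico]
      refine ENNReal.ofReal_le_ofReal (le_of_eq ?_)
      ring
  let w : ℝ≥0 := (M + 1 : ℝ≥0)⁻¹
  have hw : (w : ℝ≥0∞) * ((M : ℝ≥0∞) + 1) = 1 := by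
    have : w * ((M : ℝ≥0) + 1) = 1 := inv_mul_cancel₀ (by positivity)
    exact_mod_cast congrArg (fun x : ℝ≥0 => (x : ℝ≥0∞)) this
  have hwh : ∀ k, (ENNReal.ofReal (l k))⁻¹ * ENNReal.ofReal (h k) = w := by
    intro k
    rw [← ENNReal.ofReal_inv_of_pos (hl k), ← ENNReal.ofReal_mul (by have := hl k; positivity)]
    rw [← ENNReal.ofReal_coe_nnreal]
    congr 1
    have := (hl k).ne'
    simp only [h, w]; push_cast; field_simp
  have hle : ∀ t, ∑' k, (Ico (a k) (a k + l k)).indicator (fun _ => (ENNReal.ofReal (l k))⁻¹ *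
      ∫⁻ s in Ico (a k + l k / (M + 1)) (a k + l k), G s) t ≤ w * ∑ i, f i t := by
    intro t
    by_cases ht : ∃ k, t ∈ Ico (a k) (a k + l k)
    · obtain ⟨k, hk⟩ := ht
      rw [tsum_indicator_const_of_mem hd _ hk]
      have hex : ∃ p, t ∈ S p := by
        have h1 := hk.1; have h2 := hk.2
        have hkp := hh k
        have hnn : 0 ≤ (t - a k) / h k := div_nonneg (by linarith) hkp.le
        refine ⟨(k, ⟨⌊(t - a k) / h k⌋₊, ?_⟩), ?_, ?_⟩
        · rw [Nat.floor_lt hnn, div_lt_iff₀ hkp]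
          have := hhl k
          push_cast
          linarith
        · have := Nat.floor_le hnn
          rw [le_div_iff₀ hkp] at this
          simp only; linarith
        · have := Nat.lt_floor_add_one ((t - a k) / h k)
          rw [div_lt_iff₀ hkp] at this
          simp only; linarith
      have hf : ∀ i, f i t = c hex.choose.1 (hex.choose.2 + i) := fun i => dif_pos hex
      have hkk : hex.choose.1 = k := by
        by_contra hne
        exact Set.disjoint_left.mp (hd hne) (hSI _ hex.choose_spec) hk
      simp only [hf, hkk]
      rw [show ∑ i, c k (hex.choose.2 + i) = ∑ i, c k i from
        Equiv.sum_comp (Equiv.addLeft hex.choose.2) (c k), ← hwh k, mul_assoc, ← hhl k]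
      gcongr
      refine (setLIntegral_Ico_le_sum (hh k) M ?_).trans ?_
      · rw [hhl]; exact (hG k).mono Ioo_subset_Ico_self
      · gcongr
        rw [Fin.sum_univ_castSucc, Finset.sum_range]
        refine le_trans (Finset.sum_le_sum fun i _ => ?_) le_self_add
        simp only [c]
        rw [if_pos (by simp)]
        simp
    · push Not at ht
      rw [ENNReal.tsum_eq_zero.mpr fun k => indicator_of_notMem (ht k) _]
      exact zero_le
  calc _ ≤ N (fun t => (w : ℝ≥0∞) * ∑ i, f i t) := hN.mono _ _ (.of_forall hle)
    _ = w * N (fun t => ∑ i, f i t) := hN.smul _ _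
    _ ≤ w * ∑ i, N (f i) := by gcongr; exact hN.sum_le _ _
    _ ≤ w * ∑ i : Fin (M + 1), N G := by gcongr with i; exact hfN i
    _ = N G := by
      rw [Finset.sum_const, Finset.card_univ, Fintype.card_fin, nsmul_eq_mul, ← mul_assoc]
      push_cast
      rw [hw, one_mul]

/-- Averaging a function over disjoint intervals on which it is non-increasing does not increase
its norm. -/
theorem average_le (hN : IsRINorm N) {a l : ℕ → ℝ} {G : ℝ → ℝ≥0∞}
    (hl : ∀ k, 0 < l k)
    (hd : Pairwise fun i j => Disjoint (Ico (a i) (a i + l i)) (Ico (a j) (a j + l j)))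
    (h01 : ∀ k, Ico (a k) (a k + l k) ⊆ Ioo 0 1)
    (hG : ∀ k, AntitoneOn G (Ico (a k) (a k + l k))) :
    N (fun t => ∑' k, (Ico (a k) (a k + l k)).indicator (fun _ => (ENNReal.ofReal (l k))⁻¹ *
      ∫⁻ s in Ioo (a k) (a k + l k), G s) t) ≤ N G := by
  have hmono : ∀ k, Monotone fun M : ℕ => Ico (a k + l k / (M + 1)) (a k + l k) := by
    intro k M M' hMM
    refine Ico_subset_Ico_left ?_
    have : (M : ℝ) ≤ M' := by exact_mod_cast hMM
    have := hl k
    gcongr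
  have hU : ∀ k, ⋃ M : ℕ, Ico (a k + l k / (M + 1)) (a k + l k) = Ioo (a k) (a k + l k) := by
    intro k
    ext t
    simp only [mem_iUnion, mem_Ico, mem_Ioo]
    constructor
    · rintro ⟨M, h1, h2⟩
      have : 0 < l k / (M + 1) := div_pos (hl k) (by positivity)
      exact ⟨by linarith, h2⟩
    · rintro ⟨h1, h2⟩
      obtain ⟨M, hM⟩ := exists_nat_gt (l k / (t - a k))
      refine ⟨M, ?_, h2⟩
      have h3 : 0 < t - a k := by linarith
      rw [div_lt_iff₀ h3] at hM
      have : l k / (M + 1) ≤ t - a k := by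
        rw [div_le_iff₀ (by positivity)]; nlinarith
      linarith
  rw [hN.iSup_eq (fun M t => ∑' k, (Ico (a k) (a k + l k)).indicator
    (fun _ => (ENNReal.ofReal (l k))⁻¹ *
      ∫⁻ s in Ico (a k + l k / (M + 1)) (a k + l k), G s) t)]
  · exact iSup_le fun M => hN.shifted_average_le M hl hd h01 hG
  · refine fun M => .of_forall fun t => ENNReal.tsum_le_tsum fun k => indicator_le_indicator ?_
    gcongr
    · exact (hl k).le
    · exact le_of_lt (lt_add_one _)
  · refine .of_forall fun t => ?_
    by_cases ht : ∃ k, t ∈ Ico (a k) (a k + l k)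
    · obtain ⟨k, hk⟩ := ht
      simp only [tsum_indicator_const_of_mem hd _ hk]
      rw [← ENNReal.mul_iSup, ← setLIntegral_iUnion_of_directed _ (hmono k).directed_le, hU]
    · push Not at ht
      have : ∀ v : ℕ → ℝ≥0∞, ∑' k, (Ico (a k) (a k + l k)).indicator (fun _ => v k) t = 0 :=
        fun v => ENNReal.tsum_eq_zero.mpr fun k => indicator_of_notMem (ht k) _
      simp only [this, iSup_const]

end IsRINorm

section Potential

variable {E : Type*} [NormedAddCommGroup E] [NormedSpace ℝ E]

theorem enorm_iteratedFDeriv_ray_le {u : E → ℝ} (hu : ContDiff ℝ (⊤ : ℕ∞) u)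
    (hc : HasCompactSupport u) (x : E) {ω : E} (hω : ω ≠ 0) (i : ℕ) (r : ℝ) :
    ‖iteratedFDeriv ℝ i u (x + r • ω)‖ₑ ≤
      ‖ω‖ₑ * ∫⁻ s in Iic r, ‖iteratedFDeriv ℝ (i + 1) u (x + s • ω)‖ₑ := by
  have hW : ContDiff ℝ 1 (iteratedFDeriv ℝ i u) := by
    apply hu.iteratedFDeriv_right (i := i) (m := 1)
    exact_mod_cast le_top
  have hWc : HasCompactSupport (iteratedFDeriv ℝ i u) := hc.iteratedFDeriv i
  have hline : ContDiff ℝ 1 fun s : ℝ => x + s • ω := by fun_prop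
  have hcl : Topology.IsClosedEmbedding fun s : ℝ => x + s • ω :=
    (Homeomorph.addLeft x).isClosedEmbedding.comp (isClosedEmbedding_smul_left hω)
  have h1 : ContDiff ℝ 1 fun s : ℝ => iteratedFDeriv ℝ i u (x + s • ω) := hW.comp hline
  have h2 : HasCompactSupport fun s : ℝ => iteratedFDeriv ℝ i u (x + s • ω) :=
    hWc.comp_isClosedEmbedding hcl
  refine (HasCompactSupport.enorm_le_lintegral_Ici_deriv h1 h2 r).trans ?_
  rw [← lintegral_const_mul' _ _ enorm_ne_top]
  refine lintegral_mono fun s => ?_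
  have hd : HasDerivAt (fun s : ℝ => iteratedFDeriv ℝ i u (x + s • ω))
      (fderiv ℝ (iteratedFDeriv ℝ i u) (x + s • ω) ω) s := by
    have hl : HasDerivAt (fun s : ℝ => x + s • ω) ω s := by
      simpa using ((hasDerivAt_id s).smul_const ω).const_add x
    exact ((hW.differentiable one_ne_zero) _).hasFDerivAt.comp_hasDerivAt s hl
  rw [hd.deriv, mul_comm]
  have := (fderiv ℝ (iteratedFDeriv ℝ i u) (x + s • ω)).le_opENorm ω
  refine this.trans (le_of_eq ?_)
  congr 1
  rw [← ofReal_norm, ← ofReal_norm, norm_fderiv_iteratedFDeriv]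

theorem enorm_le_ray_integral {u : E → ℝ} (hu : ContDiff ℝ (⊤ : ℕ∞) u)
    (hc : HasCompactSupport u) (x : E) {ω : E} (hω : ω ≠ 0) (j : ℕ) :
    ‖u x‖ₑ ≤ ‖ω‖ₑ ^ (j + 1) *
      ∫⁻ s in Iic (0 : ℝ), ‖s‖ₑ ^ j * ‖iteratedFDeriv ℝ (j + 1) u (x + s • ω)‖ₑ := by
  have hcont : ∀ i, Continuous fun s : ℝ => ‖iteratedFDeriv ℝ i u (x + s • ω)‖ₑ := fun i =>
    (((hu.continuous_iteratedFDeriv (m := i) (by exact_mod_cast le_top)).comp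
      (by fun_prop : Continuous fun s : ℝ => x + s • ω))).enorm
  induction j with
  | zero =>
    have := enorm_iteratedFDeriv_ray_le hu hc x hω 0 0
    simp only [zero_smul, add_zero] at this
    rw [← ofReal_norm, norm_iteratedFDeriv_zero, ofReal_norm] at this
    simpa using this
  | succ j ih =>
    refine ih.trans ?_
    rw [pow_succ _ (j + 1), mul_assoc]
    gcongr
    calc ∫⁻ s in Iic (0 : ℝ), ‖s‖ₑ ^ j * ‖iteratedFDeriv ℝ (j + 1) u (x + s • ω)‖ₑ
        ≤ ∫⁻ s in Iic (0 : ℝ), ‖s‖ₑ ^ j *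
          (‖ω‖ₑ * ∫⁻ t in Iic s, ‖iteratedFDeriv ℝ (j + 2) u (x + t • ω)‖ₑ) := by
          gcongr with s
          exact enorm_iteratedFDeriv_ray_le hu hc x hω (j + 1) s
      _ = ‖ω‖ₑ * ∫⁻ s in Iic (0 : ℝ), ∫⁻ t, ‖s‖ₑ ^ j *
          (Iic s).indicator (fun t => ‖iteratedFDeriv ℝ (j + 2) u (x + t • ω)‖ₑ) t := by
          rw [← lintegral_const_mul' _ _ enorm_ne_top]
          refine lintegral_congr fun s => ?_
          rw [lintegral_const_mul' _ _ (by finiteness), lintegral_indicator measurableSet_Iic]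
          ring
      _ = ‖ω‖ₑ * ∫⁻ t, ∫⁻ s in Iic (0 : ℝ), ‖s‖ₑ ^ j *
          (Iic s).indicator (fun t => ‖iteratedFDeriv ℝ (j + 2) u (x + t • ω)‖ₑ) t := by
          rw [lintegral_lintegral_swap]
          refine Measurable.aemeasurable ?_
          refine Measurable.mul (by fun_prop) ?_
          have hms : MeasurableSet {z : ℝ × ℝ | z.2 ≤ z.1} :=
            measurableSet_le measurable_snd measurable_fst
          exact (((hcont (j + 2)).measurable.comp measurable_snd).indicator hms)
      _ ≤ ‖ω‖ₑ * ∫⁻ t in Iic (0 : ℝ),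
          ‖t‖ₑ ^ (j + 1) * ‖iteratedFDeriv ℝ (j + 2) u (x + t • ω)‖ₑ := by
          gcongr ‖ω‖ₑ * ?_
          rw [← lintegral_indicator measurableSet_Iic]
          refine lintegral_mono fun t => ?_
          rw [← lintegral_indicator measurableSet_Iic]
          calc ∫⁻ s, (Iic (0 : ℝ)).indicator (fun s => ‖s‖ₑ ^ j * (Iic s).indicator
                (fun t => ‖iteratedFDeriv ℝ (j + 2) u (x + t • ω)‖ₑ) t) s
              ≤ ∫⁻ s, (Icc t 0).indicator (fun _ => ‖t‖ₑ ^ j *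
                ‖iteratedFDeriv ℝ (j + 2) u (x + t • ω)‖ₑ) s := by
                refine lintegral_mono fun s => ?_
                by_cases hs : t ≤ s ∧ s ≤ 0
                · rw [indicator_of_mem (show s ∈ Iic (0 : ℝ) from hs.2),
                    indicator_of_mem (show t ∈ Iic s from hs.1),
                    indicator_of_mem (show s ∈ Icc t 0 from hs)]
                  gcongr
                  rw [Real.enorm_eq_ofReal_abs, Real.enorm_eq_ofReal_abs]
                  refine ENNReal.ofReal_le_ofReal ?_
                  rw [abs_of_nonpos hs.2, abs_of_nonpos (hs.1.trans hs.2)]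
                  linarith [hs.1]
                · refine le_of_eq_of_le ?_ zero_le
                  by_cases h0 : s ∈ Iic (0 : ℝ)
                  · rw [indicator_of_mem h0, indicator_of_notMem (fun h : t ∈ Iic s => hs ⟨h, h0⟩), mul_zero]
                  · rw [indicator_of_notMem h0]
            _ ≤ _ := by
                rw [lintegral_indicator measurableSet_Icc, setLIntegral_const, Real.volume_Icc]
                by_cases ht : t ≤ 0
                · rw [indicator_of_mem (show t ∈ Iic (0 : ℝ) from ht), zero_sub, pow_succ,
                    Real.enorm_eq_ofReal_abs t, abs_of_nonpos ht]
                  exact le_of_eq (by ring)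
                · rw [ENNReal.ofReal_of_nonpos (by linarith), mul_zero]
                  exact zero_le

variable [FiniteDimensional ℝ E] [MeasurableSpace E] [BorelSpace E]
  (ν : Measure E) [ν.IsAddHaarMeasure]

theorem lintegral_comp_add_smul (x : E) {s : ℝ} (hs : s ≠ 0) {F : E → ℝ≥0∞} (hF : Measurable F) :
    ∫⁻ ω, F (x + s • ω) ∂ν =
      ENNReal.ofReal |(s ^ Module.finrank ℝ E)⁻¹| * ∫⁻ y, F y ∂ν := by
  calc ∫⁻ ω, F (x + s • ω) ∂ν = ∫⁻ y, F (x + y) ∂(Measure.map (s • ·) ν) := by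
        exact (lintegral_map (hF.comp (measurable_const_add x)) (measurable_const_smul s)).symm
    _ = _ := by
        rw [Measure.map_addHaar_smul ν hs, lintegral_smul_measure, lintegral_add_left_eq_self]
        rfl

theorem setLIntegral_shell_comp_add_smul (x : E) {s : ℝ} (hs : s ≠ 0) {F : E → ℝ≥0∞}
    (hF : Measurable F) :
    ∫⁻ ω in {ω : E | 1 < ‖ω‖ ∧ ‖ω‖ < 2}, F (x + s • ω) ∂ν =
      ENNReal.ofReal |(s ^ Module.finrank ℝ E)⁻¹| *
        ∫⁻ y in {y | |s| < ‖y - x‖ ∧ ‖y - x‖ < 2 * |s|}, F y ∂ν := by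
  have hm1 : MeasurableSet {ω : E | 1 < ‖ω‖ ∧ ‖ω‖ < 2} :=
    (measurableSet_lt measurable_const measurable_norm).inter
      (measurableSet_lt measurable_norm measurable_const)
  have hn : Measurable fun y : E => ‖y - x‖ := by fun_prop
  have hm2 : MeasurableSet {y : E | |s| < ‖y - x‖ ∧ ‖y - x‖ < 2 * |s|} :=
    (measurableSet_lt measurable_const hn).inter (measurableSet_lt hn measurable_const)
  rw [← lintegral_indicator hm1, ← lintegral_indicator hm2,
    ← lintegral_comp_add_smul ν x hs (hF.indicator hm2)]
  refine lintegral_congr fun ω => ?_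
  have hs' : 0 < |s| := abs_pos.mpr hs
  have : (ω ∈ {ω : E | 1 < ‖ω‖ ∧ ‖ω‖ < 2}) ↔
      (x + s • ω) ∈ {y | |s| < ‖y - x‖ ∧ ‖y - x‖ < 2 * |s|} := by
    simp only [mem_ofPred_eq, add_sub_cancel_left, norm_smul, Real.norm_eq_abs]
    constructor
    · rintro ⟨h1, h2⟩; constructor <;> nlinarith
    · rintro ⟨h1, h2⟩; constructor <;> nlinarith
  by_cases h : ω ∈ {ω : E | 1 < ‖ω‖ ∧ ‖ω‖ < 2}
  · rw [indicator_of_mem h, indicator_of_mem (this.mp h)]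
  · rw [indicator_of_notMem h, indicator_of_notMem (fun h' => h (this.mpr h'))]

/-- The radial weight obtained when a ray integral is averaged over directions. -/
theorem lintegral_radial_weight_le {N j : ℕ} (hj : j + 1 ≤ N) (ρ : ℝ) (hρ : 0 ≤ ρ) :
    ∫⁻ s in Iio (0 : ℝ), ‖s‖ₑ ^ j * ENNReal.ofReal |(s ^ N)⁻¹| *
      {s : ℝ | |s| < ρ ∧ ρ < 2 * |s|}.indicator 1 s ≤
      2 ^ N * (ENNReal.ofReal ρ ^ (N - (j + 1)))⁻¹ := by
  rcases hρ.eq_or_lt with rfl | hρ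
  · simp
  calc _ ≤ ∫⁻ s, (Ioo (-ρ) (-(ρ / 2))).indicator
        (fun _ => ENNReal.ofReal (ρ ^ j * (2 / ρ) ^ N)) s := by
        rw [← lintegral_indicator measurableSet_Iio]
        refine lintegral_mono fun s => ?_
        by_cases hs : s < 0 ∧ |s| < ρ ∧ ρ < 2 * |s|
        · have h1 := abs_of_neg hs.1
          rw [indicator_of_mem (show s ∈ Iio (0 : ℝ) from hs.1),
            indicator_of_mem (show s ∈ {s : ℝ | |s| < ρ ∧ ρ < 2 * |s|} from hs.2),
            indicator_of_mem (show s ∈ Ioo (-ρ) (-(ρ / 2)) from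
              ⟨by linarith [hs.2.1], by linarith [hs.2.2]⟩)]
          rw [Pi.one_apply, mul_one, Real.enorm_eq_ofReal_abs,
            ← ENNReal.ofReal_pow (abs_nonneg s), ← ENNReal.ofReal_mul (by positivity)]
          refine ENNReal.ofReal_le_ofReal ?_
          have h2 : |(s ^ N)⁻¹| ≤ (2 / ρ) ^ N := by
            rw [abs_inv, abs_pow, ← inv_pow]
            have h3 : 0 < |s| := abs_pos.mpr hs.1.ne
            gcongr
            rw [inv_le_comm₀ h3 (by positivity), inv_div]
            linarith [hs.2.2]
          have h4 := hs.2.1.le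
          gcongr
        · refine le_of_eq_of_le ?_ zero_le
          by_cases h0 : s ∈ Iio (0 : ℝ)
          · rw [indicator_of_mem h0, 
              indicator_of_notMem (fun h : s ∈ {s : ℝ | |s| < ρ ∧ ρ < 2 * |s|} => hs ⟨h0, h⟩),
              mul_zero]
          · rw [indicator_of_notMem h0]
    _ ≤ ENNReal.ofReal (ρ ^ j * (2 / ρ) ^ N) * ENNReal.ofReal ρ := by
        rw [lintegral_indicator measurableSet_Ioo, setLIntegral_const, Real.volume_Ioo]
        gcongr
        linarith
    _ = _ := by
        rw [← ENNReal.ofReal_mul (by positivity), ← ENNReal.ofReal_pow hρ.le,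
          ← ENNReal.ofReal_inv_of_pos (by positivity)]
        rw [show (2 : ℝ≥0∞) ^ N = ENNReal.ofReal (2 ^ N) by
          rw [ENNReal.ofReal_pow (by norm_num)]; simp]
        rw [← ENNReal.ofReal_mul (by positivity)]
        congr 1
        obtain ⟨k, rfl⟩ := Nat.exists_eq_add_of_le hj
        rw [Nat.add_sub_cancel_left, div_pow]
        field_simp
        ring

/-- Pointwise estimate of a test function by the Riesz potential of a higher derivative. -/
theorem exists_enorm_le_riesz_potential {j : ℕ} (hj : j + 1 ≤ Module.finrank ℝ E) :
    ∃ C : ℝ≥0, ∀ u : E → ℝ, ContDiff ℝ (⊤ : ℕ∞) u → HasCompactSupport u → ∀ x,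
      ‖u x‖ₑ ≤ C * ∫⁻ y, ‖iteratedFDeriv ℝ (j + 1) u y‖ₑ *
        (ENNReal.ofReal ‖y - x‖ ^ (Module.finrank ℝ E - (j + 1)))⁻¹ ∂ν := by
  set N := Module.finrank ℝ E
  let K : Set E := {ω : E | 1 < ‖ω‖ ∧ ‖ω‖ < 2}
  have hKo : IsOpen K := (isOpen_lt continuous_const continuous_norm).inter
    (isOpen_lt continuous_norm continuous_const)
  have : Nontrivial E := Module.nontrivial_of_finrank_pos (R := ℝ) (by omega)
  have hKne : K.Nonempty := by
    obtain ⟨ω, hω⟩ := exists_norm_eq E (by norm_num : (0 : ℝ) ≤ 3 / 2)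
    exact ⟨ω, by simp only [K, mem_ofPred_eq, hω]; norm_num⟩
  have hK0 : ν K ≠ 0 := (hKo.measure_pos ν hKne).ne'
  have hKt : ν K ≠ ⊤ := by
    refine ((measure_mono ?_).trans_lt (measure_ball_lt_top (μ := ν) (x := (0 : E)) (r := 2))).ne
    intro ω hω
    simpa using hω.2
  refine ⟨((ν K)⁻¹ * (2 ^ (j + 1) * 2 ^ N)).toNNReal, fun u hu hc x => ?_⟩
  rw [ENNReal.coe_toNNReal (ENNReal.mul_ne_top (ENNReal.inv_ne_top.mpr hK0) (by finiteness))]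
  let F : E → ℝ≥0∞ := fun y => ‖iteratedFDeriv ℝ (j + 1) u y‖ₑ
  have hF : Measurable F :=
    (hu.continuous_iteratedFDeriv (m := j + 1) (by exact_mod_cast le_top)).enorm.measurable
  have key : ν K * ‖u x‖ₑ ≤ 2 ^ (j + 1) * (2 ^ N * ∫⁻ y, F y *
      (ENNReal.ofReal ‖y - x‖ ^ (N - (j + 1)))⁻¹ ∂ν) := by
    calc ν K * ‖u x‖ₑ = ∫⁻ ω in K, ‖u x‖ₑ ∂ν := by rw [setLIntegral_const, mul_comm]
      _ ≤ ∫⁻ ω in K, (2 ^ (j + 1) * ∫⁻ s in Iio (0 : ℝ), ‖s‖ₑ ^ j * F (x + s • ω)) ∂ν := by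
          refine setLIntegral_mono' hKo.measurableSet fun ω hω => ?_
          have hω0 : ω ≠ 0 := by
            rintro rfl
            have := hω.1
            norm_num at this
          refine (enorm_le_ray_integral hu hc x hω0 j).trans ?_
          rw [Measure.restrict_congr_set Iio_ae_eq_Iic]
          gcongr
          rw [← ofReal_norm]
          refine (ENNReal.ofReal_le_ofReal hω.2.le).trans ?_
          simp
      _ = 2 ^ (j + 1) * ∫⁻ s in Iio (0 : ℝ), ∫⁻ ω in K, ‖s‖ₑ ^ j * F (x + s • ω) ∂ν := by
          rw [lintegral_const_mul' _ _ (by finiteness), lintegral_lintegral_swap]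
          refine Measurable.aemeasurable ?_
          exact Measurable.mul (by fun_prop) (hF.comp (by fun_prop))
      _ = 2 ^ (j + 1) * ∫⁻ s in Iio (0 : ℝ), ∫⁻ y, F y * (‖s‖ₑ ^ j *
          ENNReal.ofReal |(s ^ N)⁻¹| *
            {s : ℝ | |s| < ‖y - x‖ ∧ ‖y - x‖ < 2 * |s|}.indicator 1 s) ∂ν := by
          congr 1
          refine setLIntegral_congr_fun measurableSet_Iio fun s hs => ?_
          have hs0 : s ≠ 0 := ne_of_lt hs
          rw [lintegral_const_mul' _ _ (by finiteness),
            setLIntegral_shell_comp_add_smul ν x hs0 hF, ← lintegral_indicator, ← mul_assoc,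
            ← lintegral_const_mul' _ _ (by finiteness)]
          · refine lintegral_congr fun y => ?_
            by_cases hy : |s| < ‖y - x‖ ∧ ‖y - x‖ < 2 * |s|
            · rw [indicator_of_mem (by exact hy), indicator_of_mem (by exact hy), Pi.one_apply]
              ring
            · rw [indicator_of_notMem (by exact hy), indicator_of_notMem (by exact hy)]
              ring
          · have hn : Measurable fun y : E => ‖y - x‖ := by fun_prop
            exact (measurableSet_lt measurable_const hn).inter
              (measurableSet_lt hn measurable_const)
      _ = 2 ^ (j + 1) * ∫⁻ y, F y * (∫⁻ s in Iio (0 : ℝ), (‖s‖ₑ ^ j *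
          ENNReal.ofReal |(s ^ N)⁻¹| *
            {s : ℝ | |s| < ‖y - x‖ ∧ ‖y - x‖ < 2 * |s|}.indicator 1 s)) ∂ν := by
          rw [lintegral_lintegral_swap]
          · congr 1
            refine lintegral_congr fun y => ?_
            rw [lintegral_const_mul' _ _ enorm_ne_top]
          · refine Measurable.aemeasurable ?_
            have hm3 : Measurable fun z : ℝ × E => |z.1| := by fun_prop
            have hm4 : Measurable fun z : ℝ × E => ‖z.2 - x‖ := by fun_prop
            have hms : MeasurableSet {z : ℝ × E | |z.1| < ‖z.2 - x‖ ∧ ‖z.2 - x‖ < 2 * |z.1|} :=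
              (measurableSet_lt hm3 hm4).inter (measurableSet_lt hm4 (hm3.const_mul 2))
            refine (hF.comp measurable_snd).mul (Measurable.mul (by fun_prop) ?_)
            exact (measurable_one.indicator hms : Measurable
              ({z : ℝ × E | |z.1| < ‖z.2 - x‖ ∧ ‖z.2 - x‖ < 2 * |z.1|}.indicator
                (1 : ℝ × E → ℝ≥0∞)))
      _ ≤ 2 ^ (j + 1) * ∫⁻ y, F y *
          (2 ^ N * (ENNReal.ofReal ‖y - x‖ ^ (N - (j + 1)))⁻¹) ∂ν := by
          gcongr with y
          exact lintegral_radial_weight_le hj _ (norm_nonneg _)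
      _ = _ := by
          rw [← lintegral_const_mul' (2 ^ N) _ (by finiteness)]
          congr 1
          refine lintegral_congr fun y => ?_
          ring
  calc ‖u x‖ₑ = (ν K)⁻¹ * (ν K * ‖u x‖ₑ) := by
        rw [← mul_assoc, ENNReal.inv_mul_cancel hK0 hKt, one_mul]
    _ ≤ _ := by
        refine (mul_le_mul_right key _).trans (le_of_eq ?_)
        simp only [F]; ring

end Potential

section Kernels

variable {E : Type*} [NormedAddCommGroup E] [NormedSpace ℝ E]
  [FiniteDimensional ℝ E] [MeasurableSpace E] [BorelSpace E]
  (ν : Measure E) [ν.IsAddHaarMeasure]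

theorem exists_lintegral_ball_inv_pow_le {q : ℕ} (hq : q < Module.finrank ℝ E) :
    ∃ C : ℝ, 0 < C ∧ ∀ (x : E) (R : ℝ), 0 < R →
      ∫⁻ y in Metric.ball x R, (ENNReal.ofReal ‖y - x‖ ^ q)⁻¹ ∂ν ≤
        ENNReal.ofReal (C * R ^ (Module.finrank ℝ E - q)) := by
  set N := Module.finrank ℝ E
  have : Nontrivial E := Module.nontrivial_of_finrank_pos (R := ℝ) (by omega)
  set b := (ν (Metric.ball (0 : E) 1)).toReal
  have hb0 : ν (Metric.ball (0 : E) 1) ≠ 0 := (Metric.measure_ball_pos ν 0 one_pos).ne'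
  have hbt : ν (Metric.ball (0 : E) 1) ≠ ⊤ := measure_ball_lt_top.ne
  have hb : 0 < b := ENNReal.toReal_pos hb0 hbt
  refine ⟨2 ^ q * b * 2, by positivity, fun x R hR => ?_⟩
  let r : ℕ → ℝ := fun k => (1 / 2) ^ k * R
  have hr : ∀ k, 0 < r k := fun k => by positivity
  calc ∫⁻ y in Metric.ball x R, (ENNReal.ofReal ‖y - x‖ ^ q)⁻¹ ∂ν
      ≤ ∫⁻ y, ∑' k, (Metric.ball x (r k)).indicator
          (fun _ => ENNReal.ofReal ((r (k + 1) ^ q)⁻¹)) y ∂ν := by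
        rw [← lintegral_indicator measurableSet_ball]
        refine lintegral_mono_ae ?_
        have hne : ∀ᵐ y ∂ν, y ≠ x := by
          rw [ae_iff]; simp
        filter_upwards [hne] with y hy
        by_cases hyR : y ∈ Metric.ball x R
        · rw [indicator_of_mem hyR]
          have h0 : 0 < ‖y - x‖ := norm_pos_iff.mpr (sub_ne_zero.mpr hy)
          have h1 : ‖y - x‖ < R := by simpa [dist_eq_norm] using hyR
          obtain ⟨k, hk1, hk2⟩ := IsRINorm.exists_dyadic (t := ‖y - x‖ / R)
            ⟨by positivity, by rwa [div_lt_one hR]⟩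
          rw [le_div_iff₀ hR] at hk1
          rw [div_lt_iff₀ hR] at hk2
          refine le_trans ?_ (ENNReal.le_tsum k)
          rw [indicator_of_mem (by rw [Metric.mem_ball, dist_eq_norm]; exact hk2),
            ENNReal.ofReal_inv_of_pos (pow_pos (hr _) _), ENNReal.ofReal_pow (hr _).le]
          gcongr
        · rw [indicator_of_notMem hyR]; exact zero_le
    _ = ∑' k, ENNReal.ofReal ((r (k + 1) ^ q)⁻¹) * ν (Metric.ball x (r k)) := by
        rw [lintegral_tsum fun k => (measurable_const.indicator measurableSet_ball).aemeasurable]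
        refine tsum_congr fun k => ?_
        rw [lintegral_indicator measurableSet_ball, setLIntegral_const]
    _ ≤ ∑' k : ℕ, ENNReal.ofReal (2 ^ q * b * R ^ (N - q) * (1 / 2) ^ k) := by
        refine ENNReal.tsum_le_tsum fun k => ?_
        rw [Measure.addHaar_ball ν x (hr k).le, ← ENNReal.ofReal_toReal hbt,
          ← ENNReal.ofReal_mul (pow_nonneg (hr k).le _), ← ENNReal.ofReal_mul
            (inv_nonneg.mpr (pow_nonneg (hr _).le _))]
        refine ENNReal.ofReal_le_ofReal ?_
        change (r (k + 1) ^ q)⁻¹ * (r k ^ N * b) ≤ _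
        have h1 : r (k + 1) = r k / 2 := by simp only [r, pow_succ]; ring
        obtain ⟨c, hc⟩ := Nat.exists_eq_add_of_lt hq
        have hN : N = q + (c + 1) := hc
        rw [h1, hN, Nat.add_sub_cancel_left, pow_add, div_pow, inv_div]
        have h2 : r k ^ (c + 1) ≤ R ^ (c + 1) * (1 / 2) ^ k := by
          simp only [r]
          rw [mul_pow, mul_comm]
          gcongr
          rw [pow_succ]
          refine mul_le_of_le_one_left (by positivity) (pow_le_one₀ (by positivity) ?_)
          exact pow_le_one₀ (by norm_num) (by norm_num)
        have h3 := hr k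
        calc 2 ^ q / r k ^ q * (r k ^ q * r k ^ (c + 1) * b) = 2 ^ q * b * r k ^ (c + 1) := by
              field_simp
          _ ≤ 2 ^ q * b * (R ^ (c + 1) * (1 / 2) ^ k) := by gcongr
          _ = _ := by ring
    _ = ENNReal.ofReal (2 ^ q * b * 2 * R ^ (N - q)) := by
        rw [← ENNReal.ofReal_tsum_of_nonneg (fun k => by positivity)
          (summable_geometric_two.mul_left _), tsum_mul_left, tsum_geometric_two]
        congr 1; ring

/-- Among sets of given measure the Riesz kernel has the largest integral, up to a constant, on
balls around its pole. -/
theorem exists_setLIntegral_inv_pow_le {m : ℕ} (hm : 1 ≤ m) (hmN : m ≤ Module.finrank ℝ E) :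
    ∃ C : ℝ, 0 < C ∧ ∀ (x : E) (S : Set E) (a : ℝ), 0 < a → MeasurableSet S →
      ν S ≤ ENNReal.ofReal a →
      ∫⁻ y in S, (ENNReal.ofReal ‖y - x‖ ^ (Module.finrank ℝ E - m))⁻¹ ∂ν ≤
        ENNReal.ofReal (C * a ^ ((m : ℝ) / Module.finrank ℝ E)) := by
  obtain ⟨C, hC, hball⟩ := exists_lintegral_ball_inv_pow_le ν
    (q := Module.finrank ℝ E - m) (by omega)
  set N := Module.finrank ℝ E
  have hN : (0 : ℝ) < N := by exact_mod_cast (by omega : 0 < N)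
  refine ⟨C + 1, by positivity, fun x S a ha hS hSa => ?_⟩
  set R := a ^ (1 / (N : ℝ))
  have hR : 0 < R := Real.rpow_pos_of_pos ha _
  have hRN : R ^ N = a := by
    simp only [R]; rw [← Real.rpow_natCast, ← Real.rpow_mul ha.le]; field_simp; simp
  have hRm : R ^ m = a ^ ((m : ℝ) / N) := by
    simp only [R]; rw [← Real.rpow_natCast, ← Real.rpow_mul ha.le]; congr 1; ring
  calc _ ≤ ∫⁻ y in Metric.ball x R, (ENNReal.ofReal ‖y - x‖ ^ (N - m))⁻¹ ∂ν +
        ∫⁻ y in S \ Metric.ball x R, (ENNReal.ofReal ‖y - x‖ ^ (N - m))⁻¹ ∂ν := by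
        refine (lintegral_mono_set ?_).trans (lintegral_union_le _ _ _)
        intro y hy
        by_cases h : y ∈ Metric.ball x R
        · exact Or.inl h
        · exact Or.inr ⟨hy, h⟩
    _ ≤ ENNReal.ofReal (C * R ^ m) + ENNReal.ofReal (R ^ m) := by
        gcongr
        · have := hball x R hR
          rwa [Nat.sub_sub_self hmN] at this
        · calc _ ≤ ∫⁻ _ in S \ Metric.ball x R, ENNReal.ofReal ((R ^ (N - m))⁻¹) ∂ν := by
                refine setLIntegral_mono' (hS.diff measurableSet_ball) fun y hy => ?_
                have h1 : R ≤ ‖y - x‖ := by simpa [dist_eq_norm] using hy.2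
                rw [ENNReal.ofReal_inv_of_pos (by positivity), ENNReal.ofReal_pow hR.le]
                gcongr
            _ ≤ ENNReal.ofReal ((R ^ (N - m))⁻¹) * ENNReal.ofReal a := by
                rw [setLIntegral_const]
                gcongr
                exact (measure_mono sdiff_subset).trans hSa
            _ = ENNReal.ofReal (R ^ m) := by
                rw [← ENNReal.ofReal_mul (by positivity), ← hRN]
                congr 1
                obtain ⟨k, hk⟩ := Nat.exists_eq_add_of_le hmN
                rw [hk, Nat.add_sub_cancel_left, pow_add]
                field_simp
    _ = _ := by
        rw [← ENNReal.ofReal_add (by positivity) (by positivity), hRm]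
        congr 1; ring

end Kernels

section Poincare

variable {F : Type*} [NormedAddCommGroup F] [NormedSpace ℝ F]

theorem sub_le_lintegral_deriv_level {φ : ℝ → F} (hφ : ContDiff ℝ 1 φ) {a b : ℝ≥0∞}
    (h0 : ‖φ 0‖ₑ ≤ a) (h1 : b ≤ ‖φ 1‖ₑ) :
    b - a ≤ ∫⁻ t in Ioo (0 : ℝ) 1, {t | a < ‖φ t‖ₑ ∧ ‖φ t‖ₑ < b}.indicator
      (fun t => ‖deriv φ t‖ₑ) t := by
  rcases le_or_gt b a with hba | hab
  · rw [tsub_eq_zero_of_le hba]; exact zero_le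
  have hcont : Continuous fun t => ‖φ t‖ₑ := hφ.continuous.enorm
  obtain ⟨t1, ⟨ht1, hat1⟩, hmax⟩ := (isCompact_Icc.inter_right
    (isClosed_le hcont continuous_const) : IsCompact (Icc (0 : ℝ) 1 ∩ {t | ‖φ t‖ₑ ≤ a})).exists_isGreatest
      ⟨0, by simp, h0⟩
  obtain ⟨t2, ⟨ht2, hbt2⟩, hmin⟩ := (isCompact_Icc.inter_right
    (isClosed_le continuous_const hcont) : IsCompact (Icc t1 1 ∩ {t | b ≤ ‖φ t‖ₑ})).exists_isLeast
      ⟨1, ⟨ht1.2, le_rfl⟩, h1⟩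
  have hlevel : ∀ t ∈ Ioo t1 t2, a < ‖φ t‖ₑ ∧ ‖φ t‖ₑ < b := by
    intro t ht
    constructor
    · by_contra! hc
      exact absurd (hmax ⟨⟨ht1.1.trans ht.1.le, ht.2.le.trans ht2.2⟩, hc⟩) (not_le.mpr ht.1)
    · by_contra! hc
      exact absurd (hmin ⟨⟨ht.1.le, ht.2.le.trans ht2.2⟩, hc⟩) (not_le.mpr ht.2)
  have hIoo : Ioo t1 t2 ⊆ Ioo 0 1 := Ioo_subset_Ioo ht1.1 ht2.2
  calc b - a ≤ ‖φ t2 - φ t1‖ₑ := by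
        rw [tsub_le_iff_right]
        calc b ≤ ‖φ t2‖ₑ := hbt2
          _ = ‖(φ t2 - φ t1) + φ t1‖ₑ := by rw [sub_add_cancel]
          _ ≤ ‖φ t2 - φ t1‖ₑ + ‖φ t1‖ₑ := enorm_add_le _ _
          _ ≤ _ := by gcongr; exact hat1
    _ ≤ ∫⁻ t in Icc t1 t2, ‖deriv φ t‖ₑ :=
        enorm_sub_le_lintegral_deriv_of_contDiffOn_Icc hφ.contDiffOn ht2.1
    _ = ∫⁻ t in Ioo t1 t2, ‖deriv φ t‖ₑ := by rw [restrict_Ioo_eq_restrict_Icc]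
    _ = ∫⁻ t in Ioo t1 t2, {t | a < ‖φ t‖ₑ ∧ ‖φ t‖ₑ < b}.indicator (fun t => ‖deriv φ t‖ₑ) t :=
        setLIntegral_congr_fun measurableSet_Ioo fun t ht => by
          rw [indicator_of_mem (show t ∈ {t | a < ‖φ t‖ₑ ∧ ‖φ t‖ₑ < b} from hlevel t ht)]
    _ ≤ _ := lintegral_mono_set hIoo

variable {E : Type*} [NormedAddCommGroup E] [NormedSpace ℝ E]
  [FiniteDimensional ℝ E] [MeasurableSpace E] [BorelSpace E]
  (ν : Measure E) [ν.IsAddHaarMeasure]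

theorem lintegral_comp_add_smul_le_of_half_le (x : E) {s : ℝ} (hs : 1 / 2 ≤ s) {H : E → ℝ≥0∞}
    (hH : Measurable H) :
    ∫⁻ y, H (x + s • y) ∂ν ≤ 2 ^ Module.finrank ℝ E * ∫⁻ y, H y ∂ν := by
  rw [lintegral_comp_add_smul ν x (by linarith) hH]
  gcongr
  rw [← inv_pow, abs_of_nonneg (by positivity)]
  calc ENNReal.ofReal (s⁻¹ ^ Module.finrank ℝ E) ≤ ENNReal.ofReal (2 ^ Module.finrank ℝ E) := by
        refine ENNReal.ofReal_le_ofReal ?_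
        gcongr
        rw [inv_le_comm₀ (by linarith) (by norm_num)]
        linarith
    _ = _ := by rw [ENNReal.ofReal_pow (by norm_num)]; simp

/-- Poincaré-type inequality on a convex set for the part of a function between two levels. -/
theorem sub_mul_measure_mul_measure_le {W : E → F} (hW : ContDiff ℝ 1 W) {Q S₁ S₂ : Set E}
    (hQ : Convex ℝ Q) (hQm : MeasurableSet Q) {δ : ℝ≥0∞} (hδ : δ ≠ ⊤)
    (hdiam : ∀ x ∈ Q, ∀ y ∈ Q, ‖x - y‖ₑ ≤ δ) (hm₁ : MeasurableSet S₁) (hm₂ : MeasurableSet S₂)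
    (hS₁ : S₁ ⊆ Q) (hS₂ : S₂ ⊆ Q) {a b : ℝ≥0∞}
    (hb : ∀ y ∈ S₁, b ≤ ‖W y‖ₑ) (ha : ∀ z ∈ S₂, ‖W z‖ₑ ≤ a) :
    (b - a) * ν S₁ * ν S₂ ≤ δ * 2 ^ Module.finrank ℝ E * ν Q *
      ∫⁻ y in Q ∩ {y | a < ‖W y‖ₑ ∧ ‖W y‖ₑ < b}, ‖fderiv ℝ W y‖ₑ ∂ν := by
  have hWe : Measurable fun y => ‖W y‖ₑ := hW.continuous.enorm.measurable
  have hDm : MeasurableSet (Q ∩ {y | a < ‖W y‖ₑ ∧ ‖W y‖ₑ < b}) :=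
    hQm.inter ((measurableSet_lt measurable_const hWe).inter
      (measurableSet_lt hWe measurable_const))
  set D := Q ∩ {y | a < ‖W y‖ₑ ∧ ‖W y‖ₑ < b}
  let H : E → ℝ≥0∞ := D.indicator fun y => ‖fderiv ℝ W y‖ₑ
  have hH : Measurable H :=
    (hW.continuous_fderiv one_ne_zero).enorm.measurable.indicator hDm
  have hHI : ∫⁻ y, H y ∂ν = ∫⁻ y in D, ‖fderiv ℝ W y‖ₑ ∂ν := lintegral_indicator hDm _
  rw [← hHI]
  have hseg : ∀ y ∈ S₁, ∀ z ∈ S₂, b - a ≤ δ * ∫⁻ t in Ioo (0 : ℝ) 1, H (z + t • (y - z)) := by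
    intro y hy z hz
    have hline : ContDiff ℝ 1 fun t : ℝ => z + t • (y - z) := by fun_prop
    have hφ : ContDiff ℝ 1 fun t : ℝ => W (z + t • (y - z)) := hW.comp hline
    refine (sub_le_lintegral_deriv_level hφ (a := a) (b := b) (by simpa using ha z hz)
      (by simpa using hb y hy)).trans ?_
    rw [← lintegral_const_mul' _ _ hδ]
    refine setLIntegral_mono' measurableSet_Ioo fun t ht => ?_
    by_cases hlev : a < ‖W (z + t • (y - z))‖ₑ ∧ ‖W (z + t • (y - z))‖ₑ < b
    · have hmem : z + t • (y - z) ∈ D :=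
        ⟨hQ.add_smul_sub_mem (hS₂ hz) (hS₁ hy) ⟨ht.1.le, ht.2.le⟩, hlev⟩
      rw [indicator_of_mem (by exact hlev)]
      simp only [H]
      rw [indicator_of_mem hmem]
      have hl : HasDerivAt (fun t : ℝ => z + t • (y - z)) (y - z) t := by
        simpa using ((hasDerivAt_id t).smul_const (y - z)).const_add z
      have hd : HasDerivAt (fun t : ℝ => W (z + t • (y - z)))
          (fderiv ℝ W (z + t • (y - z)) (y - z)) t :=
        (hW.differentiable one_ne_zero _).hasFDerivAt.comp_hasDerivAt t hl
      rw [hd.deriv, mul_comm]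
      exact ((fderiv ℝ W (z + t • (y - z))).le_opENorm _).trans
        (by gcongr; exact hdiam _ (hS₁ hy) _ (hS₂ hz))
    · rw [indicator_of_notMem (by exact hlev)]; exact zero_le
  have hmeas : Measurable fun p : (E × E) × ℝ => H (p.1.2 + p.2 • (p.1.1 - p.1.2)) :=
    hH.comp (by fun_prop)
  have hinner : ∀ t ∈ Ioo (0 : ℝ) 1, ∫⁻ y in Q, ∫⁻ z in Q, H (z + t • (y - z)) ∂ν ∂ν ≤
      2 ^ Module.finrank ℝ E * (∫⁻ y, H y ∂ν) * ν Q := by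
    intro t ht
    rcases le_total t (1 / 2) with h | h
    · calc ∫⁻ y in Q, (∫⁻ z in Q, H (z + t • (y - z)) ∂ν) ∂ν
          ≤ ∫⁻ y in Q, (2 ^ Module.finrank ℝ E * (∫⁻ y, H y ∂ν)) ∂ν := by
            refine lintegral_mono fun y => (setLIntegral_le_lintegral _ _).trans ?_
            refine le_of_eq_of_le ?_ (lintegral_comp_add_smul_le_of_half_le ν (t • y)
              (s := 1 - t) (by linarith) hH)
            refine lintegral_congr fun z => ?_
            congr 1
            module
        _ = _ := by rw [setLIntegral_const]
    · rw [lintegral_lintegral_swap]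
      · calc ∫⁻ z in Q, (∫⁻ y in Q, H (z + t • (y - z)) ∂ν) ∂ν
            ≤ ∫⁻ z in Q, (2 ^ Module.finrank ℝ E * (∫⁻ y, H y ∂ν)) ∂ν := by
              refine lintegral_mono fun z => (setLIntegral_le_lintegral _ _).trans ?_
              refine le_of_eq_of_le ?_ (lintegral_comp_add_smul_le_of_half_le ν ((1 - t) • z)
                (s := t) h hH)
              refine lintegral_congr fun y => ?_
              congr 1
              module
          _ = _ := by rw [setLIntegral_const]
      · exact (hH.comp (by fun_prop : Measurable fun p : E × E =>
          p.2 + t • (p.1 - p.2))).aemeasurable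
  calc (b - a) * ν S₁ * ν S₂ = ∫⁻ y in S₁, (∫⁻ z in S₂, (b - a) ∂ν) ∂ν := by
        rw [setLIntegral_const, setLIntegral_const]; ring
    _ ≤ ∫⁻ y in S₁, (∫⁻ z in S₂, (δ * ∫⁻ t in Ioo (0 : ℝ) 1, H (z + t • (y - z))) ∂ν) ∂ν :=
        setLIntegral_mono' hm₁ fun y hy => setLIntegral_mono' hm₂ fun z hz => hseg y hy z hz
    _ ≤ ∫⁻ y in Q, (∫⁻ z in Q, (δ * ∫⁻ t in Ioo (0 : ℝ) 1, H (z + t • (y - z))) ∂ν) ∂ν :=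
        (lintegral_mono_set hS₁).trans (lintegral_mono fun y => lintegral_mono_set hS₂)
    _ = δ * ∫⁻ y in Q, (∫⁻ z in Q, (∫⁻ t in Ioo (0 : ℝ) 1, H (z + t • (y - z))) ∂ν) ∂ν := by
        simp only [lintegral_const_mul' _ _ hδ]
    _ = δ * ∫⁻ y in Q, (∫⁻ t in Ioo (0 : ℝ) 1, (∫⁻ z in Q, H (z + t • (y - z)) ∂ν)) ∂ν := by
        congr 1
        refine lintegral_congr fun y => ?_
        rw [lintegral_lintegral_swap]
        exact (hH.comp (by fun_prop : Measurable fun p : E × ℝ =>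
          p.1 + p.2 • (y - p.1))).aemeasurable
    _ = δ * ∫⁻ t in Ioo (0 : ℝ) 1, (∫⁻ y in Q, (∫⁻ z in Q, H (z + t • (y - z)) ∂ν) ∂ν) := by
        rw [lintegral_lintegral_swap]
        refine Measurable.aemeasurable ?_
        refine Measurable.lintegral_prod_right' (f := fun p : (E × ℝ) × E =>
          H (p.2 + p.1.2 • (p.1.1 - p.2))) ?_
        exact hH.comp (by fun_prop)
    _ ≤ δ * ∫⁻ t in Ioo (0 : ℝ) 1, 2 ^ Module.finrank ℝ E * (∫⁻ y, H y ∂ν) * ν Q := by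
        gcongr δ * ?_
        exact setLIntegral_mono' measurableSet_Ioo hinner
    _ = _ := by
        rw [setLIntegral_const, Real.volume_Ioo]; simp; ring

end Poincare

section Cubes

variable {n : ℕ}

/-- The index of the half-open grid cube of side `l` that contains a point. -/
noncomputable def cubeIndex (l : ℝ) (x : EuclideanSpace ℝ (Fin n)) : Fin n → ℤ :=
  fun i => ⌊x i / l⌋

/-- The half-open grid cube of side `l` that contains `x`. -/
def gridCube (l : ℝ) (x : EuclideanSpace ℝ (Fin n)) : Set (EuclideanSpace ℝ (Fin n)) :=
  {y | cubeIndex l y = cubeIndex l x}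

theorem measurable_cubeIndex (l : ℝ) : Measurable (cubeIndex (n := n) l) := by
  refine measurable_pi_lambda _ fun i => Int.measurable_floor.comp ?_
  fun_prop

theorem measurableSet_gridCube (l : ℝ) (x : EuclideanSpace ℝ (Fin n)) :
    MeasurableSet (gridCube l x) :=
  measurable_cubeIndex l (measurableSet_singleton (cubeIndex l x))

theorem mem_gridCube_comm {l : ℝ} {x y : EuclideanSpace ℝ (Fin n)} :
    y ∈ gridCube l x ↔ x ∈ gridCube l y := eq_comm

theorem self_mem_gridCube (l : ℝ) (x : EuclideanSpace ℝ (Fin n)) : x ∈ gridCube l x := rfl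

theorem gridCube_eq_pi {l : ℝ} (hl : 0 < l) (x : EuclideanSpace ℝ (Fin n)) :
    gridCube l x = (WithLp.ofLp : EuclideanSpace ℝ (Fin n) → Fin n → ℝ) ⁻¹'
      (univ.pi fun i => Ico (⌊x i / l⌋ * l) ((⌊x i / l⌋ + 1) * l)) := by
  ext y
  simp only [gridCube, cubeIndex, funext_iff, mem_ofPred_eq, mem_preimage, mem_pi, mem_univ,
    forall_const, mem_Ico, Int.floor_eq_iff, le_div_iff₀ hl, div_lt_iff₀ hl]

theorem volume_gridCube {l : ℝ} (hl : 0 < l) (x : EuclideanSpace ℝ (Fin n)) :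
    volume (gridCube l x) = ENNReal.ofReal (l ^ n) := by
  rw [gridCube_eq_pi hl, (PiLp.volume_preserving_ofLp (Fin n)).measure_preimage
    (MeasurableSet.univ_pi fun i => measurableSet_Ico).nullMeasurableSet, Real.volume_pi_Ico]
  have : ∀ i, (⌊x i / l⌋ + 1) * l - ⌊x i / l⌋ * l = l := fun i => by ring
  simp only [this, Finset.prod_const, Finset.card_univ, Fintype.card_fin]
  rw [ENNReal.ofReal_pow hl.le]

theorem convex_gridCube {l : ℝ} (hl : 0 < l) (x : EuclideanSpace ℝ (Fin n)) :
    Convex ℝ (gridCube l x) := by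
  rw [gridCube_eq_pi hl]
  exact (convex_pi fun i _ => convex_Ico _ _).is_linear_preimage
    (WithLp.linearEquiv 2 ℝ (Fin n → ℝ)).toLinearMap.isLinear

theorem norm_sub_le_of_mem_gridCube {l : ℝ} (hl : 0 < l) {x y z : EuclideanSpace ℝ (Fin n)}
    (hy : y ∈ gridCube l x) (hz : z ∈ gridCube l x) : ‖y - z‖ ≤ n * l := by
  rw [gridCube_eq_pi hl] at hy hz
  refine abs_le_of_sq_le_sq' ?_ (by positivity) |>.2
  rw [EuclideanSpace.real_norm_sq_eq]
  calc ∑ i, (y - z) i ^ 2 ≤ ∑ _i : Fin n, l ^ 2 := by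
        refine Finset.sum_le_sum fun i _ => ?_
        have h1 := hy i (mem_univ i)
        have h2 := hz i (mem_univ i)
        simp only [mem_Ico] at h1 h2
        rw [PiLp.sub_apply]
        exact sq_le_sq' (by linarith) (by linarith)
    _ = n * l ^ 2 := by simp
    _ ≤ (n * l) ^ 2 := by
        rw [mul_pow]
        gcongr
        exact_mod_cast Nat.le_self_pow two_ne_zero n

theorem cubeIndex_double {l : ℝ} {x y : EuclideanSpace ℝ (Fin n)}
    (h : cubeIndex l y = cubeIndex l x) : cubeIndex (2 * l) y = cubeIndex (2 * l) x := by
  funext i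
  have hf : ∀ z : EuclideanSpace ℝ (Fin n), ⌊z i / (2 * l)⌋ = ⌊z i / l⌋ / 2 := by
    intro z
    rw [← Int.mul_natCast_floor_div_cancel two_ne_zero]
    congr 2
    push_cast
    rw [mul_comm 2 l, ← div_div, div_mul_cancel₀ _ two_ne_zero]
  have := congrFun h i
  simp only [cubeIndex] at this ⊢
  rw [hf, hf, this]

theorem cubeIndex_pow_mul {l : ℝ} {x y : EuclideanSpace ℝ (Fin n)}
    (h : cubeIndex l y = cubeIndex l x) (k : ℕ) :
    cubeIndex (2 ^ k * l) y = cubeIndex (2 ^ k * l) x := by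
  induction k with
  | zero => simpa using h
  | succ k ih => rw [pow_succ', mul_assoc]; exact cubeIndex_double ih

theorem gridCube_eq_of_mem {l : ℝ} {x y : EuclideanSpace ℝ (Fin n)} (h : y ∈ gridCube l x) :
    gridCube l y = gridCube l x := by
  ext z
  exact ⟨fun hz => Eq.trans hz h, fun hz => Eq.trans hz (Eq.symm h)⟩

theorem dyadic_side_eq (R : ℝ) {k j : ℕ} (hkj : k ≤ j) :
    R / 2 ^ k = 2 ^ (j - k) * (R / 2 ^ j) := by
  rw [← Nat.sub_add_cancel hkj, Nat.add_sub_cancel, pow_add]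
  field_simp

theorem mem_gridCube_of_le {R : ℝ} {x y : EuclideanSpace ℝ (Fin n)} {k j : ℕ} (hkj : k ≤ j)
    (h : y ∈ gridCube (R / 2 ^ j) x) : y ∈ gridCube (R / 2 ^ k) x := by
  rw [dyadic_side_eq R hkj]
  exact cubeIndex_pow_mul h _

end Cubes

section CubeLevels

variable {n : ℕ}

/-- The value exceeded by `w` on a fraction `θ` of the dyadic grid cube of generation `k` around
`x`. -/
noncomputable def cubeLevel (w : EuclideanSpace ℝ (Fin n) → ℝ≥0∞) (R θ : ℝ) (k : ℕ)
    (x : EuclideanSpace ℝ (Fin n)) : ℝ≥0∞ :=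
  levelRearr (volume.restrict (gridCube (R / 2 ^ k) x)) w (θ * (R / 2 ^ k) ^ n)

/-- Running maximum of `cubeLevel` over the generations `1, …, k`. -/
noncomputable def runLevel (w : EuclideanSpace ℝ (Fin n) → ℝ≥0∞) (R θ : ℝ) :
    ℕ → EuclideanSpace ℝ (Fin n) → ℝ≥0∞
  | 0, _ => 0
  | k + 1, x => max (runLevel w R θ k x) (cubeLevel w R θ (k + 1) x)

variable (w : EuclideanSpace ℝ (Fin n) → ℝ≥0∞) (R θ : ℝ)

theorem cubeLevel_eq_of_mem {k j : ℕ} (hkj : k ≤ j) {x y : EuclideanSpace ℝ (Fin n)}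
    (h : y ∈ gridCube (R / 2 ^ j) x) : cubeLevel w R θ k y = cubeLevel w R θ k x := by
  rw [cubeLevel, gridCube_eq_of_mem (mem_gridCube_of_le hkj h), cubeLevel]

theorem runLevel_eq_of_mem {k j : ℕ} (hkj : k ≤ j) {x y : EuclideanSpace ℝ (Fin n)}
    (h : y ∈ gridCube (R / 2 ^ j) x) : runLevel w R θ k y = runLevel w R θ k x := by
  induction k with
  | zero => rfl
  | succ k ih =>
    rw [runLevel, runLevel, ih (by omega), cubeLevel_eq_of_mem w R θ hkj h]

theorem runLevel_mono (x : EuclideanSpace ℝ (Fin n)) : Monotone fun k => runLevel w R θ k x :=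
  monotone_nat_of_le_succ fun _ => le_max_left _ _

theorem measurable_runLevel (k : ℕ) : Measurable (runLevel w R θ k) := by
  induction k with
  | zero => exact measurable_const
  | succ k ih =>
    refine ih.max ?_
    classical
    let e : (Fin n → ℤ) → ℝ≥0∞ := fun c =>
      if h : ∃ x, cubeIndex (R / 2 ^ (k + 1)) x = c then cubeLevel w R θ (k + 1) h.choose else 0
    have : cubeLevel w R θ (k + 1) = e ∘ cubeIndex (R / 2 ^ (k + 1)) := by
      ext x
      have h : ∃ x', cubeIndex (R / 2 ^ (k + 1)) x' = cubeIndex (R / 2 ^ (k + 1)) x := ⟨x, rfl⟩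
      simp only [Function.comp, e, dif_pos h]
      exact (cubeLevel_eq_of_mem w R θ le_rfl h.choose_spec).symm
    rw [this]
    exact (measurable_of_countable e).comp (measurable_cubeIndex _)

theorem le_tsum_runLevel_sub {w : EuclideanSpace ℝ (Fin n) → ℝ≥0∞} {R θ : ℝ}
    (hw : Continuous w) (hR : 0 < R) (hθ : θ < 1)
    (x : EuclideanSpace ℝ (Fin n)) :
    w x ≤ ∑' k, (runLevel w R θ (k + 1) x - runLevel w R θ k x) := by
  have hP : ∀ k, runLevel w R θ k x ≤
      ∑ i ∈ Finset.range k, (runLevel w R θ (i + 1) x - runLevel w R θ i x) := by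
    intro k
    induction k with
    | zero => simp [runLevel]
    | succ k ih =>
      rw [Finset.sum_range_succ]
      calc runLevel w R θ (k + 1) x
          ≤ (runLevel w R θ (k + 1) x - runLevel w R θ k x) + runLevel w R θ k x := le_tsub_add
        _ ≤ _ := by rw [add_comm]; gcongr
  refine le_of_forall_lt fun b hb => ?_
  obtain ⟨ε, hε, hball⟩ := Metric.mem_nhds_iff.mp (hw.continuousAt.eventually (lt_mem_nhds hb))
  obtain ⟨k, hk⟩ : ∃ k : ℕ, n * R / ε < (2 : ℝ) ^ k := pow_unbounded_of_one_lt _ (by norm_num)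
  have hl : 0 < R / 2 ^ (k + 1) := by positivity
  have hsub : gridCube (R / 2 ^ (k + 1)) x ⊆ {y | b < w y} := by
    intro y hy
    refine hball ?_
    rw [Metric.mem_ball, dist_eq_norm]
    refine (norm_sub_le_of_mem_gridCube hl hy (self_mem_gridCube _ x)).trans_lt ?_
    rw [div_lt_iff₀ hε] at hk
    rw [← mul_div_assoc, div_lt_iff₀ (by positivity), pow_succ]
    nlinarith
  have hlt : b < cubeLevel w R θ (k + 1) x := by
    rw [cubeLevel, lt_levelRearr_iff, Measure.restrict_apply' (measurableSet_gridCube _ _),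
      inter_eq_self_of_subset_right hsub, volume_gridCube hl]
    refine (ENNReal.ofReal_lt_ofReal_iff (by positivity)).mpr ?_
    have : 0 < (R / 2 ^ (k + 1)) ^ n := by positivity
    nlinarith
  exact (hlt.trans_le (le_max_right _ _)).trans_le ((hP (k + 1)).trans
    (ENNReal.sum_le_tsum _))

/-- The set where `w` lies strictly between two consecutive running levels. -/
def levelSlice (k : ℕ) : Set (EuclideanSpace ℝ (Fin n)) :=
  {y | runLevel w R θ k y < w y ∧ w y < runLevel w R θ (k + 1) y}

theorem measurableSet_levelSlice {w : EuclideanSpace ℝ (Fin n) → ℝ≥0∞} (hw : Measurable w)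
    (k : ℕ) : MeasurableSet (levelSlice w R θ k) :=
  (measurableSet_lt (measurable_runLevel w R θ k) hw).inter
    (measurableSet_lt hw (measurable_runLevel w R θ (k + 1)))

theorem pairwise_disjoint_levelSlice :
    Pairwise fun i j => Disjoint (levelSlice w R θ i) (levelSlice w R θ j) := by
  have key : ∀ i j, i < j → Disjoint (levelSlice w R θ i) (levelSlice w R θ j) := by
    intro i j hij
    refine Set.disjoint_left.mpr fun y hi hj => ?_
    exact lt_irrefl _ ((hi.2.trans_le (runLevel_mono w R θ y hij)).trans hj.1)
  intro i j hij
  rcases lt_or_gt_of_ne hij with h | h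
  · exact key i j h
  · exact (key j i h).symm

end CubeLevels

section CubePoincare

variable {n : ℕ} {F : Type*} [NormedAddCommGroup F] [NormedSpace ℝ F]

theorem measure_gridCube_runLevel_lt_le {w : EuclideanSpace ℝ (Fin n) → ℝ≥0∞} {R : ℝ}
    (hR : 0 < R) (hw : Measurable w)
    (hsupp : volume {y | 0 < w y} ≤ ENNReal.ofReal ((1 / 2) ^ (n + 1) * R ^ n))
    (k : ℕ) (x : EuclideanSpace ℝ (Fin n)) :
    volume (gridCube (R / 2 ^ (k + 1)) x ∩ {y | runLevel w R ((1 / 2) ^ (n + 1)) k x < w y}) ≤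
      ENNReal.ofReal ((R / 2 ^ (k + 1)) ^ n / 2) := by
  have hside : (R / 2 ^ (k + 1)) ^ n / 2 = (1 / 2) ^ (n + 1) * (R / 2 ^ k) ^ n := by
    rw [pow_succ, ← div_div, div_pow (R / 2 ^ k), pow_succ, div_pow 1 2 n]
    field_simp
    try simp
  rw [hside]
  rcases k with _ | k
  · refine (measure_mono inter_subset_right).trans ?_
    simpa [runLevel] using hsupp
  · calc _ ≤ volume (gridCube (R / 2 ^ (k + 1)) x ∩
          {y | cubeLevel w R ((1 / 2) ^ (n + 1)) (k + 1) x < w y}) := by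
          refine measure_mono (inter_subset_inter (fun y hy => mem_gridCube_of_le (by omega) hy)
            fun y (hy : runLevel w R _ (k + 1) x < w y) => ?_)
          exact lt_of_le_of_lt (le_max_right (runLevel w R _ k x) _) hy
      _ ≤ _ := by
          have := measure_levelRearr_lt_le (volume.restrict (gridCube (R / 2 ^ (k + 1)) x)) w
            ((1 / 2) ^ (n + 1) * (R / 2 ^ (k + 1)) ^ n)
          rw [Measure.restrict_apply (measurableSet_lt measurable_const hw)] at this
          rwa [inter_comm]

theorem runLevel_succ_sub_le {W : EuclideanSpace ℝ (Fin n) → F} (hW : ContDiff ℝ 1 W) {R : ℝ}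
    (hR : 0 < R)
    (hsupp : volume {y | 0 < ‖W y‖ₑ} ≤ ENNReal.ofReal ((1 / 2) ^ (n + 1) * R ^ n))
    (k : ℕ) (x : EuclideanSpace ℝ (Fin n)) :
    runLevel (fun y => ‖W y‖ₑ) R ((1 / 2) ^ (n + 1)) (k + 1) x -
      runLevel (fun y => ‖W y‖ₑ) R ((1 / 2) ^ (n + 1)) k x ≤
      ENNReal.ofReal (n * 2 ^ n * 2 ^ (n + 2) * (R / 2 ^ (k + 1) / (R / 2 ^ (k + 1)) ^ n)) *
        ∫⁻ y in gridCube (R / 2 ^ (k + 1)) x ∩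
          levelSlice (fun y => ‖W y‖ₑ) R ((1 / 2) ^ (n + 1)) k, ‖fderiv ℝ W y‖ₑ := by
  set w : EuclideanSpace ℝ (Fin n) → ℝ≥0∞ := fun y => ‖W y‖ₑ
  have hw : Measurable w := hW.continuous.enorm.measurable
  set θ : ℝ := (1 / 2) ^ (n + 1)
  have hθ : 0 < θ := by positivity
  set l := R / 2 ^ (k + 1)
  have hl : 0 < l := by positivity
  have hln : 0 < l ^ n := by positivity
  set Q := gridCube l x
  have hQm : MeasurableSet Q := measurableSet_gridCube l x
  have hQv : volume Q = ENNReal.ofReal (l ^ n) := volume_gridCube hl x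
  set I := ∫⁻ y in Q ∩ levelSlice w R θ k, ‖fderiv ℝ W y‖ₑ
  rcases le_or_gt (cubeLevel w R θ (k + 1) x) (runLevel w R θ k x) with hle | hlt
  · rw [tsub_eq_zero_of_le (show runLevel w R θ (k + 1) x ≤ runLevel w R θ k x from
      max_le le_rfl hle)]
    exact zero_le
  rw [runLevel, max_eq_right hlt.le, tsub_le_iff_right]
  refine le_of_forall_lt_imp_le_of_dense fun b hb => ?_
  rw [← tsub_le_iff_right]
  have h1 : ENNReal.ofReal (θ * l ^ n) ≤ volume (Q ∩ {y | b < w y}) := by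
    rw [cubeLevel, lt_levelRearr_iff, Measure.restrict_apply (measurableSet_lt measurable_const hw),
      inter_comm] at hb
    exact hb.le
  have h2 : ENNReal.ofReal (l ^ n / 2) ≤ volume (Q ∩ {y | w y ≤ runLevel w R θ k x}) := by
    have h3 := measure_gridCube_runLevel_lt_le hR hw hsupp k x
    have h4 : volume Q ≤ volume (Q ∩ {y | w y ≤ runLevel w R θ k x}) +
        volume (Q ∩ {y | runLevel w R θ k x < w y}) := by
      refine (measure_mono fun y hy => ?_).trans (measure_union_le _ _)
      rcases le_or_gt (w y) (runLevel w R θ k x) with h | h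
      · exact Or.inl ⟨hy, h⟩
      · exact Or.inr ⟨hy, h⟩
    have h5 : ENNReal.ofReal (l ^ n / 2) + ENNReal.ofReal (l ^ n / 2) ≤
        volume (Q ∩ {y | w y ≤ runLevel w R θ k x}) + ENNReal.ofReal (l ^ n / 2) := by
      rw [← ENNReal.ofReal_add (by positivity) (by positivity), add_halves, ← hQv]
      exact h4.trans (by gcongr)
    exact (ENNReal.add_le_add_iff_right ENNReal.ofReal_ne_top).mp h5
  have hP := sub_mul_measure_mul_measure_le volume hW (convex_gridCube hl x) hQm
    (δ := ENNReal.ofReal (n * l)) ENNReal.ofReal_ne_top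
    (fun y hy z hz => by
      rw [← ofReal_norm]
      exact ENNReal.ofReal_le_ofReal (norm_sub_le_of_mem_gridCube hl hy hz))
    (hQm.inter (measurableSet_lt measurable_const hw))
    (hQm.inter (measurableSet_le hw measurable_const)) inter_subset_left inter_subset_left
    (a := runLevel w R θ k x) (b := b) (fun y hy => le_of_lt hy.2) (fun z hz => hz.2)
  have hI : ∫⁻ y in Q ∩ {y | runLevel w R θ k x < ‖W y‖ₑ ∧ ‖W y‖ₑ < b}, ‖fderiv ℝ W y‖ₑ ≤ I := by
    refine lintegral_mono_set fun y hy => ⟨hy.1, ?_⟩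
    have e1 : runLevel w R θ k y = runLevel w R θ k x :=
      runLevel_eq_of_mem w R θ (Nat.le_succ k) hy.1
    have e2 : runLevel w R θ (k + 1) y = runLevel w R θ (k + 1) x :=
      runLevel_eq_of_mem w R θ le_rfl hy.1
    refine ⟨?_, ?_⟩
    · rw [e1]; exact hy.2.1
    · rw [e2]
      exact (hy.2.2.trans hb).trans_le (le_max_right _ _)
  have key : (b - runLevel w R θ k x) * ENNReal.ofReal (θ * l ^ n * (l ^ n / 2)) ≤
      ENNReal.ofReal (n * l * 2 ^ n * l ^ n) * I := by
    calc _ = (b - runLevel w R θ k x) * ENNReal.ofReal (θ * l ^ n) * ENNReal.ofReal (l ^ n / 2) := by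
          rw [ENNReal.ofReal_mul (by positivity), mul_assoc]
      _ ≤ _ := by
          refine (mul_le_mul' (mul_le_mul_right h1 _) h2).trans (hP.trans ?_)
          rw [finrank_euclideanSpace_fin, hQv]
          rw [ENNReal.ofReal_mul (p := n * l * 2 ^ n) (by positivity),
            ENNReal.ofReal_mul (p := (n : ℝ) * l) (q := 2 ^ n) (by positivity)]
          rw [ENNReal.ofReal_pow (p := 2) (by norm_num), ENNReal.ofReal_ofNat]
          gcongr
  rw [← ENNReal.le_div_iff_mul_le (Or.inl (by simp; positivity)) (Or.inl ENNReal.ofReal_ne_top),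
    ENNReal.mul_div_right_comm, ← ENNReal.ofReal_div_of_pos (by positivity)] at key
  refine key.trans (le_of_eq ?_)
  congr 2
  simp only [θ, div_pow, one_pow]
  field_simp
  try ring

/-- A compactly supported function is dominated by scaled integrals of its derivative over dyadic
cubes, with the integrals of different scales taken over disjoint sets. -/
theorem exists_enorm_le_tsum_gridCube (hn : 1 ≤ n) {W : EuclideanSpace ℝ (Fin n) → F}
    (hW : ContDiff ℝ 1 W) (hWc : HasCompactSupport W) :
    ∃ (l : ℕ → ℝ) (D : ℕ → Set (EuclideanSpace ℝ (Fin n))), (∀ k, 0 < l k) ∧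
      (∀ k, MeasurableSet (D k)) ∧ (Pairwise fun i j => Disjoint (D i) (D j)) ∧
      ∀ x, ‖W x‖ₑ ≤ ∑' k, ENNReal.ofReal (n * 2 ^ n * 2 ^ (n + 2) * (l k / l k ^ n)) *
        ∫⁻ y in gridCube (l k) x ∩ D k, ‖fderiv ℝ W y‖ₑ := by
  set θ : ℝ := (1 / 2) ^ (n + 1)
  have hθ : 0 < θ := by positivity
  set V := (volume (tsupport W)).toReal
  set R := max 1 (V / θ)
  have hR1 : 1 ≤ R := le_max_left _ _
  have hR : 0 < R := by linarith
  have hsupp : volume {y | 0 < ‖W y‖ₑ} ≤ ENNReal.ofReal (θ * R ^ n) := by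
    calc volume {y | 0 < ‖W y‖ₑ} ≤ volume (tsupport W) :=
          measure_mono fun y hy => subset_tsupport W (by simpa using hy)
      _ = ENNReal.ofReal V := (ENNReal.ofReal_toReal hWc.isCompact.measure_lt_top.ne).symm
      _ ≤ _ := by
          refine ENNReal.ofReal_le_ofReal ?_
          have h1 : V / θ ≤ R ^ n := (le_max_right _ _).trans (le_self_pow₀ hR1 (by omega))
          rwa [div_le_iff₀ hθ, mul_comm] at h1
  refine ⟨fun k => R / 2 ^ (k + 1), fun k => levelSlice (fun y => ‖W y‖ₑ) R θ k,
    fun k => by positivity, fun k => measurableSet_levelSlice R θ hW.continuous.enorm.measurable k,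
    pairwise_disjoint_levelSlice _ R θ, fun x => ?_⟩
  refine (le_tsum_runLevel_sub hW.continuous.enorm hR (θ := θ) ?_ x).trans
    (ENNReal.tsum_le_tsum fun k => runLevel_succ_sub_le hW hR hsupp k x)
  exact pow_lt_one₀ (by norm_num) (by norm_num) (by omega)

end CubePoincare

section ScaleKernel

/-- The kernel `ρ ↦ l / (l + ρ) ^ (p + 1)`, a smoothing of `ρ ↦ ρ ^ (-p)` at scale `l`. -/
noncomputable def scaleKernel (p : ℕ) (l ρ : ℝ) : ℝ≥0∞ :=
  ENNReal.ofReal (l / (l + ρ) ^ (p + 1))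

variable {n : ℕ}

theorem exists_lintegral_gridCube_le_scaleKernel {p : ℕ} (hp : p + 1 < n) :
    ∃ C : ℝ≥0, ∀ (l : ℝ), 0 < l → ∀ x y : EuclideanSpace ℝ (Fin n),
      ENNReal.ofReal (l / l ^ n) *
        ∫⁻ z in gridCube l y, (ENNReal.ofReal ‖z - x‖ ^ (p + 1))⁻¹ ≤
        C * scaleKernel p l ‖y - x‖ := by
  obtain ⟨C₀, hC₀, hball⟩ := exists_lintegral_ball_inv_pow_le
    (volume : Measure (EuclideanSpace ℝ (Fin n))) (q := p + 1)
    (by rwa [finrank_euclideanSpace_fin])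
  rw [finrank_euclideanSpace_fin] at hball
  refine ⟨Real.toNNReal (4 ^ (p + 1) + C₀ * (3 * n) ^ n), fun l hl x y => ?_⟩
  set ρ := ‖y - x‖
  have hρ : 0 ≤ ρ := norm_nonneg _
  have hn : (1 : ℝ) ≤ n := by exact_mod_cast (by omega : 1 ≤ n)
  change _ ≤ ENNReal.ofReal _ * ENNReal.ofReal _
  rw [← ENNReal.ofReal_mul (by positivity)]
  rcases le_or_gt (2 * n * l) ρ with h | h
  · have hlow : ∀ z ∈ gridCube l y, (l + ρ) / 4 ≤ ‖z - x‖ := by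
      intro z hz
      have h1 := norm_sub_le_of_mem_gridCube hl (self_mem_gridCube l y) hz
      have h2 : ρ ≤ ‖y - z‖ + ‖z - x‖ := norm_sub_le_norm_sub_add_norm_sub y z x
      nlinarith
    calc ENNReal.ofReal (l / l ^ n) *
          ∫⁻ z in gridCube l y, (ENNReal.ofReal ‖z - x‖ ^ (p + 1))⁻¹
        ≤ ENNReal.ofReal (l / l ^ n) *
          ∫⁻ _z in gridCube l y, (ENNReal.ofReal ((l + ρ) / 4) ^ (p + 1))⁻¹ := by
          gcongr 1
          refine setLIntegral_mono' (measurableSet_gridCube l y) fun z hz => ?_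
          gcongr
          exact hlow z hz
      _ = ENNReal.ofReal (4 ^ (p + 1) * (l / (l + ρ) ^ (p + 1))) := by
          rw [setLIntegral_const, volume_gridCube hl, ← ENNReal.ofReal_pow (by positivity),
            ← ENNReal.ofReal_inv_of_pos (by positivity), ← ENNReal.ofReal_mul (by positivity),
            ← ENNReal.ofReal_mul (by positivity)]
          congr 1
          rw [div_pow]
          field_simp
      _ ≤ _ := by
          refine ENNReal.ofReal_le_ofReal ?_
          gcongr
          exact le_add_of_nonneg_right (by positivity)
  · have hsub : gridCube l y ⊆ Metric.ball x (3 * n * l) := by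
      intro z hz
      rw [Metric.mem_ball, dist_eq_norm]
      have h1 := norm_sub_le_of_mem_gridCube hl hz (self_mem_gridCube l y)
      have h2 : ‖z - x‖ ≤ ‖z - y‖ + ‖y - x‖ := norm_sub_le_norm_sub_add_norm_sub z y x
      change ‖z - x‖ ≤ ‖z - y‖ + ρ at h2
      nlinarith
    calc ENNReal.ofReal (l / l ^ n) *
          ∫⁻ z in gridCube l y, (ENNReal.ofReal ‖z - x‖ ^ (p + 1))⁻¹
        ≤ ENNReal.ofReal (l / l ^ n) * ENNReal.ofReal (C₀ * (3 * n * l) ^ (n - (p + 1))) := by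
          gcongr 1
          exact (lintegral_mono_set hsub).trans (hball x (3 * n * l) (by positivity))
      _ = ENNReal.ofReal (C₀ * (3 * n) ^ n * (l / (3 * n * l) ^ (p + 1))) := by
          rw [← ENNReal.ofReal_mul (by positivity)]
          congr 1
          obtain ⟨r, rfl⟩ : ∃ r, n = p + 1 + r := ⟨n - (p + 1), by omega⟩
          rw [Nat.add_sub_cancel_left]
          set N : ℝ := ((p + 1 + r : ℕ) : ℝ)
          rw [mul_pow (3 * N) l, mul_pow (3 * N) l, pow_add _ (p + 1) r, pow_add _ (p + 1) r]
          field_simp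
      _ ≤ _ := by
          refine ENNReal.ofReal_le_ofReal ?_
          have : l + ρ ≤ 3 * n * l := by nlinarith
          gcongr
          exact le_add_of_nonneg_left (by positivity)

theorem indicator_gridCube_le_scaleKernel {p : ℕ} (hp : p + 1 = n) {l : ℝ} (hl : 0 < l)
    (x y : EuclideanSpace ℝ (Fin n)) :
    ENNReal.ofReal (l / l ^ n) * (gridCube l x).indicator 1 y ≤
      ENNReal.ofReal ((n + 1) ^ n) * scaleKernel p l ‖y - x‖ := by
  by_cases hy : y ∈ gridCube l x
  · rw [indicator_of_mem hy, Pi.one_apply, mul_one, scaleKernel,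
      ← ENNReal.ofReal_mul (by positivity), hp]
    refine ENNReal.ofReal_le_ofReal ?_
    have h := norm_sub_le_of_mem_gridCube hl hy (self_mem_gridCube l x)
    calc l / l ^ n = (n + 1) ^ n * (l / ((n + 1) * l) ^ n) := by
          rw [mul_pow]; field_simp
      _ ≤ _ := by
          gcongr
          linarith
  · rw [indicator_of_notMem hy]
    simp

theorem measurable_indicator_gridCube {l : EuclideanSpace ℝ (Fin n) → ℝ} (hl : Measurable l) :
    Measurable fun q : EuclideanSpace ℝ (Fin n) × EuclideanSpace ℝ (Fin n) =>
      (gridCube (l q.2) q.1).indicator (1 : EuclideanSpace ℝ (Fin n) → ℝ≥0∞) q.2 := by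
  have hs : MeasurableSet {q : EuclideanSpace ℝ (Fin n) × EuclideanSpace ℝ (Fin n) |
      q.2 ∈ gridCube (l q.2) q.1} := by
    refine measurableSet_eq_fun (f := fun q : EuclideanSpace ℝ (Fin n) × EuclideanSpace ℝ (Fin n) =>
        cubeIndex (l q.2) q.2) (g := fun q => cubeIndex (l q.2) q.1) ?_ ?_
    all_goals
      refine measurable_pi_lambda _ fun i => Int.measurable_floor.comp ?_
      have := hl
      fun_prop
  exact (measurable_const (a := (1 : ℝ≥0∞))).indicator hs

/-- A compactly supported function is dominated by an integral of its derivative over cubes whose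
side depends only on the point at which the derivative is taken. -/
theorem exists_enorm_le_lintegral_gridCube {F : Type*} [NormedAddCommGroup F] [NormedSpace ℝ F]
    (hn : 1 ≤ n) {W : EuclideanSpace ℝ (Fin n) → F}
    (hW : ContDiff ℝ 1 W) (hWc : HasCompactSupport W) :
    ∃ l : EuclideanSpace ℝ (Fin n) → ℝ, Measurable l ∧ (∀ y, 0 < l y) ∧
      ∀ x, ‖W x‖ₑ ≤ ENNReal.ofReal (n * 2 ^ n * 2 ^ (n + 2)) *
        ∫⁻ y, ‖fderiv ℝ W y‖ₑ *
          (ENNReal.ofReal (l y / l y ^ n) * (gridCube (l y) x).indicator 1 y) := by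
  obtain ⟨l, D, hl, hDm, hDd, hle⟩ := exists_enorm_le_tsum_gridCube hn hW hWc
  have hex : ∃ L : EuclideanSpace ℝ (Fin n) → ℝ, Measurable L ∧ (∀ y, 0 < L y) ∧
      ∀ k, ∀ y ∈ D k, L y = l k := by
    classical
    let c : EuclideanSpace ℝ (Fin n) → ℕ := fun y => if h : ∃ k, y ∈ D k then h.choose + 1 else 0
    have hc : ∀ k, ∀ y ∈ D k, c y = k + 1 := by
      intro k y hy
      have h : ∃ k, y ∈ D k := ⟨k, hy⟩
      simp only [c, dif_pos h]
      by_contra hne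
      exact Set.disjoint_left.mp (hDd (fun e => hne (by rw [e]))) h.choose_spec hy
    have hcm : Measurable c := by
      refine measurable_to_countable' fun j => ?_
      rcases j with _ | j
      · have : c ⁻¹' {0} = (⋃ k, D k)ᶜ := by
          ext y
          by_cases h : ∃ k, y ∈ D k
          · simp [c, h]
          · simp [c, h]
            simpa using h
        rw [this]
        exact (MeasurableSet.iUnion hDm).compl
      · have : c ⁻¹' {j + 1} = D j := by
          ext y
          refine ⟨fun hy => ?_, fun hy => hc j y hy⟩
          by_cases h : ∃ k, y ∈ D k
          · obtain ⟨k, hk⟩ := h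
            have h1 : c y = j + 1 := hy
            rw [hc k y hk] at h1
            rwa [← Nat.succ_injective h1]
          · simp [c, h] at hy
        rw [this]
        exact hDm j
    let v : ℕ → ℝ := fun j => if j = 0 then 1 else l (j - 1)
    have hv : ∀ j, 0 < v j := fun j => by
      by_cases h : j = 0
      · simp [v, h]
      · simp [v, h, hl]
    exact ⟨fun y => v (c y), (measurable_from_top (f := v)).comp hcm, fun y => hv _,
      fun k y hy => by simp [hc k y hy, v]⟩
  obtain ⟨L, hLm, hL0, hLD⟩ := hex
  refine ⟨L, hLm, hL0, fun x => (hle x).trans ?_⟩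
  set K : ℝ≥0∞ := ENNReal.ofReal (n * 2 ^ n * 2 ^ (n + 2))
  set Φ : EuclideanSpace ℝ (Fin n) → ℝ≥0∞ := fun y => ‖fderiv ℝ W y‖ₑ *
    (ENNReal.ofReal (L y / L y ^ n) * (gridCube (L y) x).indicator 1 y)
  have hterm : ∀ k, ENNReal.ofReal (n * 2 ^ n * 2 ^ (n + 2) * (l k / l k ^ n)) *
      ∫⁻ y in gridCube (l k) x ∩ D k, ‖fderiv ℝ W y‖ₑ ≤ K * ∫⁻ y in D k, Φ y := by
    intro k
    rw [ENNReal.ofReal_mul (by positivity), mul_assoc]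
    refine mul_le_mul_right ?_ _
    rw [← lintegral_const_mul' _ _ ENNReal.ofReal_ne_top]
    calc _ ≤ ∫⁻ y in gridCube (l k) x ∩ D k, Φ y := by
          refine setLIntegral_mono' ((measurableSet_gridCube _ _).inter (hDm k)) fun y hy => ?_
          simp only [Φ, hLD k y hy.2]
          rw [indicator_of_mem hy.1, Pi.one_apply, mul_one, mul_comm]
      _ ≤ _ := lintegral_mono_set inter_subset_right
  calc _ ≤ ∑' k, K * ∫⁻ y in D k, Φ y := ENNReal.tsum_le_tsum hterm
    _ = K * ∫⁻ y in ⋃ k, D k, Φ y := by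
        rw [ENNReal.tsum_mul_left, lintegral_iUnion hDm hDd]
    _ ≤ _ := mul_le_mul_right (setLIntegral_le_lintegral _ _) _

theorem enorm_fderiv_iteratedFDeriv_eq {u : EuclideanSpace ℝ (Fin n) → ℝ} {j : ℕ}
    (x : EuclideanSpace ℝ (Fin n)) :
    ‖fderiv ℝ (iteratedFDeriv ℝ j u) x‖ₑ = ‖iteratedFDeriv ℝ (j + 1) u x‖ₑ := by
  rw [← ofReal_norm, ← ofReal_norm, norm_fderiv_iteratedFDeriv]

/-- Pointwise representation: a smooth compactly supported function is dominated by an integral of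
its `m`-th derivative against the kernels `scaleKernel` with a variable scale. -/
theorem exists_enorm_le_lintegral_scaleKernel {m : ℕ} (hm : 1 ≤ m) (hmn : m < n) :
    ∃ C : ℝ≥0, ∀ u : EuclideanSpace ℝ (Fin n) → ℝ, ContDiff ℝ (⊤ : ℕ∞) u →
      HasCompactSupport u → ∃ l : EuclideanSpace ℝ (Fin n) → ℝ, Measurable l ∧ (∀ y, 0 < l y) ∧
        ∀ x, ‖u x‖ₑ ≤
          C * ∫⁻ y, ‖iteratedFDeriv ℝ m u y‖ₑ * scaleKernel (n - m) (l y) ‖y - x‖ := by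
  obtain ⟨j, rfl⟩ : ∃ j, m = j + 1 := ⟨m - 1, by omega⟩
  set K : ℝ≥0 := Real.toNNReal (n * 2 ^ n * 2 ^ (n + 2))
  have hWd : ∀ u : EuclideanSpace ℝ (Fin n) → ℝ, ContDiff ℝ (⊤ : ℕ∞) u →
      ContDiff ℝ 1 (iteratedFDeriv ℝ j u) := fun u hu =>
    hu.iteratedFDeriv_right (by exact_mod_cast le_top)
  have hgm : ∀ u : EuclideanSpace ℝ (Fin n) → ℝ, ContDiff ℝ (⊤ : ℕ∞) u →
      Measurable fun y => ‖iteratedFDeriv ℝ (j + 1) u y‖ₑ := fun u hu =>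
    (hu.continuous_iteratedFDeriv (by exact_mod_cast le_top)).enorm.measurable
  rcases j with _ | j
  · refine ⟨K * Real.toNNReal ((n + 1) ^ n), fun u hu huc => ?_⟩
    obtain ⟨l, hlm, hl0, hle⟩ := exists_enorm_le_lintegral_gridCube (by omega) (hWd u hu)
      (huc.iteratedFDeriv (𝕜 := ℝ) 0)
    refine ⟨l, hlm, hl0, fun x => ?_⟩
    have h0 : ‖iteratedFDeriv ℝ 0 u x‖ₑ = ‖u x‖ₑ := by
      rw [← ofReal_norm, ← ofReal_norm, norm_iteratedFDeriv_zero]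
    rw [← h0, ENNReal.coe_mul, mul_assoc]
    refine (hle x).trans (mul_le_mul_right ?_ _)
    rw [← lintegral_const_mul' _ _ ENNReal.coe_ne_top]
    refine lintegral_mono fun y => ?_
    rw [enorm_fderiv_iteratedFDeriv_eq, mul_left_comm (Real.toNNReal _ : ℝ≥0∞)]
    exact mul_le_mul_right
      (indicator_gridCube_le_scaleKernel (p := n - (0 + 1)) (by omega) (hl0 y) x y) _
  · obtain ⟨C₁, hC₁⟩ := exists_enorm_le_riesz_potential
      (volume : Measure (EuclideanSpace ℝ (Fin n))) (j := j)
      (by rw [finrank_euclideanSpace_fin]; omega)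
    rw [finrank_euclideanSpace_fin, show n - (j + 1) = n - (j + 1 + 1) + 1 by omega] at hC₁
    set p := n - (j + 1 + 1)
    obtain ⟨C₂, hC₂⟩ := exists_lintegral_gridCube_le_scaleKernel (n := n) (p := p) (by omega)
    refine ⟨C₁ * K * C₂, fun u hu huc => ?_⟩
    obtain ⟨l, hlm, hl0, hle⟩ := exists_enorm_le_lintegral_gridCube (by omega) (hWd u hu)
      (huc.iteratedFDeriv (𝕜 := ℝ) (j + 1))
    refine ⟨l, hlm, hl0, fun x => ?_⟩
    set g : EuclideanSpace ℝ (Fin n) → ℝ≥0∞ := fun y => ‖iteratedFDeriv ℝ (j + 1 + 1) u y‖ₑ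
    have hg : Measurable g := hgm u hu
    set R : EuclideanSpace ℝ (Fin n) → ℝ≥0∞ := fun z => (ENNReal.ofReal ‖z - x‖ ^ (p + 1))⁻¹
    have hR : Measurable R := by fun_prop
    have hφ := measurable_indicator_gridCube (n := n) hlm
    set φ : EuclideanSpace ℝ (Fin n) → EuclideanSpace ℝ (Fin n) → ℝ≥0∞ := fun z y =>
      (gridCube (l y) z).indicator 1 y
    have hφ' : Measurable fun q : EuclideanSpace ℝ (Fin n) × EuclideanSpace ℝ (Fin n) =>
      φ q.1 q.2 := hφ
    set a : EuclideanSpace ℝ (Fin n) → ℝ≥0∞ := fun y => ENNReal.ofReal (l y / l y ^ n)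
    have ha : Measurable a := by fun_prop
    rw [ENNReal.coe_mul, ENNReal.coe_mul, mul_assoc, mul_assoc]
    refine (hC₁ u hu huc x).trans (mul_le_mul_right ?_ _)
    calc ∫⁻ z, ‖iteratedFDeriv ℝ (j + 1) u z‖ₑ * R z
        ≤ ∫⁻ z, (K * ∫⁻ y, g y * (a y * φ z y)) * R z := by
          refine lintegral_mono fun z => mul_le_mul_left ((hle z).trans (le_of_eq ?_)) _
          congr 1
          refine lintegral_congr fun y => ?_
          rw [enorm_fderiv_iteratedFDeriv_eq]
      _ = K * ∫⁻ z, ∫⁻ y, g y * (a y * φ z y) * R z := by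
          rw [← lintegral_const_mul' _ _ ENNReal.coe_ne_top]
          refine lintegral_congr fun z => ?_
          rw [mul_assoc, lintegral_mul_const]
          exact hg.mul (ha.mul (hφ'.comp measurable_prodMk_left))
      _ = K * ∫⁻ y, ∫⁻ z, g y * (a y * φ z y) * R z := by
          rw [lintegral_lintegral_swap]
          exact (((hg.comp measurable_snd).mul ((ha.comp measurable_snd).mul hφ')).mul
            (hR.comp measurable_fst)).aemeasurable
      _ ≤ K * ∫⁻ y, C₂ * (g y * scaleKernel p (l y) ‖y - x‖) := by
          gcongr with y
          have e1 : ∀ z, g y * (a y * φ z y) * R z =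
              g y * (a y * (gridCube (l y) y).indicator R z) := by
            intro z
            by_cases hz : z ∈ gridCube (l y) y
            · simp [φ, indicator_of_mem hz, indicator_of_mem (mem_gridCube_comm.mp hz), mul_assoc]
            · simp [φ, indicator_of_notMem hz,
                indicator_of_notMem (fun h => hz (mem_gridCube_comm.mp h))]
          simp_rw [e1]
          rw [lintegral_const_mul _ ((hR.indicator (measurableSet_gridCube _ _)).const_mul _),
            lintegral_const_mul _ (hR.indicator (measurableSet_gridCube _ _)),
            lintegral_indicator (measurableSet_gridCube _ _), mul_left_comm (C₂ : ℝ≥0∞)]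
          exact mul_le_mul_right (hC₂ (l y) (hl0 y) x y) _
      _ = K * (C₂ * ∫⁻ y, g y * scaleKernel p (l y) ‖y - x‖) := by
          rw [lintegral_const_mul' _ _ ENNReal.coe_ne_top]

end ScaleKernel

section FrostmanSums

theorem scaleKernel_le_tsum (p : ℕ) {l ρ : ℝ} (hl : 0 < l) (hρ : 0 ≤ ρ) :
    scaleKernel p l ρ ≤ ∑' i : ℕ, if ρ < 2 ^ i * l then
      ENNReal.ofReal (2 ^ (p + 1) * ((1 / 2) ^ i * ((2 ^ i * l) ^ p)⁻¹)) else 0 := by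
  have hex : ∃ i : ℕ, ρ < 2 ^ i * l := by
    obtain ⟨i, hi⟩ := pow_unbounded_of_one_lt (ρ / l) (one_lt_two)
    exact ⟨i, by rwa [div_lt_iff₀ hl] at hi⟩
  classical
  have hi := Nat.find_spec hex
  have hmin := fun j => Nat.find_min hex (m := j)
  set i := Nat.find hex
  refine le_trans ?_ (ENNReal.le_tsum i)
  rw [if_pos hi]
  refine ENNReal.ofReal_le_ofReal ?_
  have hlow : 2 ^ i * l / 2 ≤ l + ρ := by
    rcases h : i with _ | j
    · simp; linarith
    · have := hmin j (by omega)
      rw [not_lt] at this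
      rw [pow_succ]
      linarith
  calc l / (l + ρ) ^ (p + 1) ≤ l / (2 ^ i * l / 2) ^ (p + 1) := by gcongr
    _ = _ := by
        rw [div_pow, pow_succ (2 ^ i * l) p, div_pow, one_pow]
        field_simp

theorem exists_tsum_rpow_lt_le {α : ℝ} (hα : 0 < α) :
    ∃ C : ℝ, 0 < C ∧ ∀ R : ℝ, 0 < R →
      ∑' k : ℕ, (if (1 / 2 : ℝ) ^ (k + 1) < R then
        ENNReal.ofReal (((1 / 2 : ℝ) ^ (k + 1)) ^ α) else 0) ≤ ENNReal.ofReal (C * R ^ α) := by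
  set q : ℝ := (1 / 2 : ℝ) ^ α
  have hq0 : 0 < q := by positivity
  have hq1 : q < 1 := Real.rpow_lt_one (by norm_num) (by norm_num) hα
  refine ⟨(1 - q)⁻¹, inv_pos.mpr (by linarith), fun R hR => ?_⟩
  have hex : ∃ k : ℕ, (1 / 2 : ℝ) ^ (k + 1) < R := by
    obtain ⟨k, hk⟩ := exists_pow_lt_of_lt_one hR (show (1 / 2 : ℝ) < 1 by norm_num)
    exact ⟨k, (pow_le_pow_of_le_one (by norm_num) (by norm_num) (Nat.le_succ k)).trans_lt hk⟩
  obtain ⟨k, hk, hmin⟩ : ∃ k : ℕ, (1 / 2 : ℝ) ^ (k + 1) < R ∧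
      ∀ j < k, ¬ (1 / 2 : ℝ) ^ (j + 1) < R := by
    classical
    exact ⟨Nat.find hex, Nat.find_spec hex, fun j hj => Nat.find_min hex hj⟩
  set F : ℕ → ℝ≥0∞ := fun k => if (1 / 2 : ℝ) ^ (k + 1) < R then
    ENNReal.ofReal (((1 / 2 : ℝ) ^ (k + 1)) ^ α) else 0 with hF
  have hF0 : ∑ i ∈ Finset.range k, F i = 0 := Finset.sum_eq_zero fun i hi =>
    if_neg (hmin i (Finset.mem_range.mp hi))
  have hsplit : ∑' i, F (i + k) = ∑' i, F i := by
    have h := Summable.sum_add_tsum_nat_add' (f := F) (k := k) ENNReal.summable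
    rwa [hF0, zero_add] at h
  rw [← hsplit]
  calc _ ≤ ∑' i : ℕ, ENNReal.ofReal (R ^ α * q ^ i) := by
          refine ENNReal.tsum_le_tsum fun i => ?_
          simp only [hF]
          split_ifs
          · refine ENNReal.ofReal_le_ofReal ?_
            have e : (1 / 2 : ℝ) ^ (i + k + 1) = (1 / 2) ^ (k + 1) * (1 / 2) ^ i := by
              rw [← pow_add]; congr 1; ring
            rw [e, Real.mul_rpow (by positivity) (by positivity),
              Real.rpow_pow_comm (by norm_num : (0 : ℝ) ≤ 1 / 2) α i |>.symm]
            gcongr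
          · exact zero_le
      _ = ENNReal.ofReal ((1 - q)⁻¹ * R ^ α) := by
          rw [← ENNReal.ofReal_tsum_of_nonneg (fun i => by positivity)
            ((summable_geometric_of_lt_one hq0.le hq1).mul_left _), tsum_mul_left,
            tsum_geometric_of_lt_one hq0.le hq1, mul_comm]

variable {E : Type*} [NormedAddCommGroup E] [MeasurableSpace E]

theorem exists_tsum_setLIntegral_ball_le {μ : Measure E} {d α A M : ℝ}
    (hα0 : 0 < α) (hα1 : α ≤ 1) (hA0 : 0 ≤ A) (hM : 0 ≤ M)
    (hA : ∀ (x : E) (r : ℝ), 0 < r → μ (Metric.ball x r) ≤ ENNReal.ofReal (A * r ^ d)) :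
    ∃ C : ℝ, 0 < C ∧ ∀ ψ : ℕ → E → ℝ≥0∞, (∀ k, Measurable (ψ k)) →
      (∀ k, ∫⁻ x, ψ k x ∂μ ≤ ENNReal.ofReal (M * (1 / 2) ^ (k + 1))) →
      (∀ x, ∑' k, ψ k x ≤ 1) → ∀ (y : E) (r : ℝ), 0 < r →
        ∑' k : ℕ, ENNReal.ofReal (((1 / 2 : ℝ) ^ (k + 1)) ^ (α - 1)) *
          ∫⁻ x in Metric.ball y r, ψ k x ∂μ ≤ ENNReal.ofReal (C * r ^ (α * d)) := by
  obtain ⟨C, hC, hsum⟩ := exists_tsum_rpow_lt_le hα0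
  refine ⟨M * C + A + 1, by positivity, fun ψ hψm hψ hψ1 y r hr => ?_⟩
  set R := r ^ d
  have hR : 0 < R := by positivity
  have hRα : r ^ (α * d) = R ^ α := by rw [mul_comm, Real.rpow_mul hr.le]
  have hterm : ∀ k : ℕ, ENNReal.ofReal (((1 / 2 : ℝ) ^ (k + 1)) ^ (α - 1)) *
      ∫⁻ x in Metric.ball y r, ψ k x ∂μ ≤
      ENNReal.ofReal M * (if (1 / 2 : ℝ) ^ (k + 1) < R then
        ENNReal.ofReal (((1 / 2 : ℝ) ^ (k + 1)) ^ α) else 0) +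
      ENNReal.ofReal (R ^ (α - 1)) * ∫⁻ x in Metric.ball y r, ψ k x ∂μ := by
    intro k
    set t : ℝ := (1 / 2) ^ (k + 1)
    have ht : 0 < t := by positivity
    split_ifs with h
    · refine le_add_right ?_
      calc _ ≤ ENNReal.ofReal (t ^ (α - 1)) * ENNReal.ofReal (M * t) := by
            gcongr
            exact (setLIntegral_le_lintegral _ _).trans (hψ k)
        _ = _ := by
            rw [← ENNReal.ofReal_mul (by positivity), ← ENNReal.ofReal_mul hM]
            congr 1
            rw [Real.rpow_sub_one ht.ne']
            field_simp
    · refine le_add_left ?_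
      gcongr 1
      exact ENNReal.ofReal_le_ofReal
        (Real.rpow_le_rpow_of_nonpos hR (not_lt.mp h) (by linarith))
  calc _ ≤ _ := ENNReal.tsum_le_tsum hterm
    _ ≤ ENNReal.ofReal M * ENNReal.ofReal (C * R ^ α) +
        ENNReal.ofReal (R ^ (α - 1)) * ENNReal.ofReal (A * R) := by
        rw [ENNReal.tsum_add, ENNReal.tsum_mul_left, ENNReal.tsum_mul_left]
        gcongr
        · exact hsum R hR
        · rw [← lintegral_tsum fun k => (hψm k).aemeasurable]
          calc _ ≤ ∫⁻ _x in Metric.ball y r, 1 ∂μ := lintegral_mono fun x => hψ1 x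
            _ ≤ _ := by rw [setLIntegral_one]; exact hA y r hr
    _ ≤ _ := by
        rw [← ENNReal.ofReal_mul hM, ← ENNReal.ofReal_mul (by positivity),
          ← ENNReal.ofReal_add (by positivity) (by positivity), hRα]
        refine ENNReal.ofReal_le_ofReal ?_
        have e : R ^ (α - 1) * (A * R) = A * R ^ α := by
          rw [Real.rpow_sub_one hR.ne']
          field_simp
        rw [e]
        have : 0 < R ^ α := by positivity
        linarith

theorem measurable_scaleKernel {β : Type*} [MeasurableSpace β] {p : ℕ} {f g : β → ℝ}
    (hf : Measurable f) (hg : Measurable g) : Measurable fun x => scaleKernel p (f x) (g x) := by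
  unfold scaleKernel
  fun_prop

theorem exists_tsum_lintegral_scaleKernel_le [OpensMeasurableSpace E] {μ : Measure E} {p : ℕ} {d α A M : ℝ}
    (hα0 : 0 < α) (hα1 : α ≤ 1) (hp : α * d = p) (hA0 : 0 ≤ A) (hM : 0 ≤ M)
    (hA : ∀ (x : E) (r : ℝ), 0 < r → μ (Metric.ball x r) ≤ ENNReal.ofReal (A * r ^ d)) :
    ∃ C : ℝ, 0 < C ∧ ∀ ψ : ℕ → E → ℝ≥0∞, (∀ k, Measurable (ψ k)) →
      (∀ k, ∫⁻ x, ψ k x ∂μ ≤ ENNReal.ofReal (M * (1 / 2) ^ (k + 1))) →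
      (∀ x, ∑' k, ψ k x ≤ 1) → ∀ (y : E) (l : ℝ), 0 < l →
        ∑' k : ℕ, ENNReal.ofReal (((1 / 2 : ℝ) ^ (k + 1)) ^ (α - 1)) *
          ∫⁻ x, scaleKernel p l ‖y - x‖ * ψ k x ∂μ ≤ ENNReal.ofReal C := by
  obtain ⟨C, hC, hball⟩ := exists_tsum_setLIntegral_ball_le hα0 hα1 hA0 hM hA
  refine ⟨2 ^ (p + 1) * C * 2, by positivity, fun ψ hψm hψ hψ1 y l hl => ?_⟩
  set c : ℕ → ℝ≥0∞ := fun i =>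
    ENNReal.ofReal (2 ^ (p + 1) * ((1 / 2) ^ i * ((2 ^ i * l) ^ p)⁻¹))
  have hterm : ∀ k, ∫⁻ x, scaleKernel p l ‖y - x‖ * ψ k x ∂μ ≤
      ∑' i, c i * ∫⁻ x in Metric.ball y (2 ^ i * l), ψ k x ∂μ := by
    intro k
    calc _ ≤ ∫⁻ x, ∑' i, c i * (Metric.ball y (2 ^ i * l)).indicator (ψ k) x ∂μ := by
          refine lintegral_mono fun x => ?_
          refine (mul_le_mul_left (scaleKernel_le_tsum p hl (norm_nonneg (y - x))) _).trans ?_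
          rw [← ENNReal.tsum_mul_right]
          refine ENNReal.tsum_le_tsum fun i => ?_
          split_ifs with h
          · rw [indicator_of_mem]
            rwa [Metric.mem_ball, dist_comm, dist_eq_norm]
          · simp
      _ = _ := by
          rw [lintegral_tsum fun i =>
            (((hψm k).indicator Metric.isOpen_ball.measurableSet).const_mul _).aemeasurable]
          refine tsum_congr fun i => ?_
          rw [lintegral_const_mul _ ((hψm k).indicator Metric.isOpen_ball.measurableSet),
            lintegral_indicator Metric.isOpen_ball.measurableSet]
  set b : ℕ → ℝ≥0∞ := fun k => ENNReal.ofReal (((1 / 2 : ℝ) ^ (k + 1)) ^ (α - 1))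
  calc _ ≤ ∑' k, b k * ∑' i, c i * ∫⁻ x in Metric.ball y (2 ^ i * l), ψ k x ∂μ :=
        ENNReal.tsum_le_tsum fun k => mul_le_mul_right (hterm k) _
    _ = ∑' i, c i * ∑' k, b k * ∫⁻ x in Metric.ball y (2 ^ i * l), ψ k x ∂μ := by
        simp_rw [← ENNReal.tsum_mul_left]
        rw [ENNReal.tsum_comm]
        refine tsum_congr fun i => tsum_congr fun k => mul_left_comm _ _ _
    _ ≤ ∑' i : ℕ, ENNReal.ofReal (2 ^ (p + 1) * C * (1 / 2) ^ i) := by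
        refine ENNReal.tsum_le_tsum fun i => ?_
        calc _ ≤ c i * ENNReal.ofReal (C * (2 ^ i * l) ^ (α * d)) :=
              mul_le_mul_right (hball ψ hψm hψ hψ1 y (2 ^ i * l) (by positivity)) _
          _ = _ := by
              rw [← ENNReal.ofReal_mul (by positivity), hp, Real.rpow_natCast]
              congr 1
              field_simp
    _ = _ := by
        rw [← ENNReal.ofReal_tsum_of_nonneg (fun i => by positivity)
          (summable_geometric_two.mul_left _), tsum_mul_left, tsum_geometric_two]

end FrostmanSums

section LevelPartition

variable {β : Type*} [MeasurableSpace β] {μ : Measure β}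

theorem ofReal_le_measure_levelRearr_le [IsFiniteMeasure μ] {h : β → ℝ≥0∞} (hh : Measurable h)
    {s : ℝ} (hs : ENNReal.ofReal s ≤ μ univ) :
    ENNReal.ofReal s ≤ μ {x | levelRearr μ h s ≤ h x} := by
  set lam := levelRearr μ h s
  rcases eq_or_ne lam 0 with h0 | h0
  · simpa [h0] using hs
  obtain ⟨ρ, hρm, hρlt, hρt⟩ := exists_seq_strictMono_tendsto' (pos_iff_ne_zero.mpr h0)
  have hset : {x | lam ≤ h x} = ⋂ j, {x | ρ j < h x} := by
    ext x
    simp only [mem_ofPred_eq, mem_iInter]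
    refine ⟨fun hx j => (hρlt j).2.trans_le hx, fun hx => ?_⟩
    exact le_of_tendsto' hρt fun j => (hx j).le
  have hanti : Antitone fun j => {x | ρ j < h x} := fun i j hij x hx =>
    (hρm.monotone hij).trans_lt hx
  rw [hset, hanti.measure_iInter (fun j => (measurableSet_lt measurable_const hh).nullMeasurableSet)
    ⟨0, measure_ne_top _ _⟩]
  exact le_iInf fun j => ((lt_levelRearr_iff μ h s (ρ j)).mp (hρlt j).2).le

/-- A `[0,1]`-valued function squeezed between the indicators of a strict and a non-strict
superlevel set of `h`, whose integral is prescribed. -/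
noncomputable def levelCutoff (μ : Measure β) (h : β → ℝ≥0∞) (s : ℝ) (x : β) : ℝ≥0∞ :=
  {x | levelRearr μ h s < h x}.indicator 1 x +
    (ENNReal.ofReal s - μ {x | levelRearr μ h s < h x}) / μ {x | h x = levelRearr μ h s} *
      {x | h x = levelRearr μ h s}.indicator 1 x

theorem measurable_levelCutoff {h : β → ℝ≥0∞} (hh : Measurable h) (s : ℝ) :
    Measurable (levelCutoff μ h s) :=
  (measurable_one.indicator (measurableSet_lt measurable_const hh)).add
    ((measurable_one.indicator (measurableSet_eq_fun hh measurable_const)).const_mul _)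

theorem ofReal_sub_le_measure_level [IsFiniteMeasure μ] {h : β → ℝ≥0∞} (hh : Measurable h)
    {s : ℝ} (hs : ENNReal.ofReal s ≤ μ univ) :
    ENNReal.ofReal s - μ {x | levelRearr μ h s < h x} ≤ μ {x | h x = levelRearr μ h s} := by
  rw [tsub_le_iff_left]
  refine (ofReal_le_measure_levelRearr_le hh hs).trans ?_
  refine (measure_mono fun x hx => ?_).trans (measure_union_le _ _)
  rcases lt_or_eq_of_le (show levelRearr μ h s ≤ h x from hx) with h1 | h1
  · exact Or.inl h1
  · exact Or.inr h1.symm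

theorem lintegral_levelCutoff [IsFiniteMeasure μ] {h : β → ℝ≥0∞} (hh : Measurable h)
    {s : ℝ} (hs : ENNReal.ofReal s ≤ μ univ) :
    ∫⁻ x, levelCutoff μ h s x ∂μ = ENNReal.ofReal s := by
  have h1 : MeasurableSet {x | levelRearr μ h s < h x} := measurableSet_lt measurable_const hh
  have h2 : MeasurableSet {x | h x = levelRearr μ h s} := measurableSet_eq_fun hh measurable_const
  unfold levelCutoff
  rw [lintegral_add_left (measurable_one.indicator h1),
    lintegral_const_mul _ (measurable_one.indicator h2), lintegral_indicator_one h1,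
    lintegral_indicator_one h2, ENNReal.div_mul_cancel' (fun h0 => ?_)
      (fun ht => absurd ht (measure_ne_top _ _))]
  · exact add_tsub_cancel_of_le (measure_levelRearr_lt_le μ h s)
  · exact le_antisymm ((ofReal_sub_le_measure_level hh hs).trans h0.le) zero_le

theorem levelCutoff_le_one [IsFiniteMeasure μ] {h : β → ℝ≥0∞} (hh : Measurable h)
    {s : ℝ} (hs : ENNReal.ofReal s ≤ μ univ) (x : β) : levelCutoff μ h s x ≤ 1 := by
  unfold levelCutoff
  rcases lt_trichotomy (levelRearr μ h s) (h x) with h1 | h1 | h1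
  · simp [indicator, h1, h1.ne']
  · have : (ENNReal.ofReal s - μ {x | levelRearr μ h s < h x}) /
        μ {x | h x = levelRearr μ h s} ≤ 1 :=
      ENNReal.div_le_of_le_mul (by rw [one_mul]; exact ofReal_sub_le_measure_level hh hs)
    simpa [indicator, h1.symm] using this
  · simp [indicator, h1.not_gt, h1.ne]

theorem levelRearr_le_of_levelCutoff_ne_zero {h : β → ℝ≥0∞} {s : ℝ} {x : β}
    (hx : levelCutoff μ h s x ≠ 0) : levelRearr μ h s ≤ h x := by
  by_contra hlt
  rw [not_le] at hlt
  exact hx (by simp [levelCutoff, indicator, hlt.le, hlt.ne])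

theorem levelCutoff_mono [IsFiniteMeasure μ] {h : β → ℝ≥0∞} (hh : Measurable h)
    {s s' : ℝ} (hss : s' ≤ s) (hs' : ENNReal.ofReal s' ≤ μ univ) (x : β) :
    levelCutoff μ h s' x ≤ levelCutoff μ h s x := by
  rcases eq_or_lt_of_le (levelRearr_antitone μ h hss) with heq | hlt
  · unfold levelCutoff
    rw [← heq]
    gcongr
  · rcases eq_or_ne (levelCutoff μ h s' x) 0 with h0 | h0
    · rw [h0]; exact zero_le
    · refine (levelCutoff_le_one hh hs' x).trans ?_
      have hx : levelRearr μ h s < h x := hlt.trans_le (levelRearr_le_of_levelCutoff_ne_zero h0)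
      simp [levelCutoff, indicator, hx]

theorem tsum_tsub_succ_le {f : ℕ → ℝ≥0∞} (hf : ∀ k, f (k + 1) ≤ f k) :
    ∑' k, (f k - f (k + 1)) ≤ f 0 := by
  rw [ENNReal.tsum_eq_iSup_nat]
  refine iSup_le fun K => ?_
  suffices ∑ k ∈ Finset.range K, (f k - f (k + 1)) + f K ≤ f 0 from le_self_add.trans this
  induction K with
  | zero => simp
  | succ K ih =>
    rw [Finset.sum_range_succ, add_assoc, tsub_add_cancel_of_le (hf K)]
    exact ih

/-- Splitting of a subunit function into pieces of prescribed integral, the `k`-th piece being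
carried by the set where `h` is at least the value of its rearrangement at `s k`. -/
theorem exists_level_partition [IsFiniteMeasure μ] {h : β → ℝ≥0∞} (hh : Measurable h)
    {s : ℕ → ℝ} (hs : ∀ k, s (k + 1) ≤ s k) (hs0 : ∀ k, ENNReal.ofReal (s k) ≤ μ univ) :
    ∃ ψ : ℕ → β → ℝ≥0∞, (∀ k, Measurable (ψ k)) ∧
      (∀ k, ∫⁻ x, ψ k x ∂μ = ENNReal.ofReal (s k) - ENNReal.ofReal (s (k + 1))) ∧
      (∀ x, ∑' k, ψ k x ≤ 1) ∧ ∀ k x, ψ k x ≠ 0 → levelRearr μ h (s k) ≤ h x := by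
  refine ⟨fun k x => levelCutoff μ h (s k) x - levelCutoff μ h (s (k + 1)) x,
    fun k => (measurable_levelCutoff hh _).sub (measurable_levelCutoff hh _), fun k => ?_,
    fun x => ?_, fun k x hx => ?_⟩
  · rw [lintegral_sub (measurable_levelCutoff hh _)
      (by rw [lintegral_levelCutoff hh (hs0 _)]; exact ENNReal.ofReal_ne_top)
      (ae_of_all _ fun x => levelCutoff_mono hh (hs k) (hs0 _) x),
      lintegral_levelCutoff hh (hs0 _), lintegral_levelCutoff hh (hs0 _)]
  · exact (tsum_tsub_succ_le (f := fun k => levelCutoff μ h (s k) x)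
      fun k => levelCutoff_mono hh (hs k) (hs0 _) x).trans (levelCutoff_le_one hh (hs0 0) x)
  · exact levelRearr_le_of_levelCutoff_ne_zero fun h0 => hx (by simp [h0])

end LevelPartition

section TruncatedPotential

theorem ofReal_rpow_half_le_setLIntegral {b a D : ℝ} (hb : b ≤ 1) (hD0 : 0 < D) (haD : a ≤ D / 2) :
    ENNReal.ofReal (D ^ b / 2) ≤ ∫⁻ s in Ioo a D, ENNReal.ofReal (s ^ (b - 1)) := by
  calc ENNReal.ofReal (D ^ b / 2)
      = ∫⁻ _s in Ioo (D / 2) D, ENNReal.ofReal (D ^ (b - 1)) := by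
        rw [setLIntegral_const, Real.volume_Ioo, ← ENNReal.ofReal_mul (by positivity),
          Real.rpow_sub_one hD0.ne']
        congr 1
        field_simp
        norm_num
    _ ≤ ∫⁻ s in Ioo (D / 2) D, ENNReal.ofReal (s ^ (b - 1)) := by
        refine setLIntegral_mono' measurableSet_Ioo fun s hs => ENNReal.ofReal_le_ofReal ?_
        exact Real.rpow_le_rpow_of_nonpos (by linarith [hs.1]) hs.2.le (by linarith)
    _ ≤ _ := lintegral_mono_set (Ioo_subset_Ioo_left haD)

/-- Riesz potentials of a truncated function are controlled by a weighted integral of its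
rearrangement away from the origin. -/
theorem exists_lintegral_min_riesz_le {n m : ℕ} (hm : 1 ≤ m) (hmn : m ≤ n)
    {Ω : Set (EuclideanSpace ℝ (Fin n))} (hΩ : MeasurableSet Ω) {V : ℝ} (hV : 0 < V)
    (hΩV : volume Ω = ENNReal.ofReal V) :
    ∃ C : ℝ, 0 < C ∧ ∀ g : EuclideanSpace ℝ (Fin n) → ℝ≥0∞, Measurable g → ∀ τ : ℝ, 0 < τ →
      ∀ x, ∫⁻ y in Ω, min (g y) (levelRearr (volume.restrict Ω) g (V * τ)) *
          (ENNReal.ofReal ‖y - x‖ ^ (n - m))⁻¹ ≤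
        ENNReal.ofReal C * ∫⁻ s in Ioo (τ / 2) 1,
          ENNReal.ofReal (s ^ ((m : ℝ) / n - 1)) * levelRearr (volume.restrict Ω) g (V * s) := by
  obtain ⟨C₀, hC₀, hpot⟩ := exists_setLIntegral_inv_pow_le
    (volume : Measure (EuclideanSpace ℝ (Fin n))) hm (by rwa [finrank_euclideanSpace_fin])
  rw [finrank_euclideanSpace_fin] at hpot
  set b : ℝ := (m : ℝ) / n
  have hn0 : (0 : ℝ) < n := by exact_mod_cast (by omega : 0 < n)
  have hb1 : b ≤ 1 := by
    rw [div_le_one hn0]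
    exact_mod_cast hmn
  refine ⟨2 * C₀ * V ^ b, by positivity, fun g hg τ hτ x => ?_⟩
  set Gr : ℝ → ℝ≥0∞ := fun s => levelRearr (volume.restrict Ω) g (V * s)
  set θ := levelRearr (volume.restrict Ω) g (V * τ)
  set K : EuclideanSpace ℝ (Fin n) → ℝ≥0∞ := fun y => (ENNReal.ofReal ‖y - x‖ ^ (n - m))⁻¹
  have hK : Measurable K := by fun_prop
  have hGr : Measurable Gr :=
    (levelRearr_antitone (volume.restrict Ω) g).measurable.comp (measurable_const_mul V)
  have hwm : Measurable fun s : ℝ => ENNReal.ofReal (s ^ (b - 1)) := by fun_prop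
  have hmin : Measurable fun y => min (g y) θ := hg.min measurable_const
  set ν₁ := (volume.restrict Ω).withDensity K
  set ν₂ := (volume.restrict (Ioo (τ / 2) 1)).withDensity fun s : ℝ => ENNReal.ofReal (s ^ (b - 1))
  have e1 : ∫⁻ y in Ω, min (g y) θ * K y = ∫⁻ y, min (g y) θ ∂ν₁ := by
    rw [lintegral_withDensity_eq_lintegral_mul _ hK hmin]
    exact lintegral_congr fun y => mul_comm _ _
  have e2 : ∫⁻ s in Ioo (τ / 2) 1, ENNReal.ofReal (s ^ (b - 1)) * Gr s = ∫⁻ s, Gr s ∂ν₂ := by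
    rw [lintegral_withDensity_eq_lintegral_mul _ hwm hGr]
    rfl
  rw [e1, e2, lintegral_eq_lintegral_level ν₁ hmin, lintegral_eq_lintegral_level ν₂ hGr,
    ← lintegral_const_mul' _ _ ENNReal.ofReal_ne_top]
  refine lintegral_mono fun r => ?_
  rcases le_or_gt θ (ENNReal.ofReal r) with hr | hr
  · have : {y | ENNReal.ofReal r < min (g y) θ} = ∅ := by
      ext y
      simp [hr.not_gt]
    rw [this, measure_empty]
    exact zero_le
  have hS : MeasurableSet {y | ENNReal.ofReal r < g y} := measurableSet_lt measurable_const hg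
  set Dm := (volume.restrict Ω) {y | ENNReal.ofReal r < g y}
  have hDm : Dm = volume ({y | ENNReal.ofReal r < g y} ∩ Ω) := Measure.restrict_apply hS
  have hDle : Dm ≤ ENNReal.ofReal V := by
    rw [hDm, ← hΩV]
    exact measure_mono inter_subset_right
  have hDt : Dm ≠ ⊤ := (hDle.trans_lt ENNReal.ofReal_lt_top).ne
  obtain ⟨D, hD0, hDD⟩ : ∃ D : ℝ, 0 ≤ D ∧ Dm = ENNReal.ofReal (V * D) :=
    ⟨Dm.toReal / V, by positivity, by
      rw [mul_div_cancel₀ _ hV.ne', ENNReal.ofReal_toReal hDt]⟩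
  have hτD : τ < D := by
    have h1 := (lt_levelRearr_iff (volume.restrict Ω) g (V * τ) (ENNReal.ofReal r)).mp hr
    change ENNReal.ofReal (V * τ) < Dm at h1
    rw [hDD, ENNReal.ofReal_lt_ofReal_iff_of_nonneg (by positivity)] at h1
    exact lt_of_mul_lt_mul_left h1 hV.le
  have hDpos : 0 < D := hτ.trans hτD
  have hD1 : D ≤ 1 := by
    rw [hDD, ENNReal.ofReal_le_ofReal_iff hV.le] at hDle
    nlinarith
  calc ν₁ {y | ENNReal.ofReal r < min (g y) θ}
      = ∫⁻ y in {y | ENNReal.ofReal r < g y} ∩ Ω, K y := by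
        have : {y | ENNReal.ofReal r < min (g y) θ} = {y | ENNReal.ofReal r < g y} := by
          ext y
          simp [hr]
        rw [this, withDensity_apply _ hS, Measure.restrict_restrict hS]
    _ ≤ ENNReal.ofReal (C₀ * (V * D) ^ b) :=
        hpot x _ (V * D) (by positivity) (hS.inter hΩ) (by rw [← hDm, hDD])
    _ = ENNReal.ofReal (2 * C₀ * V ^ b) * ENNReal.ofReal (D ^ b / 2) := by
        rw [← ENNReal.ofReal_mul (by positivity), Real.mul_rpow hV.le hD0]
        congr 1
        ring
    _ ≤ ENNReal.ofReal (2 * C₀ * V ^ b) * ∫⁻ s in Ioo (τ / 2) D, ENNReal.ofReal (s ^ (b - 1)) := by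
        gcongr
        exact ofReal_rpow_half_le_setLIntegral hb1 hDpos (by linarith)
    _ ≤ _ := by
        gcongr
        have hS2 : MeasurableSet {s | ENNReal.ofReal r < Gr s} :=
          measurableSet_lt measurable_const hGr
        rw [withDensity_apply _ hS2, Measure.restrict_restrict hS2]
        refine lintegral_mono_set fun s hs => ⟨?_, hs.1, hs.2.trans_le hD1⟩
        refine (lt_levelRearr_iff (volume.restrict Ω) g (V * s) (ENNReal.ofReal r)).mpr ?_
        change _ < Dm
        rw [hDD]
        have hs0 : 0 < s := by linarith [hs.1]
        exact (ENNReal.ofReal_lt_ofReal_iff (by positivity)).mpr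
          (mul_lt_mul_of_pos_left hs.2 hV)

end TruncatedPotential

section BlockRearrangement

variable {β : Type*} [MeasurableSpace β]

theorem levelRearr_eq_zero_of_le {ν : Measure β} {g : β → ℝ≥0∞} {s : ℝ}
    (h : ν univ ≤ ENNReal.ofReal s) : levelRearr ν g s = 0 := by
  by_contra h0
  have h1 := (lt_levelRearr_iff ν g s 0).mp (pos_iff_ne_zero.mpr h0)
  exact absurd (h1.trans_le (measure_mono (subset_univ _))) h.not_gt

theorem lintegral_le_mul_setLIntegral_levelRearr {ν : Measure β} [SFinite ν] {g : β → ℝ≥0∞}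
    (hg : Measurable g) {V a : ℝ} (hV : 0 < V) (hν : ν univ ≤ ENNReal.ofReal (V * a)) :
    ∫⁻ x, g x ∂ν ≤ ENNReal.ofReal V * ∫⁻ t in Ioo a (a + a), levelRearr ν g (V * (t - a)) := by
  set F : ℝ → ℝ≥0∞ := (Ioi 0).indicator (levelRearr ν g)
  have hF : Measurable F := (levelRearr_antitone ν g).measurable.indicator measurableSet_Ioi
  have hscale := lintegral_comp_add_smul volume (-(V * a)) hV.ne' hF
  rw [Module.finrank_self, pow_one, abs_of_pos (inv_pos.mpr hV)] at hscale
  calc ∫⁻ x, g x ∂ν = ∫⁻ y, F y := by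
        rw [← lintegral_levelRearr ν hg, ← lintegral_indicator measurableSet_Ioi]
    _ = ENNReal.ofReal V * ∫⁻ t, F (-(V * a) + V • t) := by
        rw [hscale, ← mul_assoc, ← ENNReal.ofReal_mul hV.le, mul_inv_cancel₀ hV.ne',
          ENNReal.ofReal_one, one_mul]
    _ ≤ _ := by
        refine mul_le_mul_right ?_ _
        rw [← lintegral_indicator measurableSet_Ioo]
        refine lintegral_mono fun t => ?_
        have e : -(V * a) + V • t = V * (t - a) := by simp; ring
        simp only [e]
        rcases le_or_gt t a with h1 | h1
        · have : V * (t - a) ≤ 0 := mul_nonpos_of_nonneg_of_nonpos hV.le (by linarith)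
          simp [F, indicator, this.not_gt]
        · rcases le_or_gt (a + a) t with h2 | h2
          · have h0 : levelRearr ν g (V * (t - a)) = 0 :=
              levelRearr_eq_zero_of_le (hν.trans (ENNReal.ofReal_le_ofReal (by gcongr; linarith)))
            simp [F, indicator, h0]
          · have hp : 0 < V * (t - a) := mul_pos hV (by linarith)
            rw [indicator_of_mem (show t ∈ Ioo a (a + a) from ⟨h1, h2⟩)]
            simp [F, hp]

theorem vol01_lt_levelRearr_mul (ν : Measure β) (g : β → ℝ≥0∞) {V : ℝ} (hV : 0 < V) (ρ : ℝ≥0∞) :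
    vol01 {t | ρ < levelRearr ν g (V * t)} = min (ν {x | ρ < g x} / ENNReal.ofReal V) 1 := by
  rw [← vol01_ofReal_lt]
  congr 1
  ext t
  rw [mem_ofPred_eq, mem_ofPred_eq, lt_levelRearr_iff, ENNReal.ofReal_mul hV.le,
    ENNReal.lt_div_iff_mul_lt (Or.inl (by simpa using hV)) (Or.inl ENNReal.ofReal_ne_top), mul_comm]

theorem volume_lt_levelRearr_block_le (ν : Measure β) (g : β → ℝ≥0∞) {V a : ℝ} (hV : 0 < V)
    (hν : ν univ ≠ ⊤) (ρ : ℝ≥0∞) :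
    volume {t | a ≤ t ∧ ρ < levelRearr ν g (V * (t - a))} ≤
      ν {x | ρ < g x} / ENNReal.ofReal V := by
  set b := (ν {x | ρ < g x}).toReal
  have hb : ν {x | ρ < g x} = ENNReal.ofReal b :=
    (ENNReal.ofReal_toReal ((measure_mono (subset_univ _)).trans_lt hν.lt_top).ne).symm
  rw [hb, ← ENNReal.ofReal_div_of_pos hV]
  calc _ ≤ volume (Ico a (a + b / V)) := by
        refine measure_mono fun t ht => ⟨ht.1, ?_⟩
        have h1 := (lt_levelRearr_iff ν g (V * (t - a)) ρ).mp ht.2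
        rw [hb, ENNReal.ofReal_lt_ofReal_iff_of_nonneg
          (mul_nonneg hV.le (sub_nonneg.mpr ht.1))] at h1
        have h2 : t - a < b / V := by rwa [lt_div_iff₀ hV, mul_comm]
        linarith
    _ = _ := by rw [Real.volume_Ico, add_sub_cancel_left]

/-- Measures which sum up to at most `ν` and whose masses decay geometrically: the integrals of `g`
against them are controlled by a decreasing function not larger in norm than the rearrangement of
`g`. -/
theorem IsRINorm.exists_antitone_lintegral_le {N : (ℝ → ℝ≥0∞) → ℝ≥0∞} (hN : IsRINorm N)
    {ν : Measure β} {g : β → ℝ≥0∞} (hg : Measurable g) {V : ℝ} (hV : 0 < V)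
    {ν' : ℕ → Measure β} [∀ k, SFinite (ν' k)]
    (hsum : ∀ S, MeasurableSet S → ∑' k, ν' k S ≤ ν S) {a : ℕ → ℝ} (ha0 : ∀ k, 0 < a k)
    (ha1 : ∀ k, a k ≤ 1 / 2) (ha : ∀ k, a (k + 1) ≤ a k / 2)
    (hν' : ∀ k, ν' k univ ≤ ENNReal.ofReal (V * a k)) :
    ∃ F : ℝ → ℝ≥0∞, Antitone F ∧ N F ≤ N (fun t => levelRearr ν g (V * t)) ∧
      ∀ k s, s < a k → ∫⁻ x, g x ∂ν' k ≤ ENNReal.ofReal (V * a k) * F s := by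
  set I : ℕ → Set ℝ := fun k => Ico (a k) (a k + a k)
  have hmono : Antitone a := antitone_nat_of_succ_le fun k => (ha k).trans (by linarith [ha0 k])
  have hlt : ∀ i j, i < j → a j + a j ≤ a i := fun i j hij => by
    have h1 := hmono (Nat.succ_le_of_lt hij)
    have h2 := ha i
    simp only [Nat.succ_eq_add_one] at h1
    linarith
  have hd : Pairwise fun i j => Disjoint (I i) (I j) := by
    have key : ∀ i j, i < j → Disjoint (I i) (I j) := fun i j hij =>
      Set.disjoint_left.mpr fun t hi hj => by
        have := hlt i j hij
        linarith [hi.1, hj.2]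
    intro i j hij
    rcases lt_or_gt_of_ne hij with h | h
    · exact key i j h
    · exact (key j i h).symm
  have h01 : ∀ k, I k ⊆ Ioo 0 1 := fun k t ht =>
    ⟨(ha0 k).trans_le ht.1, ht.2.trans_le (by linarith [ha1 k])⟩
  set G : ℝ → ℝ≥0∞ := fun t =>
    ∑' k, (I k).indicator (fun _ => levelRearr (ν' k) g (V * (t - a k))) t
  have hGI : ∀ k, ∀ t ∈ I k, G t = levelRearr (ν' k) g (V * (t - a k)) := fun k t ht =>
    tsum_indicator_const_of_mem hd (fun k => levelRearr (ν' k) g (V * (t - a k))) ht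
  have hGa : ∀ k, AntitoneOn G (I k) := fun k s hs t ht hst => by
    rw [hGI k s hs, hGI k t ht]
    exact levelRearr_antitone _ _ (by gcongr)
  have hNG : N G ≤ N fun t => levelRearr ν g (V * t) := by
    refine hN.le_of_distribution fun ρ => ?_
    rw [vol01_lt_levelRearr_mul ν g hV]
    refine le_min ?_ ((measure_mono (subset_univ _)).trans (by simp [vol01]))
    calc vol01 {t | ρ < G t} ≤ volume {t | ρ < G t} := Measure.restrict_apply_le _ _
      _ ≤ volume (⋃ k, {t | a k ≤ t ∧ ρ < levelRearr (ν' k) g (V * (t - a k))}) := by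
          refine measure_mono fun t (ht : ρ < G t) => ?_
          by_cases hex : ∃ k, t ∈ I k
          · obtain ⟨k, hk⟩ := hex
            rw [hGI k t hk] at ht
            exact mem_iUnion.mpr ⟨k, hk.1, ht⟩
          · exfalso
            have : G t = 0 := ENNReal.tsum_eq_zero.mpr fun k =>
              indicator_of_notMem (fun h : t ∈ I k => hex ⟨k, h⟩) _
            rw [this] at ht
            exact not_lt_zero ht
      _ ≤ ∑' k, ν' k {x | ρ < g x} / ENNReal.ofReal V :=
          (measure_iUnion_le _).trans (ENNReal.tsum_le_tsum fun k =>
            volume_lt_levelRearr_block_le (ν' k) g hV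
              ((hν' k).trans_lt ENNReal.ofReal_lt_top).ne ρ)
      _ ≤ _ := by
          simp_rw [div_eq_mul_inv]
          rw [ENNReal.tsum_mul_right]
          gcongr
          exact hsum _ (measurableSet_lt measurable_const hg)
  set avg : ℕ → ℝ≥0∞ := fun k => (ENNReal.ofReal (a k))⁻¹ * ∫⁻ s in Ioo (a k) (a k + a k), G s
  set f : ℝ → ℝ≥0∞ := fun t => ∑' k, (I k).indicator (fun _ => avg k) t
  refine ⟨decRearr f, levelRearr_antitone vol01 f,
    (hN.decRearr_eq f).le.trans ((hN.average_le ha0 hd h01 hGa).trans hNG), fun k s hs => ?_⟩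
  have hF : avg k ≤ decRearr f s := by
    refine le_of_forall_lt fun ρ hρ => (lt_levelRearr_iff vol01 f s ρ).mpr ?_
    calc ENNReal.ofReal s < ENNReal.ofReal (a k) := (ENNReal.ofReal_lt_ofReal_iff (ha0 k)).mpr hs
      _ = vol01 (I k) := by
          rw [vol01, Measure.restrict_apply measurableSet_Ico, inter_eq_left.mpr (h01 k),
            Real.volume_Ico, add_sub_cancel_left]
      _ ≤ _ := by
          refine measure_mono fun t ht => ?_
          change ρ < f t
          rwa [show f t = avg k from tsum_indicator_const_of_mem hd avg ht]
  calc ∫⁻ x, g x ∂ν' k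
      ≤ ENNReal.ofReal V * ∫⁻ t in Ioo (a k) (a k + a k), levelRearr (ν' k) g (V * (t - a k)) :=
        lintegral_le_mul_setLIntegral_levelRearr hg hV (hν' k)
    _ = ENNReal.ofReal V * ∫⁻ t in Ioo (a k) (a k + a k), G t := by
        congr 1
        exact setLIntegral_congr_fun measurableSet_Ioo fun t ht =>
          (hGI k t ⟨ht.1.le, ht.2⟩).symm
    _ = ENNReal.ofReal (V * a k) * avg k := by
        rw [ENNReal.ofReal_mul hV.le, mul_assoc, ← mul_assoc (ENNReal.ofReal (a k)),
          ENNReal.mul_inv_cancel (by simpa using ha0 k) ENNReal.ofReal_ne_top, one_mul]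
    _ ≤ _ := by gcongr

end BlockRearrangement

section Interpolation

variable {n : ℕ}

theorem scaleKernel_le_inv_pow (p : ℕ) {l ρ : ℝ} (hl : 0 < l) (hρ : 0 ≤ ρ) :
    scaleKernel p l ρ ≤ (ENNReal.ofReal ρ ^ p)⁻¹ := by
  calc scaleKernel p l ρ ≤ ENNReal.ofReal (((l + ρ) ^ p)⁻¹) := by
        refine ENNReal.ofReal_le_ofReal ?_
        rw [div_le_iff₀ (by positivity), pow_succ, ← mul_assoc, inv_mul_cancel₀ (by positivity)]
        linarith
    _ = (ENNReal.ofReal (l + ρ) ^ p)⁻¹ := by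
        rw [ENNReal.ofReal_inv_of_pos (by positivity), ENNReal.ofReal_pow (by positivity)]
    _ ≤ _ := by
        gcongr
        linarith

/-- The potential `y ↦ ∫ scaleKernel p (l y) ‖y - x‖ ψ(x) dμ(x)`. -/
noncomputable def scalePotential (p : ℕ) (l : EuclideanSpace ℝ (Fin n) → ℝ)
    (μ : Measure (EuclideanSpace ℝ (Fin n))) (ψ : EuclideanSpace ℝ (Fin n) → ℝ≥0∞)
    (y : EuclideanSpace ℝ (Fin n)) : ℝ≥0∞ :=
  ∫⁻ x, scaleKernel p (l y) ‖y - x‖ * ψ x ∂μ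

variable {p : ℕ} {l : EuclideanSpace ℝ (Fin n) → ℝ} {μ : Measure (EuclideanSpace ℝ (Fin n))}
  {ψ : EuclideanSpace ℝ (Fin n) → ℝ≥0∞}

theorem measurable_scaleKernel_mul (hl : Measurable l) (hψ : Measurable ψ) :
    Measurable fun q : EuclideanSpace ℝ (Fin n) × EuclideanSpace ℝ (Fin n) =>
      scaleKernel p (l q.1) ‖q.1 - q.2‖ * ψ q.2 :=
  (measurable_scaleKernel (hl.comp measurable_fst) (by fun_prop)).mul (hψ.comp measurable_snd)

theorem measurable_scalePotential [SFinite μ] (hl : Measurable l) (hψ : Measurable ψ) :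
    Measurable (scalePotential p l μ ψ) :=
  (measurable_scaleKernel_mul hl hψ).lintegral_prod_right'

theorem lintegral_mul_scalePotential [SFinite μ] (hl : Measurable l) (hψ : Measurable ψ)
    {ν : Measure (EuclideanSpace ℝ (Fin n))} [SFinite ν] {g : EuclideanSpace ℝ (Fin n) → ℝ≥0∞}
    (hg : Measurable g) :
    ∫⁻ y, g y * scalePotential p l μ ψ y ∂ν =
      ∫⁻ x, (∫⁻ y, g y * scaleKernel p (l y) ‖y - x‖ ∂ν) * ψ x ∂μ := by
  have hm : Measurable fun q : EuclideanSpace ℝ (Fin n) × EuclideanSpace ℝ (Fin n) =>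
      g q.1 * (scaleKernel p (l q.1) ‖q.1 - q.2‖ * ψ q.2) :=
    (hg.comp measurable_fst).mul (measurable_scaleKernel_mul hl hψ)
  calc _ = ∫⁻ y, ∫⁻ x, g y * (scaleKernel p (l y) ‖y - x‖ * ψ x) ∂μ ∂ν := by
        refine lintegral_congr fun y => ?_
        rw [scalePotential, lintegral_const_mul]
        exact (measurable_scaleKernel_mul hl hψ).comp measurable_prodMk_left
    _ = ∫⁻ x, ∫⁻ y, g y * (scaleKernel p (l y) ‖y - x‖ * ψ x) ∂ν ∂μ :=
        lintegral_lintegral_swap hm.aemeasurable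
    _ = _ := by
        refine lintegral_congr fun x => ?_
        rw [← lintegral_mul_const]
        · exact lintegral_congr fun y => (mul_assoc _ _ _).symm
        · exact hg.mul (measurable_scaleKernel hl (by fun_prop))

theorem mul_lintegral_le_of_le_on_support {β : Type*} [MeasurableSpace β] {ν : Measure β}
    {φ h : β → ℝ≥0∞} (hφ : Measurable φ) {c : ℝ≥0∞} (hc : ∀ x, φ x ≠ 0 → c ≤ h x) :
    c * ∫⁻ x, φ x ∂ν ≤ ∫⁻ x, h x * φ x ∂ν := by
  rw [← lintegral_const_mul _ hφ]
  refine lintegral_mono fun x => ?_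
  rcases eq_or_ne (φ x) 0 with h0 | h0
  · simp [h0]
  · exact mul_le_mul_left (hc x h0) _

/-- Level-by-level form of the reduction principle: dyadic values of the rearrangement of `u` with
respect to `μ` are bounded by a Hardy-type integral of the rearrangement of the `m`-th derivative
plus a decreasing function of no larger norm. -/
theorem IsRINorm.exists_levelRearr_le {NX : (ℝ → ℝ≥0∞) → ℝ≥0∞} (hX : IsRINorm NX)
    {m : ℕ} (hm : 1 ≤ m) (hmn : m < n) {d : ℝ} (hd1 : (n : ℝ) - m ≤ d) (hd2 : d ≤ n)
    {Ω : Set (EuclideanSpace ℝ (Fin n))} (hΩ : MeasurableSet Ω) {V : ℝ} (hV : 0 < V)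
    (hΩV : volume Ω = ENNReal.ofReal V) [IsFiniteMeasure μ] {M : ℝ} (hM : 0 < M)
    (hμM : μ univ = ENNReal.ofReal M) {A : ℝ} (hA0 : 0 ≤ A)
    (hA : ∀ (x : EuclideanSpace ℝ (Fin n)) (r : ℝ), 0 < r →
      μ (Metric.ball x r) ≤ ENNReal.ofReal (A * r ^ d)) :
    ∃ C : ℝ≥0, ∀ u : EuclideanSpace ℝ (Fin n) → ℝ, ContDiff ℝ (⊤ : ℕ∞) u →
      HasCompactSupport u → tsupport u ⊆ Ω → ∃ F : ℝ → ℝ≥0∞, Antitone F ∧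
        NX F ≤ NX (fun t => levelRearr (volume.restrict Ω)
          (fun x => ‖iteratedFDeriv ℝ m u x‖ₑ) (V * t)) ∧
        ∀ (k : ℕ) (s : ℝ), s < ((1 / 2 : ℝ) ^ (k + 1)) ^ ((n : ℝ) / d) / 2 →
          levelRearr μ (fun x => ‖u x‖ₑ) (M * (1 / 2) ^ (k + 1)) ≤
            C * ((∫⁻ r in Ioo (((1 / 2 : ℝ) ^ (k + 1)) ^ ((n : ℝ) / d) / 2) 1,
              ENNReal.ofReal (r ^ ((m : ℝ) / n - 1)) * levelRearr (volume.restrict Ω)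
                (fun x => ‖iteratedFDeriv ℝ m u x‖ₑ) (V * r)) +
              ENNReal.ofReal ((((1 / 2 : ℝ) ^ (k + 1)) ^ ((n : ℝ) / d)) ^ ((m : ℝ) / n)) *
                F s) := by
  have hp1 : (1 : ℝ) ≤ (n : ℝ) - m := by
    have : ((m + 1 : ℕ) : ℝ) ≤ n := by exact_mod_cast hmn
    push_cast at this
    linarith
  have hd0 : 0 < d := by linarith
  have hn0 : (0 : ℝ) < n := by linarith
  have hnd : 1 ≤ (n : ℝ) / d := by rwa [one_le_div hd0]
  set p := n - m
  have hpc : (p : ℝ) = n - m := by rw [Nat.cast_sub hmn.le]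
  set α : ℝ := ((n : ℝ) - m) / d
  have hα0 : 0 < α := by positivity
  have hα1 : α ≤ 1 := by rwa [div_le_one hd0]
  have hαd : α * d = p := by rw [hpc, div_mul_cancel₀ _ hd0.ne']
  obtain ⟨C₀, hrep⟩ := exists_enorm_le_lintegral_scaleKernel (n := n) hm hmn
  obtain ⟨C₂, hC₂, hfrost⟩ := exists_tsum_lintegral_scaleKernel_le (μ := μ) hα0 hα1 hαd hA0 hM.le hA
  obtain ⟨C₃, hC₃, hbath⟩ := exists_lintegral_min_riesz_le hm hmn.le hΩ hV hΩV
  set ε : ℝ := (2 * C₂)⁻¹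
  have hε : 0 < ε := by positivity
  have hεC : ENNReal.ofReal ε * ENNReal.ofReal C₂ = ENNReal.ofReal (1 / 2) := by
    rw [← ENNReal.ofReal_mul hε.le]
    congr 1
    simp only [ε]
    field_simp
  refine ⟨C₀ * Real.toNNReal (C₃ + V / (M * ε)), fun u hu huc huΩ => ?_⟩
  set g : EuclideanSpace ℝ (Fin n) → ℝ≥0∞ := fun y => ‖iteratedFDeriv ℝ m u y‖ₑ
  have hg : Measurable g :=
    (hu.continuous_iteratedFDeriv (by exact_mod_cast le_top)).enorm.measurable
  have hg0 : ∀ y, y ∉ Ω → g y = 0 := by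
    intro y hy
    have : iteratedFDeriv ℝ m u y = 0 := image_eq_zero_of_notMem_tsupport fun h =>
      hy (huΩ (tsupport_iteratedFDeriv_subset m h))
    simp [g, this]
  obtain ⟨l, hlm, hl0, hle⟩ := hrep u hu huc
  set t : ℕ → ℝ := fun k => (1 / 2) ^ (k + 1)
  have ht0 : ∀ k, 0 < t k := fun k => by positivity
  have ht1 : ∀ k, t k ≤ 1 := fun k => pow_le_one₀ (by norm_num) (by norm_num)
  have hts : ∀ k, t (k + 1) = t k / 2 := fun k => by simp only [t]; rw [pow_succ]; ring
  have hMt : ∀ k, ENNReal.ofReal (M * t k) ≤ μ univ := fun k => by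
    rw [hμM]
    exact ENNReal.ofReal_le_ofReal (mul_le_of_le_one_right hM.le (ht1 k))
  obtain ⟨ψ, hψm, hψi, hψ1, hψl⟩ := exists_level_partition (μ := μ)
    (h := fun x => ‖u x‖ₑ) hu.continuous.enorm.measurable (s := fun k => M * t k)
    (fun k => by rw [hts]; nlinarith [mul_pos hM (ht0 k)]) hMt
  have hψint : ∀ k, ∫⁻ x, ψ k x ∂μ = ENNReal.ofReal (M * t k / 2) := fun k => by
    rw [hψi, ← ENNReal.ofReal_sub _ (mul_nonneg hM.le (ht0 _).le), hts]
    congr 1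
    ring
  set P : ℕ → EuclideanSpace ℝ (Fin n) → ℝ≥0∞ := fun k => scalePotential p l μ (ψ k)
  have hPm : ∀ k, Measurable (P k) := fun k => measurable_scalePotential hlm (hψm k)
  have hPsum : ∀ y, ∑' k, ENNReal.ofReal (t k ^ (α - 1)) * P k y ≤ ENNReal.ofReal C₂ := fun y =>
    hfrost ψ hψm (fun k => (hψint k).le.trans (ENNReal.ofReal_le_ofReal
      (by nlinarith [mul_pos hM (ht0 k)]))) hψ1 y (l y) (hl0 y)
  set τ : ℕ → ℝ := fun k => t k ^ ((n : ℝ) / d)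
  have hτ0 : ∀ k, 0 < τ k := fun k => Real.rpow_pos_of_pos (ht0 k) _
  have hτ1 : ∀ k, τ k ≤ 1 := fun k => Real.rpow_le_one (ht0 k).le (ht1 k) (by linarith)
  have hτs : ∀ k, τ (k + 1) ≤ τ k / 2 := fun k => by
    simp only [τ]
    rw [hts, div_eq_mul_inv, Real.mul_rpow (ht0 k).le (by norm_num), div_eq_mul_inv]
    refine mul_le_mul_of_nonneg_left ?_ (hτ0 k).le
    calc ((2 : ℝ)⁻¹) ^ ((n : ℝ) / d) ≤ (2 : ℝ)⁻¹ ^ (1 : ℝ) :=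
          Real.rpow_le_rpow_of_exponent_ge (by norm_num) (by norm_num) hnd
      _ = _ := Real.rpow_one _
  set θ : ℕ → ℝ≥0∞ := fun k => levelRearr (volume.restrict Ω) g (V * τ k)
  have hSm : ∀ k, MeasurableSet {y | θ k < g y} := fun k => measurableSet_lt measurable_const hg
  set w : ℕ → EuclideanSpace ℝ (Fin n) → ℝ≥0∞ := fun k y =>
    ENNReal.ofReal ε * (ENNReal.ofReal (t k ^ (α - 1)) * P k y)
  have hwm : ∀ k, Measurable (w k) := fun k => ((hPm k).const_mul _).const_mul _
  have hwsum : ∀ y, ∑' k, w k y ≤ ENNReal.ofReal (1 / 2) := fun y => by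
    rw [ENNReal.tsum_mul_left, ← hεC]
    exact mul_le_mul_right (hPsum y) _
  set ν : ℕ → Measure (EuclideanSpace ℝ (Fin n)) := fun k =>
    ((volume.restrict Ω).restrict {y | θ k < g y}).withDensity (w k)
  have hνsum : ∀ S, MeasurableSet S → ∑' k, ν k S ≤ (volume.restrict Ω) S := by
    intro S hS
    calc ∑' k, ν k S ≤ ∑' k, ∫⁻ y in S, w k y ∂(volume.restrict Ω) := by
          refine ENNReal.tsum_le_tsum fun k => ?_
          rw [withDensity_apply _ hS, Measure.restrict_restrict hS]
          exact lintegral_mono_set inter_subset_left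
      _ = ∫⁻ y in S, ∑' k, w k y ∂(volume.restrict Ω) :=
          (lintegral_tsum fun k => (hwm k).aemeasurable).symm
      _ ≤ ∫⁻ _y in S, 1 ∂(volume.restrict Ω) := by
          refine lintegral_mono fun y => (hwsum y).trans ?_
          rw [← ENNReal.ofReal_one]
          exact ENNReal.ofReal_le_ofReal (by norm_num)
      _ = _ := setLIntegral_one S
  have hνuniv : ∀ k, ν k univ ≤ ENNReal.ofReal (V * (τ k / 2)) := by
    intro k
    calc ν k univ ≤ ∫⁻ _y in {y | θ k < g y}, ENNReal.ofReal (1 / 2) ∂(volume.restrict Ω) := by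
          rw [withDensity_apply _ MeasurableSet.univ, Measure.restrict_univ]
          exact lintegral_mono fun y => (ENNReal.le_tsum k).trans (hwsum y)
      _ ≤ ENNReal.ofReal (1 / 2) * ENNReal.ofReal (V * τ k) := by
          rw [setLIntegral_const]
          exact mul_le_mul_right (measure_levelRearr_lt_le _ _ _) _
      _ = _ := by
          rw [← ENNReal.ofReal_mul (by norm_num)]
          congr 1
          ring
  obtain ⟨F, hFa, hFX, hF⟩ := hX.exists_antitone_lintegral_le hg hV hνsum
    (a := fun k => τ k / 2) (fun k => half_pos (hτ0 k))
    (fun k => by linarith [hτ1 k]) (fun k => by linarith [hτs k]) hνuniv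
  refine ⟨F, hFa, hFX, fun k s hs => ?_⟩
  set H := ∫⁻ r in Ioo (τ k / 2) 1,
    ENNReal.ofReal (r ^ ((m : ℝ) / n - 1)) * levelRearr (volume.restrict Ω) g (V * r)
  set lam := levelRearr μ (fun x => ‖u x‖ₑ) (M * t k)
  change lam ≤ _ * (H + ENNReal.ofReal (τ k ^ ((m : ℝ) / n)) * F s)
  have hMtk : 0 < M * t k / 2 := half_pos (mul_pos hM (ht0 k))
  have hsmall : ∫⁻ y in Ω, min (g y) (θ k) * P k y ≤
      ENNReal.ofReal (M * t k / 2) * (ENNReal.ofReal C₃ * H) := by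
    rw [lintegral_mul_scalePotential hlm (hψm k) (hg.min measurable_const), ← hψint k, mul_comm,
      ← lintegral_const_mul _ (hψm k)]
    refine lintegral_mono fun x => mul_le_mul_left ?_ _
    refine le_trans (lintegral_mono fun y => ?_) (hbath g hg (τ k) (hτ0 k) x)
    exact mul_le_mul_right (scaleKernel_le_inv_pow p (hl0 y) (norm_nonneg _)) _
  have hlarge : ENNReal.ofReal (ε * t k ^ (α - 1)) *
      ∫⁻ y in {y | θ k < g y}, g y * P k y ∂(volume.restrict Ω) ≤
      ENNReal.ofReal (V * (τ k / 2)) * F s := by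
    refine le_trans (le_of_eq ?_) (hF k s hs)
    rw [lintegral_withDensity_eq_lintegral_mul _ (hwm k) hg,
      ← lintegral_const_mul' _ _ ENNReal.ofReal_ne_top]
    refine lintegral_congr fun y => ?_
    rw [ENNReal.ofReal_mul hε.le, Pi.mul_apply]
    simp only [w]
    ring
  have hlarge2 : ∫⁻ y in {y | θ k < g y}, g y * P k y ∂(volume.restrict Ω) ≤
      ENNReal.ofReal (M * t k / 2) *
        (ENNReal.ofReal (V / (M * ε)) * (ENNReal.ofReal (τ k ^ ((m : ℝ) / n)) * F s)) := by
    have hc : 0 < ε * t k ^ (α - 1) := mul_pos hε (Real.rpow_pos_of_pos (ht0 k) _)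
    have hτt : τ k = τ k ^ ((m : ℝ) / n) * t k ^ α := by
      simp only [τ]
      rw [← Real.rpow_mul (ht0 k).le, ← Real.rpow_add (ht0 k)]
      congr 1
      simp only [α]
      field_simp
      ring
    have heq : V * (τ k / 2) = ε * t k ^ (α - 1) *
        (M * t k / 2 * (V / (M * ε) * τ k ^ ((m : ℝ) / n))) := by
      rw [Real.rpow_sub_one (ht0 k).ne']
      nth_rewrite 1 [hτt]
      have := (ht0 k).ne'
      field_simp
    have h0 : 0 ≤ τ k ^ ((m : ℝ) / n) := (Real.rpow_pos_of_pos (hτ0 k) _).le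
    rw [heq, ENNReal.ofReal_mul hc.le, mul_assoc, ENNReal.mul_le_mul_iff_right
      (by simpa using hc) ENNReal.ofReal_ne_top] at hlarge
    refine hlarge.trans (le_of_eq ?_)
    rw [ENNReal.ofReal_mul hMtk.le, ENNReal.ofReal_mul (by positivity)]
    ring
  have hsplit : ∫⁻ y, g y * P k y ≤ (∫⁻ y in Ω, min (g y) (θ k) * P k y) +
      ∫⁻ y in {y | θ k < g y}, g y * P k y ∂(volume.restrict Ω) := by
    have e : ∫⁻ y, g y * P k y = ∫⁻ y in Ω, g y * P k y := by
      rw [← lintegral_indicator hΩ]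
      refine lintegral_congr fun y => ?_
      by_cases hy : y ∈ Ω
      · rw [indicator_of_mem hy]
      · rw [indicator_of_notMem hy, hg0 y hy, zero_mul]
    have hgP : Measurable fun y => g y * P k y := hg.mul (hPm k)
    rw [e, ← lintegral_indicator (hSm k), ← lintegral_add_right _ (hgP.indicator (hSm k))]
    refine lintegral_mono fun y => ?_
    rcases le_or_gt (g y) (θ k) with h | h
    · rw [min_eq_left h]
      exact le_self_add
    · rw [indicator_of_mem (show y ∈ {y | θ k < g y} from h)]
      exact le_add_self
  have hmain : lam * ENNReal.ofReal (M * t k / 2) ≤ C₀ * ∫⁻ y, g y * P k y := by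
    rw [← hψint k]
    refine (mul_lintegral_le_of_le_on_support (hψm k) fun x hx => hψl k x hx).trans ?_
    rw [lintegral_mul_scalePotential hlm (hψm k) hg,
      ← lintegral_const_mul' _ _ ENNReal.coe_ne_top]
    refine lintegral_mono fun x => ?_
    rw [← mul_assoc]
    exact mul_le_mul_left (hle x) _
  have hfin : ENNReal.ofReal (M * t k / 2) * lam ≤ ENNReal.ofReal (M * t k / 2) *
      (C₀ * (ENNReal.ofReal C₃ * H +
        ENNReal.ofReal (V / (M * ε)) * (ENNReal.ofReal (τ k ^ ((m : ℝ) / n)) * F s))) := by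
    rw [mul_comm _ lam]
    refine hmain.trans ?_
    rw [mul_left_comm, mul_add]
    exact mul_le_mul_right (hsplit.trans (add_le_add hsmall hlarge2)) _
  rw [ENNReal.mul_le_mul_iff_right (by simpa using hMtk) ENNReal.ofReal_ne_top] at hfin
  refine hfin.trans ?_
  rw [ENNReal.coe_mul, mul_assoc]
  refine mul_le_mul_right ?_ _
  rw [mul_add (ENNReal.ofNNReal _)]
  refine add_le_add (mul_le_mul_left ?_ _) (mul_le_mul_left ?_ _)
  · exact ENNReal.ofReal_le_ofReal (le_add_of_nonneg_right (by positivity))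
  · exact ENNReal.ofReal_le_ofReal (le_add_of_nonneg_left hC₃.le)

end Interpolation

/-- Absorbing a decreasing remainder, available at every point below `τ / 2`, into a Hardy-type
integral. -/
theorem le_setLIntegral_of_forall_lt_half {b τ e : ℝ} (hb : b ≤ 1) (hτ0 : 0 < τ)
    (hτ1 : τ ≤ 1) (he : e ≤ τ / 4) {C : ℝ≥0} {x : ℝ≥0∞} {G F : ℝ → ℝ≥0∞}
    (hG : Measurable G)
    (hx : ∀ s, s < τ / 2 → x ≤ C * ((∫⁻ r in Ioo (τ / 2) 1, ENNReal.ofReal (r ^ (b - 1)) * G r) +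
      ENNReal.ofReal (τ ^ b) * F s)) :
    x ≤ (4 * C : ℝ≥0) * ∫⁻ r in Ioo e 1, ENNReal.ofReal (r ^ (b - 1)) * (G r + F r) := by
  set H := ∫⁻ r in Ioo (τ / 2) 1, ENNReal.ofReal (r ^ (b - 1)) * G r
  set J := ∫⁻ r in Ioo (τ / 4) (τ / 2), ENNReal.ofReal (r ^ (b - 1)) * F r
  have hw : Measurable fun r : ℝ => ENNReal.ofReal (r ^ (b - 1)) := by fun_prop
  have hτb : 0 < τ ^ b := Real.rpow_pos_of_pos hτ0 b
  have hpow : τ ^ b / 4 ≤ (τ / 2) ^ b / 2 := by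
    rw [Real.div_rpow hτ0.le (by norm_num)]
    have h2 : (2 : ℝ) ^ b ≤ 2 := by
      simpa using Real.rpow_le_rpow_of_exponent_le (by norm_num : (1 : ℝ) ≤ 2) hb
    have h20 : (0 : ℝ) < 2 ^ b := by positivity
    rw [div_div, div_le_div_iff₀ (by norm_num) (by positivity)]
    nlinarith
  have hL : x - C * H ≤ 4 * C * J := by
    have h1 : ENNReal.ofReal (τ ^ b / 4) * (x - C * H) ≤ ENNReal.ofReal (τ ^ b) * (C * J) := by
      calc ENNReal.ofReal (τ ^ b / 4) * (x - C * H)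
          ≤ (∫⁻ s in Ioo (τ / 4) (τ / 2), ENNReal.ofReal (s ^ (b - 1))) * (x - C * H) :=
            mul_le_mul_left ((ENNReal.ofReal_le_ofReal hpow).trans
              (ofReal_rpow_half_le_setLIntegral hb (by positivity) (by linarith))) _
        _ = ∫⁻ s in Ioo (τ / 4) (τ / 2), ENNReal.ofReal (s ^ (b - 1)) * (x - C * H) :=
            (lintegral_mul_const _ hw).symm
        _ ≤ ∫⁻ s in Ioo (τ / 4) (τ / 2),
            (ENNReal.ofReal (τ ^ b) * C) * (ENNReal.ofReal (s ^ (b - 1)) * F s) := by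
            refine setLIntegral_mono' measurableSet_Ioo fun s hs => ?_
            have : x - C * H ≤ C * (ENNReal.ofReal (τ ^ b) * F s) := by
              rw [tsub_le_iff_left, ← mul_add]
              exact hx s hs.2
            refine (mul_le_mul_right this _).trans (le_of_eq ?_)
            ring
        _ = ENNReal.ofReal (τ ^ b) * (C * J) := by
            rw [lintegral_const_mul' _ _ (by finiteness), mul_assoc]
    have h4 : ENNReal.ofReal (τ ^ b) = 4 * ENNReal.ofReal (τ ^ b / 4) := by
      rw [show (4 : ℝ≥0∞) = ENNReal.ofReal 4 by simp, ← ENNReal.ofReal_mul (by norm_num)]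
      congr 1
      ring
    rw [h4, mul_comm 4, mul_assoc, ENNReal.mul_le_mul_iff_right
      (by simpa using hτb) ENNReal.ofReal_ne_top] at h1
    rwa [← mul_assoc] at h1
  have hH : H ≤ ∫⁻ r in Ioo e 1, ENNReal.ofReal (r ^ (b - 1)) * G r :=
    lintegral_mono_set (Ioo_subset_Ioo_left (by linarith))
  have hJ : J ≤ ∫⁻ r in Ioo e 1, ENNReal.ofReal (r ^ (b - 1)) * F r :=
    lintegral_mono_set (Ioo_subset_Ioo he (by linarith))
  have hsum : ∫⁻ r in Ioo e 1, ENNReal.ofReal (r ^ (b - 1)) * (G r + F r) =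
      (∫⁻ r in Ioo e 1, ENNReal.ofReal (r ^ (b - 1)) * G r) +
        ∫⁻ r in Ioo e 1, ENNReal.ofReal (r ^ (b - 1)) * F r := by
    simp_rw [mul_add]
    exact lintegral_add_left (hw.mul hG) _
  calc x ≤ C * H + 4 * C * J := tsub_le_iff_left.mp hL
    _ ≤ 4 * C * H + 4 * C * J := by
      gcongr
      exact le_mul_of_one_le_left (by positivity) (by norm_num)
    _ = (4 * C : ℝ≥0) * (H + J) := by
      push_cast
      rw [mul_add]
    _ ≤ _ := by
      rw [hsum]
      gcongr

theorem S1_antitoneOn {n m : ℕ} {d : ℝ} (hd : 0 ≤ (n : ℝ) / d) (f : ℝ → ℝ≥0∞) :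
    AntitoneOn (S1 n m d f) (Ioo 0 1) := fun _ ha _ _ hab =>
  lintegral_mono_set (Ioo_subset_Ioo_left (Real.rpow_le_rpow ha.1.le hab hd))

theorem rearr_eq_levelRearr_enorm {α E : Type*} [MeasurableSpace α] [NormedAddCommGroup E]
    (ν : Measure α) (u : α → E) (s : ℝ) :
    rearr ν (fun x => ‖u x‖) s = levelRearr ν (fun x => ‖u x‖ₑ) s := by
  simp only [rearr, levelRearr, abs_norm, ofReal_norm]

theorem rearr_eq_levelRearr {α : Type*} [MeasurableSpace α] (ν : Measure α) (u : α → ℝ) (s : ℝ) :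
    rearr ν u s = levelRearr ν (fun x => ‖u x‖ₑ) s := by
  simp only [rearr, levelRearr, Real.enorm_eq_ofReal_abs]

theorem IsRINorm.rearr_zero_measure {N : (ℝ → ℝ≥0∞) → ℝ≥0∞} (hN : IsRINorm N) {α : Type*}
    [MeasurableSpace α] (u : α → ℝ) (c : ℝ) :
    N (fun t => rearr (0 : Measure α) u (c * t)) = 0 := by
  refine (hN.eq_zero_iff _).mpr (Filter.Eventually.of_forall fun t => ?_)
  rw [rearr_eq_levelRearr]
  exact levelRearr_eq_zero_of_le (by simp)

/-- **Reduction principle for fast decaying measures (`d ∈ [n-m, n]`):** the one-dimensional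
Hardy-type inequality for `S₁` implies the `m`-th order Sobolev trace inequality
`‖u‖_{Y(Ω,μ)} ≤ C₂ ‖∇^m u‖_{X(Ω)}` for every `d`-Frostman measure `μ` on `Ω`. -/
theorem reduction_principle_fast (n m : ℕ) (hn : 2 ≤ n) (hm : 1 ≤ m) (hmn : m < n)
    (d : ℝ) (hd1 : (n : ℝ) - m ≤ d) (hd2 : d ≤ n)
    (Ω : Set (EuclideanSpace ℝ (Fin n))) (hΩ : IsOpen Ω) (hΩvol : volume Ω < ⊤)
    (NX NY : (ℝ → ℝ≥0∞) → ℝ≥0∞) (hX : IsRINorm NX) (hY : IsRINorm NY)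
    (μ : Measure (EuclideanSpace ℝ (Fin n))) (hfin : IsFiniteMeasure μ) (hsupp : μ Ωᶜ = 0)
    (hFrostman : ∃ A : ℝ, ∀ (x : EuclideanSpace ℝ (Fin n)) (r : ℝ), 0 < r →
        μ (Metric.ball x r ∩ Ω) ≤ ENNReal.ofReal (A * r ^ d))
    (C₁ : ℝ)
    (hHardy : ∀ f : ℝ → ℝ≥0∞, Measurable f → AntitoneOn f (Set.Ioo 0 1) →
        NY (S1 n m d f) ≤ ENNReal.ofReal C₁ * NX f) :
    ∃ C₂ : ℝ, ∀ u : EuclideanSpace ℝ (Fin n) → ℝ,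
      ContDiff ℝ (⊤ : ℕ∞) u → HasCompactSupport u → tsupport u ⊆ Ω →
      NY (fun t => rearr μ u ((μ Ω).toReal * t)) ≤
        ENNReal.ofReal C₂ *
          NX (fun t => rearr (volume.restrict Ω) (fun x => ‖iteratedFDeriv ℝ m u x‖)
            ((volume Ω).toReal * t)) := by
  rcases eq_or_ne μ 0 with rfl | hμ0
  · exact ⟨0, fun u _ _ _ => (hY.rearr_zero_measure u _).trans_le (by positivity)⟩
  have hμΩ : μ univ = μ Ω := by
    refine le_antisymm ?_ (measure_mono (subset_univ _))
    rw [← union_compl_self Ω]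
    exact (measure_union_le _ _).trans (by rw [hsupp, add_zero])
  have hM : 0 < (μ Ω).toReal :=
    ENNReal.toReal_pos (by rwa [← hμΩ, Measure.measure_univ_ne_zero]) (measure_ne_top _ _)
  have hΩne : Ω.Nonempty := by
    rw [nonempty_iff_ne_empty]
    rintro rfl
    simp at hM
  have hV : 0 < (volume Ω).toReal :=
    ENNReal.toReal_pos (hΩ.measure_pos volume hΩne).ne' hΩvol.ne
  obtain ⟨A, hA⟩ := hFrostman
  have hd0 : 0 < d := by
    have : ((m + 1 : ℕ) : ℝ) ≤ n := by exact_mod_cast hmn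
    push_cast at this
    linarith
  have hnd : 1 ≤ (n : ℝ) / d := by rwa [one_le_div hd0]
  have hb : (m : ℝ) / n ≤ 1 := by
    rw [div_le_one (by linarith)]
    exact_mod_cast hmn.le
  have hA' : ∀ (x : EuclideanSpace ℝ (Fin n)) (r : ℝ), 0 < r →
      μ (Metric.ball x r) ≤ ENNReal.ofReal (max A 0 * r ^ d) := by
    intro x r hr
    calc μ (Metric.ball x r) ≤ μ (Metric.ball x r ∩ Ω) + μ Ωᶜ := by
          refine (measure_mono ?_).trans (measure_union_le _ _)
          intro y hy
          by_cases h : y ∈ Ω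
          · exact Or.inl ⟨hy, h⟩
          · exact Or.inr h
      _ ≤ ENNReal.ofReal (max A 0 * r ^ d) := by
          rw [hsupp, add_zero]
          refine (hA x r hr).trans (ENNReal.ofReal_le_ofReal ?_)
          gcongr
          exact le_max_left _ _
  obtain ⟨C, hC⟩ := hX.exists_levelRearr_le hm hmn hd1 hd2 hΩ.measurableSet hV
    (ENNReal.ofReal_toReal hΩvol.ne).symm hM
    (hμΩ.trans (ENNReal.ofReal_toReal (measure_ne_top _ _)).symm) (le_max_right A 0) hA'
  refine ⟨512 * C * max C₁ 0, fun u hu huc hus => ?_⟩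
  obtain ⟨F, hF, hFN, hk⟩ := hC u hu huc hus
  simp_rw [rearr_eq_levelRearr_enorm, rearr_eq_levelRearr μ]
  set G : ℝ → ℝ≥0∞ := fun t => levelRearr (volume.restrict Ω)
    (fun x => ‖iteratedFDeriv ℝ m u x‖ₑ) ((volume Ω).toReal * t)
  have hG : Antitone G := fun a b hab =>
    levelRearr_antitone _ _ (mul_le_mul_of_nonneg_left hab hV.le)
  have hGF : Antitone fun t => G t + F t := hG.add hF
  have hpt : ∀ t ∈ Ioo (0 : ℝ) 1, levelRearr μ (fun x => ‖u x‖ₑ) ((μ Ω).toReal * t) ≤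
      (4 * C : ℝ≥0) * S1 n m d (fun s => G s + F s) (t / 8) := by
    intro t ht
    obtain ⟨k, hk1, hk2⟩ := IsRINorm.exists_dyadic ht
    have htk : (0 : ℝ) < (1 / 2) ^ (k + 1) := by positivity
    refine (levelRearr_antitone _ _ (mul_le_mul_of_nonneg_left hk1 hM.le)).trans ?_
    refine le_setLIntegral_of_forall_lt_half hb (Real.rpow_pos_of_pos htk _)
      (Real.rpow_le_one htk.le (pow_le_one₀ (by norm_num) (by norm_num)) (by linarith)) ?_
      hG.measurable (hk k)
    have h4 : t / 8 ≤ (1 / 2) ^ (k + 1) * (1 / 4) := by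
      rw [pow_succ]
      linarith
    refine (Real.rpow_le_rpow (by linarith [ht.1]) h4 (by linarith)).trans ?_
    rw [Real.mul_rpow htk.le (by norm_num), div_eq_mul_inv (_ ^ _) (4 : ℝ)]
    refine mul_le_mul_of_nonneg_left ?_ (Real.rpow_pos_of_pos htk _).le
    simpa using Real.rpow_le_rpow_of_exponent_ge (by norm_num : (0 : ℝ) < 1 / 4)
      (by norm_num) hnd
  calc NY (fun t => levelRearr μ (fun x => ‖u x‖ₑ) ((μ Ω).toReal * t))
      ≤ NY (fun t => (4 * C : ℝ≥0) * S1 n m d (fun s => G s + F s) (t / 8)) :=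
        hY.mono _ _ (ae_restrict_of_forall_mem measurableSet_Ioo hpt)
    _ ≤ (4 * C : ℝ≥0) * (64 * (ENNReal.ofReal C₁ * (NX G + NX F))) := by
        rw [hY.smul]
        refine mul_le_mul_right ((hY.dilation_eighth_le
          (S1_antitoneOn (by linarith) _)).trans (mul_le_mul_right ?_ _)) _
        exact (hHardy _ hGF.measurable (hGF.antitoneOn _)).trans
          (mul_le_mul_right (hX.add_le _ _) _)
    _ ≤ (4 * C : ℝ≥0) * (64 * (ENNReal.ofReal C₁ * (NX G + NX G))) := by
        gcongr
    _ = ENNReal.ofReal (512 * C * max C₁ 0) * NX G := by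
        rw [ENNReal.ofReal_mul (by positivity), ENNReal.ofReal_mul (by norm_num),
          ENNReal.ofReal_coe_nnreal, ENNReal.ofReal_max, ENNReal.ofReal_zero, max_eq_left zero_le,
          ENNReal.ofReal_ofNat]
        push_cast
        ring
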